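/- (Estimate (2.10) for the non-harmonic part of the pressure.) Let 0 < ϱ ≤ 1 and let v ∈ L_∞(-ϱ²,0;L₂(B(ϱ))) with weak spatial gradient ∇v ∈ L₂(Q(ϱ)). For a.e. t ∈ (-ϱ²,0) set c_ϱ(t) = [v(·,t)]_{B(ϱ)}, τ(x,t) = (v(x,t)−c_ϱ(t))⊗(v(x,t)−c_ϱ(t)) and let τ_ϱ(t) be the average of τ(·,t) over B(ϱ). Suppose p₁:B(ϱ)×(-ϱ²,0)→ℝ is measurable, p₁(·,t) ∈ L_{3/2}(B(ϱ)) for a.e. t, and for a.e. t the variational identity ∫_{B(ϱ)} p₁(x,t) Δφ(x) dx = −∫_{B(ϱ)} (τ(x,t)−τ_ϱ(t)) : ∇²φ(x) dx holds for every φ ∈ C²(cl B(ϱ)) with φ = 0 on ∂B(ϱ). Then there is a universal constant c > 0 such that (1/ϱ²) ∫_{-ϱ²}^0 ∫_{B(ϱ)} |p₁|^{3/2} dx dt ≤ c E(ϱ) A^{1/2}(ϱ). -/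

import Mathlib

open MeasureTheory Metric Set

noncomputable section

/-- Three-dimensional Euclidean space. -/
abbrev E3 := EuclideanSpace ℝ (Fin 3)

/-- The open ball `B(r) ⊆ ℝ³` of radius `r` centered at the origin. -/
def ballB (r : ℝ) : Set E3 := Metric.ball (0 : E3) r

/-- The time interval `(-r², 0)`. -/
def timeI (r : ℝ) : Set ℝ := Set.Ioo (-r ^ 2) 0

/-- The parabolic cylinder `Q(r) = B(r) × (-r², 0)`. -/
def QSet (r : ℝ) : Set (E3 × ℝ) := ballB r ×ˢ timeI r

/-- The mean value `[f]_{B(r)}` of a function over the ball `B(r)`. -/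
def avgB (r : ℝ) (f : E3 → ℝ) : ℝ := ⨍ x in ballB r, f x

/-- `A(r) = ess sup_{-r²<t<0} (1/r) ∫_{B(r)} |v(x,t)|² dx`. -/
def funA (v : E3 → ℝ → E3) (r : ℝ) : ℝ :=
  essSup (fun t => (1 / r) * ∫ x in ballB r, ‖v x t‖ ^ 2)
    (volume.restrict (timeI r))

/-- `E(r) = (1/r) ∫_{Q(r)} |∇v|² dz`, where `gv` is the (weak) spatial gradient of `v`. -/
def funE (gv : E3 → ℝ → Fin 3 → Fin 3 → ℝ) (r : ℝ) : ℝ :=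
  (1 / r) * ∫ t in timeI r, ∫ x in ballB r, ∑ i, ∑ j, (gv x t i j) ^ 2

/-- `C(r) = (1/r²) ∫_{Q(r)} |v|³ dz`. -/
def funC (v : E3 → ℝ → E3) (r : ℝ) : ℝ :=
  (1 / r ^ 2) * ∫ t in timeI r, ∫ x in ballB r, ‖v x t‖ ^ 3

/-- `D₀(r) = (1/r²) ∫_{Q(r)} |p - [p]_{B(r)}|^{3/2} dz`. -/
def funD0 (p : E3 → ℝ → ℝ) (r : ℝ) : ℝ :=
  (1 / r ^ 2) * ∫ t in timeI r, ∫ x in ballB r,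
    |p x t - avgB r (fun y => p y t)| ^ ((3 : ℝ) / 2)

/-- The `j`-th spatial coordinate direction in space-time `ℝ³ × ℝ`. -/
def spaceDir (j : Fin 3) : E3 × ℝ := (EuclideanSpace.single j (1 : ℝ), 0)

/-- The time direction in space-time `ℝ³ × ℝ`. -/
def timeDir : E3 × ℝ := (0, 1)

/-- The spatial Laplacian of a space-time test function. -/
def lapSpace (φ : E3 × ℝ → ℝ) (z : E3 × ℝ) : ℝ :=
  ∑ j, fderiv ℝ (fun w => fderiv ℝ φ w (spaceDir j)) z (spaceDir j)

/-- `gv` is the weak spatial gradient of `v` on `B(ϱ)`, for a.e. time in `(-ϱ², 0)`: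
integration by parts against smooth test functions compactly supported in `B(ϱ)`. -/
def IsWeakSpatialGradient (v : E3 → ℝ → E3) (gv : E3 → ℝ → Fin 3 → Fin 3 → ℝ)
    (ϱ : ℝ) : Prop :=
  ∀ᵐ t ∂(volume.restrict (timeI ϱ)),
    ∀ φ : E3 → ℝ, ContDiff ℝ (⊤ : ℕ∞) φ → tsupport φ ⊆ ballB ϱ →
      ∀ i j, ∫ x in ballB ϱ, v x t i * fderiv ℝ φ x (EuclideanSpace.single j (1 : ℝ))
        = - ∫ x in ballB ϱ, gv x t i j * φ x

/-- The regularity class `v ∈ L_∞(-ϱ²,0;L₂(B(ϱ))) ∩ L₂(-ϱ²,0;W¹₂(B(ϱ)))`,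
with weak spatial gradient `gv ∈ L₂(Q(ϱ))`. -/
structure VelocityClass (v : E3 → ℝ → E3) (gv : E3 → ℝ → Fin 3 → Fin 3 → ℝ)
    (ϱ : ℝ) : Prop where
  v_meas : AEMeasurable (fun z : E3 × ℝ => v z.1 z.2) (volume.restrict (QSet ϱ))
  v_L2 : IntegrableOn (fun z : E3 × ℝ => ‖v z.1 z.2‖ ^ 2) (QSet ϱ)
  v_Linfty : ∃ M : ℝ, ∀ᵐ t ∂(volume.restrict (timeI ϱ)),
      (∫ x in ballB ϱ, ‖v x t‖ ^ 2) ≤ M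
  grad_L2 : IntegrableOn (fun z : E3 × ℝ => ∑ i, ∑ j, (gv z.1 z.2 i j) ^ 2) (QSet ϱ)
  isGrad : IsWeakSpatialGradient v gv ϱ

/-- The Navier–Stokes equations hold in `Q = Q(1)` in the sense of distributions. -/
def NSEDistrib (v : E3 → ℝ → E3) (gv : E3 → ℝ → Fin 3 → Fin 3 → ℝ)
    (p : E3 → ℝ → ℝ) : Prop :=
  (∀ φ : E3 × ℝ → E3, ContDiff ℝ (⊤ : ℕ∞) φ → tsupport φ ⊆ QSet 1 →
    (∫ z in QSet 1,
      ((∑ i, v z.1 z.2 i * fderiv ℝ (fun w => φ w i) z timeDir)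
        + (∑ i, ∑ j, v z.1 z.2 i * v z.1 z.2 j * fderiv ℝ (fun w => φ w i) z (spaceDir j))
        - (∑ i, ∑ j, gv z.1 z.2 i j * fderiv ℝ (fun w => φ w i) z (spaceDir j))
        + p z.1 z.2 * (∑ i, fderiv ℝ (fun w => φ w i) z (spaceDir i)))) = 0)
  ∧
  (∀ q : E3 × ℝ → ℝ, ContDiff ℝ (⊤ : ℕ∞) q → tsupport q ⊆ QSet 1 →
    (∫ z in QSet 1, ∑ i, v z.1 z.2 i * fderiv ℝ q z (spaceDir i)) = 0)

/-- The parabolic boundary of `Q = B(1) × (-1,0)`. -/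
def parabBdry : Set (E3 × ℝ) :=
  (Metric.sphere (0 : E3) 1 ×ˢ Set.Icc (-1 : ℝ) 0)
    ∪ (Metric.closedBall (0 : E3) 1 ×ˢ {(-1 : ℝ)})

/-- The local energy inequality for a suitable weak solution on `Q = Q(1)`. -/
def LocalEnergyIneq (v : E3 → ℝ → E3) (gv : E3 → ℝ → Fin 3 → Fin 3 → ℝ)
    (p : E3 → ℝ → ℝ) : Prop :=
  ∀ᵐ t ∂(volume.restrict (Set.Ioo (-1 : ℝ) 0)),
    ∀ φ : E3 × ℝ → ℝ, ContDiff ℝ (⊤ : ℕ∞) φ → (∀ z, 0 ≤ φ z) →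
      (∃ U : Set (E3 × ℝ), IsOpen U ∧ parabBdry ⊆ U ∧ ∀ z ∈ U, φ z = 0) →
      (∫ x in ballB 1, φ (x, t) * ‖v x t‖ ^ 2)
        + 2 * ∫ s in Set.Ioo (-1 : ℝ) t, ∫ x in ballB 1,
            φ (x, s) * ∑ i, ∑ j, (gv x s i j) ^ 2
      ≤ ∫ s in Set.Ioo (-1 : ℝ) t, ∫ x in ballB 1,
          (‖v x s‖ ^ 2 * (lapSpace φ (x, s) + fderiv ℝ φ (x, s) timeDir)
            + (∑ i, v x s i * fderiv ℝ φ (x, s) (spaceDir i)) * (‖v x s‖ ^ 2 + 2 * p x s))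

/-- `(v, p)` is a suitable weak solution of the Navier–Stokes equations in `Q = Q(1)`,
with `gv` the weak spatial gradient of `v`. -/
structure SuitableWeakSolution (v : E3 → ℝ → E3) (gv : E3 → ℝ → Fin 3 → Fin 3 → ℝ)
    (p : E3 → ℝ → ℝ) : Prop where
  vel : VelocityClass v gv 1
  p_meas : AEMeasurable (fun z : E3 × ℝ => p z.1 z.2) (volume.restrict (QSet 1))
  p_L32 : IntegrableOn (fun z : E3 × ℝ => |p z.1 z.2| ^ ((3 : ℝ) / 2)) (QSet 1)
  nse : NSEDistrib v gv p
  lei : LocalEnergyIneq v gv p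

/-- The open unit ball of `ℝ³`. -/
abbrev unitB : Set E3 := ball (0 : E3) 1

/-- The `j`-th partial derivative of a scalar function on `ℝ³`. -/
def pd (j : Fin 3) (f : E3 → ℝ) (x : E3) : ℝ :=
  fderiv ℝ f x (EuclideanSpace.single j (1 : ℝ))

lemma continuous_pd {f : E3 → ℝ} (hf : ContDiff ℝ 1 f) (j : Fin 3) : Continuous (pd j f) :=
  (hf.continuous_fderiv (by norm_num)).clm_apply continuous_const

lemma pd_mul {f g : E3 → ℝ} {x : E3} (hf : DifferentiableAt ℝ f x) (hg : DifferentiableAt ℝ g x)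
    (j : Fin 3) : pd j (fun y => f y * g y) x = f x * pd j g x + g x * pd j f x := by
  simp [pd, fderiv_fun_mul hf hg]

lemma pd_add {f g : E3 → ℝ} {x : E3} (hf : DifferentiableAt ℝ f x) (hg : DifferentiableAt ℝ g x)
    (j : Fin 3) : pd j (fun y => f y + g y) x = pd j f x + pd j g x := by
  simp [pd, fderiv_fun_add hf hg]

lemma pd_sub {f g : E3 → ℝ} {x : E3} (hf : DifferentiableAt ℝ f x) (hg : DifferentiableAt ℝ g x)
    (j : Fin 3) : pd j (fun y => f y - g y) x = pd j f x - pd j g x := by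
  simp [pd, fderiv_fun_sub hf hg]

lemma pd_neg {f : E3 → ℝ} {x : E3} (j : Fin 3) : pd j (fun y => - f y) x = - pd j f x := by
  simp [pd, fderiv_fun_neg]

lemma pd_sum {ι : Type*} (s : Finset ι) {f : ι → E3 → ℝ} {x : E3}
    (hf : ∀ i ∈ s, DifferentiableAt ℝ (f i) x) (j : Fin 3) :
    pd j (fun y => ∑ i ∈ s, f i y) x = ∑ i ∈ s, pd j (f i) x := by
  simp [pd, fderiv_fun_sum hf]

lemma pd_const (c : ℝ) (j : Fin 3) (x : E3) : pd j (fun _ => c) x = 0 := by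
  simp [pd]

lemma hasFDerivAt_coord (i : Fin 3) (x : E3) :
    HasFDerivAt (fun y : E3 => y i) (EuclideanSpace.proj i : E3 →L[ℝ] ℝ) x :=
  (EuclideanSpace.proj i : E3 →L[ℝ] ℝ).hasFDerivAt

lemma contDiff_coord {n : WithTop ℕ∞} (i : Fin 3) : ContDiff ℝ n (fun y : E3 => y i) :=
  (EuclideanSpace.proj i : E3 →L[ℝ] ℝ).contDiff

lemma pd_coord (i j : Fin 3) (x : E3) : pd j (fun y => y i) x = if i = j then 1 else 0 := by
  simp [pd, (hasFDerivAt_coord i x).fderiv]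

/-- The defining function `1 - |x|²` of the unit ball. -/
def bdef (x : E3) : ℝ := 1 - ∑ i, x i ^ 2

lemma bdef_eq (x : E3) : bdef x = 1 - ‖x‖ ^ 2 := by
  simp [bdef, EuclideanSpace.norm_sq_eq]

lemma contDiff_bdef {n : WithTop ℕ∞} : ContDiff ℝ n bdef :=
  contDiff_const.sub (ContDiff.sum fun i _ => (contDiff_coord i).pow 2)

lemma pd_bdef (j : Fin 3) (x : E3) : pd j bdef x = -2 * x j := by
  have h : bdef = fun y => 1 - ∑ i, y i * y i := by
    ext y; simp [bdef, sq]
  have hd : ∀ i, DifferentiableAt ℝ (fun y : E3 => y i) x := fun i =>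
    (hasFDerivAt_coord i x).differentiableAt
  rw [h, pd_sub (by fun_prop) (by fun_prop), pd_const, pd_sum _ (fun i _ => (hd i).fun_mul (hd i))]
  simp_rw [pd_mul (hd _) (hd _), pd_coord]
  simp [Finset.sum_add_distrib]; ring

lemma bdef_pos {x : E3} (hx : x ∈ unitB) : 0 < bdef x := by
  rw [mem_ball_zero_iff] at hx
  rw [bdef_eq]; nlinarith [norm_nonneg x]

lemma bdef_nonpos {x : E3} (hx : x ∉ unitB) : bdef x ≤ 0 := by
  rw [mem_ball_zero_iff, not_lt] at hx
  rw [bdef_eq]; nlinarith [norm_nonneg x]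

lemma bdef_sphere {x : E3} (hx : x ∈ sphere (0 : E3) 1) : bdef x = 0 := by
  rw [mem_sphere_zero_iff_norm] at hx
  rw [bdef_eq, hx]; norm_num

lemma Continuous.integrableOn_unitB {F : Type*} [NormedAddCommGroup F] {f : E3 → F}
    (hf : Continuous f) : IntegrableOn f unitB :=
  (hf.continuousOn.integrableOn_compact (isCompact_closedBall (0 : E3) 1)).mono_set
    ball_subset_closedBall

/-- Integration by parts for the divergence against a compactly supported function. -/
lemma integral_mul_div_eq {η : E3 → ℝ} (hη : ContDiff ℝ 1 η) (hc : HasCompactSupport η)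
    {G : Fin 3 → E3 → ℝ} (hG : ∀ i, ContDiff ℝ 1 (G i)) :
    ∫ x, η x * ∑ i, pd i (G i) x = - ∫ x, ∑ i, pd i η x * G i x := by
  have hcd : ∀ i, HasCompactSupport (pd i η) := fun i =>
    hc.fderiv_apply (𝕜 := ℝ) (EuclideanSpace.single i (1 : ℝ))
  have h1 : ∀ i, Integrable (fun x => η x * pd i (G i) x) := fun i =>
    (hη.continuous.mul (continuous_pd (hG i) i)).integrable_of_hasCompactSupport hc.mul_right
  have h2 : ∀ i, Integrable (fun x => pd i η x * G i x) := fun i =>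
    ((continuous_pd hη i).mul (hG i).continuous).integrable_of_hasCompactSupport (hcd i).mul_right
  have h3 : ∀ i, Integrable (fun x => η x * G i x) := fun i =>
    (hη.continuous.mul (hG i).continuous).integrable_of_hasCompactSupport hc.mul_right
  simp_rw [Finset.mul_sum]
  rw [integral_finsetSum _ (fun i _ => h1 i), integral_finsetSum _ (fun i _ => h2 i),
    ← Finset.sum_neg_distrib]
  refine Finset.sum_congr rfl fun i _ => ?_
  exact integral_mul_fderiv_eq_neg_fderiv_mul_of_integrable (h2 i) (h1 i) (h3 i)
    (fun x _ => (hη.differentiable (by norm_num)) x)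
    (fun x _ => ((hG i).differentiable (by norm_num)) x)

/-- Smooth cutoffs of the unit ball. -/
def cutB (ε : ℝ) (x : E3) : ℝ := Real.smoothTransition (bdef x / ε)

lemma contDiff_cutB (ε : ℝ) : ContDiff ℝ 1 (cutB ε) :=
  (Real.smoothTransition.contDiff (n := 1)).comp (contDiff_bdef.div_const ε)

lemma cutB_nonneg (ε : ℝ) (x : E3) : 0 ≤ cutB ε x := Real.smoothTransition.nonneg _

lemma cutB_le_one (ε : ℝ) (x : E3) : cutB ε x ≤ 1 := Real.smoothTransition.le_one _

lemma cutB_eq_zero {ε : ℝ} (hε : 0 < ε) {x : E3} (hx : x ∉ unitB) : cutB ε x = 0 :=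
  Real.smoothTransition.zero_of_nonpos (div_nonpos_of_nonpos_of_nonneg (bdef_nonpos hx) hε.le)

lemma hasCompactSupport_cutB {ε : ℝ} (hε : 0 < ε) : HasCompactSupport (cutB ε) :=
  HasCompactSupport.intro (isCompact_closedBall (0 : E3) 1) fun _ hx =>
    cutB_eq_zero hε fun h => hx (ball_subset_closedBall h)

/-- The derivative of the cutoff profile. -/
def cutD (ε : ℝ) (x : E3) : ℝ := deriv Real.smoothTransition (bdef x / ε) / ε

lemma pd_cutB (ε : ℝ) (i : Fin 3) (x : E3) :
    pd i (cutB ε) x = - (cutD ε x * (2 * x i)) := by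
  have h1 : HasDerivAt Real.smoothTransition (deriv Real.smoothTransition (bdef x / ε))
      (bdef x / ε) :=
    ((Real.smoothTransition.contDiff (n := 1)).differentiable (by norm_num) _).hasDerivAt
  have h2 : HasFDerivAt (fun y => bdef y / ε) (ε⁻¹ • fderiv ℝ bdef x) x := by
    have := ((contDiff_bdef (n := 1)).differentiable (by norm_num) x).hasFDerivAt.const_mul ε⁻¹
    simpa [div_eq_inv_mul] using this
  have h3 := h1.comp_hasFDerivAt x h2
  have h4 : pd i bdef x = -2 * x i := pd_bdef i x
  simp only [pd] at h4 ⊢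
  have h5 : fderiv ℝ (cutB ε) x = _ := h3.fderiv
  rw [h5]
  simp [h4, cutD]; ring

lemma cutD_nonneg {ε : ℝ} (hε : 0 < ε) (x : E3) : 0 ≤ cutD ε x :=
  div_nonneg Real.smoothTransition.monotone.deriv_nonneg hε.le

lemma continuous_cutD (ε : ℝ) : Continuous (cutD ε) :=
  (((Real.smoothTransition.contDiff (n := 1)).continuous_deriv (by norm_num)).comp
    ((contDiff_bdef (n := 1)).continuous.div_const ε)).div_const ε

lemma cutD_eq_zero {ε : ℝ} (hε : 0 < ε) {x : E3} (hx : bdef x < 0 ∨ ε < bdef x) :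
    cutD ε x = 0 := by
  have : deriv Real.smoothTransition (bdef x / ε) = 0 := by
    rcases hx with hx | hx
    · have h : Real.smoothTransition =ᶠ[nhds (bdef x / ε)] fun _ => 0 := by
        filter_upwards [Iio_mem_nhds (div_neg_of_neg_of_pos hx hε)] with y hy
        exact Real.smoothTransition.zero_of_nonpos (le_of_lt hy)
      rw [h.deriv_eq]; simp
    · have h : Real.smoothTransition =ᶠ[nhds (bdef x / ε)] fun _ => 1 := by
        filter_upwards [Ioi_mem_nhds ((one_lt_div hε).2 hx)] with y hy
        exact Real.smoothTransition.one_of_one_le (le_of_lt hy)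
      rw [h.deriv_eq]; simp
  simp [cutD, this]

lemma hasCompactSupport_cutD {ε : ℝ} (hε : 0 < ε) : HasCompactSupport (cutD ε) :=
  HasCompactSupport.intro (isCompact_closedBall (0 : E3) 1) fun x hx =>
    cutD_eq_zero hε <| Or.inl <| by
      rw [mem_closedBall_zero_iff, not_le] at hx
      rw [bdef_eq]; nlinarith

lemma integral_cutB_mul_div {ε : ℝ} (hε : 0 < ε)
    {G : Fin 3 → E3 → ℝ} (hG : ∀ i, ContDiff ℝ 1 (G i)) :
    ∫ x in unitB, cutB ε x * ∑ i, pd i (G i) x = ∫ x, cutD ε x * (2 * ∑ i, x i * G i x) := by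
  rw [setIntegral_eq_integral_of_forall_compl_eq_zero
    (fun x hx => by rw [cutB_eq_zero hε hx, zero_mul]),
    integral_mul_div_eq (contDiff_cutB ε) (hasCompactSupport_cutB hε) hG, ← integral_neg]
  refine integral_congr_ae (Filter.Eventually.of_forall fun x => ?_)
  simp only [pd_cutB, Finset.mul_sum, ← Finset.sum_neg_distrib]
  exact Finset.sum_congr rfl fun i _ => by ring

lemma integral_cutD_le {ε : ℝ} (hε : 0 < ε) (hε2 : ε ≤ 1 / 2) :
    ∫ x, cutD ε x ≤ 3 * volume.real unitB := by
  have h := integral_cutB_mul_div hε (G := fun i x => x i) (fun i => contDiff_coord i)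
  simp only [pd_coord, if_true, Finset.sum_const, Finset.card_univ, Fintype.card_fin] at h
  have h1 : ∫ x in unitB, cutB ε x * (3 • (1 : ℝ)) ≤ ∫ x in unitB, (3 : ℝ) := by
    refine setIntegral_mono_on ?_ ?_ measurableSet_ball fun x _ => ?_
    · exact ((contDiff_cutB ε).continuous.mul continuous_const).integrableOn_unitB
    · exact continuous_const.integrableOn_unitB
    · have := cutB_le_one ε x
      simp; linarith
  rw [h] at h1
  have h2 : ∫ x, cutD ε x ≤ ∫ x, cutD ε x * (2 * ∑ i, x i * x i) := by
    refine integral_mono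
      ((continuous_cutD ε).integrable_of_hasCompactSupport (hasCompactSupport_cutD hε))
      (((continuous_cutD ε).mul (by fun_prop)).integrable_of_hasCompactSupport
        (hasCompactSupport_cutD hε).mul_right) fun x => ?_
    by_cases hx : ε < bdef x
    · simp [cutD_eq_zero hε (Or.inr hx)]
    · have h3 : bdef x = 1 - ∑ i, x i * x i := by simp [bdef, sq]
      have := cutD_nonneg hε x
      have h4 : 1 ≤ 2 * ∑ i, x i * x i := by linarith
      nlinarith
  have h5 : ∫ x in unitB, (3 : ℝ) = 3 * volume.real unitB := by
    simp [mul_comm]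
  linarith

/-- A form of the divergence theorem on the unit ball: a `C¹` field pointing outwards along
the unit sphere has nonnegative total divergence. -/
lemma integral_div_nonneg {G : Fin 3 → E3 → ℝ} (hG : ∀ i, ContDiff ℝ 1 (G i))
    (h : ∀ x ∈ sphere (0 : E3) 1, 0 ≤ ∑ i, x i * G i x) :
    0 ≤ ∫ x in unitB, ∑ i, pd i (G i) x := by
  have hdiv : Continuous fun x => ∑ i, pd i (G i) x :=
    continuous_finsetSum _ fun i _ => continuous_pd (hG i) i
  have hnu : Continuous fun x : E3 => ∑ i, x i * G i x :=
    continuous_finsetSum _ fun i _ => (contDiff_coord (n := 1) i).continuous.mul (hG i).continuous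
  have key : ∀ δ > 0, ∃ ε₀ > 0, ∀ ε, 0 < ε → ε < ε₀ →
      -(6 * volume.real unitB) * δ ≤ ∫ x in unitB, cutB ε x * ∑ i, pd i (G i) x := by
    intro δ hδ
    have hK : IsCompact (closedBall (0 : E3) 1 ∩ {x | ∑ i, x i * G i x ≤ -δ}) :=
      (isCompact_closedBall (0 : E3) 1).inter_right (isClosed_le hnu continuous_const)
    obtain ⟨ε₁, hε₁, hpos⟩ : ∃ ε₁ > 0, ∀ x ∈ closedBall (0 : E3) 1 ∩ {x | ∑ i, x i * G i x ≤ -δ},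
        ε₁ ≤ bdef x := by
      rcases (closedBall (0 : E3) 1 ∩ {x | ∑ i, x i * G i x ≤ -δ}).eq_empty_or_nonempty
        with he | hne
      · exact ⟨1, one_pos, by simp [he]⟩
      · obtain ⟨x₀, hx₀, hmin⟩ := hK.exists_isMinOn hne (contDiff_bdef (n := 1)).continuous.continuousOn
        refine ⟨bdef x₀, ?_, fun x hx => hmin hx⟩
        refine bdef_pos ?_
        by_contra hb
        have hs : x₀ ∈ sphere (0 : E3) 1 := by
          have h1 := hx₀.1
          rw [mem_closedBall_zero_iff] at h1
          rw [mem_ball_zero_iff, not_lt] at hb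
          rw [mem_sphere_zero_iff_norm]
          exact le_antisymm h1 hb
        have h2 := h x₀ hs
        have h3 : ∑ i, x₀ i * G i x₀ ≤ -δ := hx₀.2
        linarith
    refine ⟨min ε₁ (1 / 2), by positivity, fun ε hε hlt => ?_⟩
    rw [integral_cutB_mul_div hε hG]
    have hInt := integral_cutD_le hε (hlt.le.trans (min_le_right _ _))
    have hmono : ∫ x, cutD ε x * (-(2 * δ)) ≤ ∫ x, cutD ε x * (2 * ∑ i, x i * G i x) := by
      refine integral_mono
        (((continuous_cutD ε).integrable_of_hasCompactSupport
          (hasCompactSupport_cutD hε)).mul_const _)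
        (((continuous_cutD ε).mul (hnu.const_mul 2)).integrable_of_hasCompactSupport
          (hasCompactSupport_cutD hε).mul_right) fun x => ?_
      by_cases hx : x ∈ closedBall (0 : E3) 1 ∩ {x | ∑ i, x i * G i x ≤ -δ}
      · have := hpos x hx
        have h2 := hlt.trans_le (min_le_left _ _)
        simp [cutD_eq_zero hε (Or.inr (h2.trans_le this))]
      · by_cases hx1 : x ∈ closedBall (0 : E3) 1
        · have h4 : -δ < ∑ i, x i * G i x := by
            by_contra hc
            exact hx ⟨hx1, not_lt.1 hc⟩
          have := cutD_nonneg hε x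
          show cutD ε x * (-(2 * δ)) ≤ cutD ε x * (2 * ∑ i, x i * G i x)
          exact mul_le_mul_of_nonneg_left (by linarith) this
        · have : cutD ε x = 0 := cutD_eq_zero hε <| Or.inl <| by
            rw [mem_closedBall_zero_iff, not_le] at hx1
            rw [bdef_eq]; nlinarith
          simp [this]
    rw [integral_mul_const] at hmono
    nlinarith
  have hlim : Filter.Tendsto (fun n : ℕ => ∫ x in unitB, cutB (1 / ((n : ℝ) + 1)) x *
      ∑ i, pd i (G i) x) Filter.atTop (nhds (∫ x in unitB, ∑ i, pd i (G i) x)) := by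
    refine tendsto_integral_of_dominated_convergence (fun x => ‖∑ i, pd i (G i) x‖) ?_ ?_ ?_ ?_
    · intro n
      exact ((contDiff_cutB _).continuous.mul hdiv).aestronglyMeasurable
    · exact hdiv.norm.integrableOn_unitB
    · intro n
      refine Filter.Eventually.of_forall fun x => ?_
      rw [norm_mul, Real.norm_of_nonneg (cutB_nonneg _ _)]
      exact mul_le_of_le_one_left (norm_nonneg _) (cutB_le_one _ _)
    · refine (ae_restrict_iff' measurableSet_ball).2 (Filter.Eventually.of_forall fun x hx => ?_)
      refine tendsto_const_nhds.congr' ?_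
      have hp := bdef_pos hx
      filter_upwards [(tendsto_one_div_add_atTop_nhds_zero_nat (𝕜 := ℝ)).eventually
        (gt_mem_nhds hp)] with n hn
      have : cutB (1 / ((n : ℝ) + 1)) x = 1 :=
        Real.smoothTransition.one_of_one_le ((one_le_div (by positivity)).2 hn.le)
      rw [this, one_mul]
  have hall : ∀ δ > 0, -(6 * volume.real unitB) * δ ≤ ∫ x in unitB, ∑ i, pd i (G i) x := by
    intro δ hδ
    obtain ⟨ε₀, hε₀, hk⟩ := key δ hδ
    refine ge_of_tendsto hlim ?_
    filter_upwards [(tendsto_one_div_add_atTop_nhds_zero_nat (𝕜 := ℝ)).eventually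
        (gt_mem_nhds hε₀)] with n hn
    exact hk _ (by positivity) hn
  have hV : 0 ≤ volume.real unitB := measureReal_nonneg
  by_contra hneg
  rw [not_le] at hneg
  have := hall (-(∫ x in unitB, ∑ i, pd i (G i) x) / (6 * volume.real unitB + 1))
    (div_pos (by linarith) (by positivity))
  rw [mul_div_assoc', div_le_iff₀ (by positivity)] at this
  nlinarith

lemma integral_div_eq_zero {G : Fin 3 → E3 → ℝ} (hG : ∀ i, ContDiff ℝ 1 (G i))
    (h : ∀ x ∈ sphere (0 : E3) 1, ∑ i, x i * G i x = 0) :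
    ∫ x in unitB, ∑ i, pd i (G i) x = 0 := by
  refine le_antisymm ?_ (integral_div_nonneg hG fun x hx => (h x hx).ge)
  have := integral_div_nonneg (G := fun i x => - G i x) (fun i => (hG i).neg) fun x hx => by
    simp [h x hx]
  simp only [pd_neg, Finset.sum_neg_distrib, integral_neg] at this
  linarith

open scoped ENNReal

lemma sq_lintegral_le {α : Type*} [MeasurableSpace α] {μ : Measure α} {f : α → ℝ≥0∞}
    (hf : AEMeasurable f μ) : (∫⁻ x, f x ∂μ) ^ 2 ≤ μ univ * ∫⁻ x, f x ^ 2 ∂μ := by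
  have h := ENNReal.lintegral_mul_norm_pow_le (μ := μ) (f := fun x => f x ^ 2) (g := fun _ => 1)
    (hf.pow_const 2) aemeasurable_const (p := 1 / 2) (q := 1 / 2) (by norm_num) (by norm_num)
    (by norm_num)
  have h2 : ∀ z : ℝ≥0∞, (z ^ 2) ^ (1 / 2 : ℝ) = z := fun z => by
    rw [← ENNReal.rpow_natCast, ← ENNReal.rpow_mul]; norm_num
  have h3 : ∀ z : ℝ≥0∞, (z ^ (1 / 2 : ℝ)) ^ 2 = z := fun z => by
    rw [← ENNReal.rpow_natCast, ← ENNReal.rpow_mul]; norm_num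
  simp only [h2, ENNReal.one_rpow, mul_one, lintegral_const, one_mul] at h
  calc (∫⁻ x, f x ∂μ) ^ 2 ≤ ((∫⁻ x, f x ^ 2 ∂μ) ^ (1 / 2 : ℝ) * (μ univ) ^ (1 / 2 : ℝ)) ^ 2 := by
        gcongr
    _ = _ := by rw [mul_pow, h3, h3, mul_comm]

lemma lintegral_comp_add_smul {H : E3 → ℝ≥0∞} (hH : Measurable H) (a : E3) {r : ℝ} (hr : 0 < r) :
    ∫⁻ y, H (a + r • y) = ENNReal.ofReal ((r ^ 3)⁻¹) * ∫⁻ y, H y := by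
  have h1 : ∫⁻ y, H (a + r • y) = ∫⁻ y, H (a + y) ∂(Measure.map (fun y => r • y) volume) := by
    rw [lintegral_map (by fun_prop) (by fun_prop)]
  rw [h1, Measure.map_addHaar_smul _ hr.ne', lintegral_smul_measure,
    lintegral_add_left_eq_self (μ := volume) H a]
  simp [abs_of_pos hr]

/-- Change of variables along segments inside a convex set. -/
lemma setLIntegral_comp_add_smul_le {H : E3 → ℝ≥0∞} (hH : Measurable H) {B : Set E3}
    (hB : MeasurableSet B) {r : ℝ} (hr : 0 < r) {a : E3} (ha : ∀ y ∈ B, a + r • y ∈ B) :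
    ∫⁻ y in B, H (a + r • y) ≤ ENNReal.ofReal ((r ^ 3)⁻¹) * ∫⁻ y in B, H y := by
  calc ∫⁻ y in B, H (a + r • y) = ∫⁻ y in B, B.indicator H (a + r • y) :=
        setLIntegral_congr_fun hB fun y hy => by simp [ha y hy]
    _ ≤ ∫⁻ y, B.indicator H (a + r • y) := setLIntegral_le_lintegral _ _
    _ = ENNReal.ofReal ((r ^ 3)⁻¹) * ∫⁻ y in B, H y := by
        rw [lintegral_comp_add_smul (hH.indicator hB) a hr, lintegral_indicator hB]

section SobolevPoincare

variable {F : Type*} [NormedAddCommGroup F] [NormedSpace ℝ F] [CompleteSpace F]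

lemma enorm_sub_sq_le {u : E3 → F} (hu : ContDiff ℝ 1 u) {x y : E3} (hx : x ∈ unitB)
    (hy : y ∈ unitB) :
    ‖u x - u y‖ₑ ^ 2 ≤ 64 * ∫⁻ s in Ioc (0 : ℝ) 1,
      ENNReal.ofReal (s ^ 6) * ‖fderiv ℝ u (x + s ^ 4 • (y - x))‖ₑ ^ 2 := by
  have hDu : Continuous (fderiv ℝ u) := hu.continuous_fderiv (by norm_num)
  have hder : ∀ s ∈ uIcc (0 : ℝ) 1, HasDerivAt (fun s : ℝ => u (x + s ^ 4 • (y - x)))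
      (fderiv ℝ u (x + s ^ 4 • (y - x)) ((4 * s ^ 3) • (y - x))) s := by
    intro s _
    have h1 : HasDerivAt (fun s : ℝ => x + s ^ 4 • (y - x)) ((4 * s ^ 3) • (y - x)) s := by
      have := ((hasDerivAt_pow 4 s).smul_const (y - x)).const_add x
      simpa using this
    exact ((hu.differentiable (by norm_num)) _).hasFDerivAt.comp_hasDerivAt s h1
  have hcont : Continuous fun s : ℝ =>
      fderiv ℝ u (x + s ^ 4 • (y - x)) ((4 * s ^ 3) • (y - x)) := by
    exact (hDu.comp (by fun_prop)).clm_apply (by fun_prop)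
  have hftc := intervalIntegral.integral_eq_sub_of_hasDerivAt hder (hcont.intervalIntegrable 0 1)
  have h0 : u y - u x = ∫ s in Ioc (0 : ℝ) 1,
      fderiv ℝ u (x + s ^ 4 • (y - x)) ((4 * s ^ 3) • (y - x)) := by
    rw [← intervalIntegral.integral_of_le zero_le_one, hftc]; simp
  have hxy : ‖y - x‖ ≤ 2 := by
    rw [mem_ball_zero_iff] at hx hy
    exact (norm_sub_le _ _).trans (by linarith)
  rw [← enorm_neg, neg_sub, h0]
  calc ‖∫ s in Ioc (0 : ℝ) 1, fderiv ℝ u (x + s ^ 4 • (y - x)) ((4 * s ^ 3) • (y - x))‖ₑ ^ 2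
      ≤ (∫⁻ s in Ioc (0 : ℝ) 1,
        ‖fderiv ℝ u (x + s ^ 4 • (y - x)) ((4 * s ^ 3) • (y - x))‖ₑ) ^ 2 := by
        gcongr; exact enorm_integral_le_lintegral_enorm _
    _ ≤ volume.restrict (Ioc (0 : ℝ) 1) univ * ∫⁻ s in Ioc (0 : ℝ) 1,
        ‖fderiv ℝ u (x + s ^ 4 • (y - x)) ((4 * s ^ 3) • (y - x))‖ₑ ^ 2 :=
        sq_lintegral_le hcont.enorm.measurable.aemeasurable
    _ = ∫⁻ s in Ioc (0 : ℝ) 1,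
        ‖fderiv ℝ u (x + s ^ 4 • (y - x)) ((4 * s ^ 3) • (y - x))‖ₑ ^ 2 := by simp
    _ ≤ ∫⁻ s in Ioc (0 : ℝ) 1, 64 * (ENNReal.ofReal (s ^ 6) *
          ‖fderiv ℝ u (x + s ^ 4 • (y - x))‖ₑ ^ 2) := by
        refine lintegral_mono fun s => ?_
        have hn : ‖fderiv ℝ u (x + s ^ 4 • (y - x)) ((4 * s ^ 3) • (y - x))‖ ≤
            ‖fderiv ℝ u (x + s ^ 4 • (y - x))‖ * (8 * |s| ^ 3) := by
          refine (ContinuousLinearMap.le_opNorm _ _).trans ?_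
          rw [norm_smul, norm_mul, norm_pow, Real.norm_eq_abs, Real.norm_eq_abs]
          have : |(4 : ℝ)| = 4 := by norm_num
          rw [this]
          have : 4 * |s| ^ 3 * ‖y - x‖ ≤ 8 * |s| ^ 3 := by
            nlinarith [pow_nonneg (abs_nonneg s) 3]
          gcongr
        have h1 : (64 : ℝ≥0∞) = ENNReal.ofReal 64 := by norm_num
        rw [h1, ← ofReal_norm, ← ofReal_norm,
          ← ENNReal.ofReal_pow (norm_nonneg _), ← ENNReal.ofReal_pow (norm_nonneg _),
          ← ENNReal.ofReal_mul (by positivity), ← ENNReal.ofReal_mul (by positivity)]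
        refine ENNReal.ofReal_le_ofReal ?_
        calc _ ≤ (‖fderiv ℝ u (x + s ^ 4 • (y - x))‖ * (8 * |s| ^ 3)) ^ 2 := by gcongr
          _ = 64 * ((|s| ^ 2) ^ 3 * ‖fderiv ℝ u (x + s ^ 4 • (y - x))‖ ^ 2) := by ring
          _ = _ := by rw [sq_abs]; ring
    _ = _ := by
        rw [lintegral_const_mul]
        have : Continuous fun s : ℝ => fderiv ℝ u (x + s ^ 4 • (y - x)) := hDu.comp (by fun_prop)
        exact (by fun_prop : Measurable fun s : ℝ => ENNReal.ofReal (s ^ 6)).mul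
          (this.enorm.measurable.pow_const 2)

lemma enorm_sub_average_sq_le {u : E3 → F} (hu : Continuous u) (x : E3) :
    ‖u x - ⨍ y in unitB, u y‖ₑ ^ 2 ≤ (volume unitB)⁻¹ * ∫⁻ y in unitB, ‖u x - u y‖ₑ ^ 2 := by
  have hb0 : volume unitB ≠ 0 := (measure_ball_pos _ _ one_pos).ne'
  have hbt : volume unitB ≠ ⊤ := measure_ball_lt_top.ne
  set ν := ((volume.restrict unitB) univ)⁻¹ • (volume.restrict unitB) with hν
  have hνp : ν univ = 1 := by
    simp only [hν, Measure.smul_apply, smul_eq_mul, Measure.restrict_apply_univ]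
    exact ENNReal.inv_mul_cancel hb0 hbt
  have : IsProbabilityMeasure ν := ⟨hνp⟩
  have hInt : Integrable u ν := by
    refine (hu.integrableOn_unitB).smul_measure ?_
    simpa using hb0
  have h1 : u x - ⨍ y in unitB, u y = ∫ y, (u x - u y) ∂ν := by
    rw [integral_sub (integrable_const _) hInt, integral_const, probReal_univ, one_smul]
    rfl
  rw [h1]
  calc ‖∫ y, (u x - u y) ∂ν‖ₑ ^ 2 ≤ (∫⁻ y, ‖u x - u y‖ₑ ∂ν) ^ 2 := by
        gcongr; exact enorm_integral_le_lintegral_enorm _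
    _ ≤ ν univ * ∫⁻ y, ‖u x - u y‖ₑ ^ 2 ∂ν :=
        sq_lintegral_le (by fun_prop : Continuous fun y => ‖u x - u y‖ₑ).measurable.aemeasurable
    _ = _ := by rw [hνp, one_mul, hν, lintegral_smul_measure]; simp

end SobolevPoincare

/-- Integral of `H` over the points `x + r (y - x)`, `y` in the unit ball. -/
def segInt (H : E3 → ℝ≥0∞) (r : ℝ) (x : E3) : ℝ≥0∞ := ∫⁻ y in unitB, H (x + r • (y - x))

lemma measurable_segInt {H : E3 → ℝ≥0∞} (hH : Measurable H) :
    Measurable fun q : ℝ × E3 => segInt H (q.1 ^ 4) q.2 := by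
  have : Measurable fun q : (ℝ × E3) × E3 => H (q.1.2 + q.1.1 ^ 4 • (q.2 - q.1.2)) :=
    hH.comp (by fun_prop)
  exact this.lintegral_prod_right'

lemma unitB_add_smul_sub_mem {x y : E3} {s : ℝ} (hx : x ∈ unitB) (hy : y ∈ unitB) (h0 : 0 ≤ s)
    (h1 : s ≤ 1) : x + s • (y - x) ∈ unitB :=
  (convex_ball (0 : E3) 1).add_smul_sub_mem hx hy ⟨h0, h1⟩

lemma segInt_le {H : E3 → ℝ≥0∞} (hH : Measurable H) {r : ℝ} (hr : 0 < r) (hr1 : r ≤ 1) {x : E3}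
    (hx : x ∈ unitB) : segInt H r x ≤ ENNReal.ofReal ((r ^ 3)⁻¹) * ∫⁻ z in unitB, H z := by
  have hrw : ∀ y : E3, x + r • (y - x) = (x - r • x) + r • y := fun y => by
    rw [smul_sub]; abel
  have h := setLIntegral_comp_add_smul_le hH measurableSet_ball (B := unitB) hr
    (a := x - r • x) (fun y hy => by
      rw [← hrw]; exact unitB_add_smul_sub_mem hx hy hr.le hr1)
  refine le_trans (le_of_eq ?_) h
  exact lintegral_congr fun y => by rw [hrw]

lemma lintegral_segInt_le {H : E3 → ℝ≥0∞} (hH : Measurable H) {r : ℝ} (hr : 0 < r) (hr1 : r ≤ 1) :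
    ∫⁻ x in unitB, segInt H r x ≤ 8 * volume unitB * ∫⁻ z in unitB, H z := by
  have hc : ∀ r : ℝ, 1 / 2 ≤ r → ENNReal.ofReal ((r ^ 3)⁻¹) ≤ 8 := by
    intro r hr
    have : (8 : ℝ≥0∞) = ENNReal.ofReal 8 := by norm_num
    rw [this]
    refine ENNReal.ofReal_le_ofReal ?_
    rw [inv_le_comm₀ (by positivity) (by norm_num)]
    calc (8 : ℝ)⁻¹ = (1 / 2) ^ 3 := by norm_num
      _ ≤ r ^ 3 := by gcongr
  have hconst : ∫⁻ _ in unitB, 8 * ∫⁻ z in unitB, H z = 8 * volume unitB * ∫⁻ z in unitB, H z := by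
    rw [setLIntegral_const]; ring
  rw [← hconst]
  by_cases hh : 1 / 2 ≤ r
  · refine setLIntegral_mono' measurableSet_ball fun x hx => ?_
    exact (segInt_le hH hr hr1 hx).trans (mul_le_mul_left (hc _ hh) _)
  · have hr2 : 1 / 2 ≤ 1 - r := by linarith
    have hsw : ∫⁻ x in unitB, segInt H r x =
        ∫⁻ y in unitB, ∫⁻ x in unitB, H (x + r • (y - x)) := by
      refine lintegral_lintegral_swap ?_
      have : Measurable fun q : E3 × E3 => H (q.1 + r • (q.2 - q.1)) :=
        hH.comp (by fun_prop)
      exact this.aemeasurable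
    rw [hsw]
    refine setLIntegral_mono' measurableSet_ball fun y hy => ?_
    have hrw : ∀ x : E3, x + r • (y - x) = r • y + (1 - r) • x := fun x => by
      rw [smul_sub, sub_smul, one_smul]; abel
    simp_rw [hrw]
    refine (setLIntegral_comp_add_smul_le hH measurableSet_ball (B := unitB)
      (by linarith) fun x hx => ?_).trans (mul_le_mul_left (hc _ hr2) _)
    rw [← hrw]
    exact unitB_add_smul_sub_mem hx hy hr.le hr1

lemma lintegral_sq_weighted_segInt_le {H : E3 → ℝ≥0∞} (hH : Measurable H) :
    ∫⁻ x in unitB, (∫⁻ s in Ioc (0 : ℝ) 1, ENNReal.ofReal (s ^ 6) * segInt H (s ^ 4) x) ^ 2 ≤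
      8 * volume unitB * (∫⁻ z in unitB, H z) ^ 2 := by
  have hm := measurable_segInt hH
  have hmx : ∀ x, Measurable fun s : ℝ => segInt H (s ^ 4) x := fun x =>
    hm.comp (by fun_prop : Measurable fun s : ℝ => (s, x))
  have hms : ∀ s : ℝ, Measurable fun x => segInt H (s ^ 4) x := fun s =>
    hm.comp (by fun_prop : Measurable fun x : E3 => (s, x))
  have hpt : ∀ x ∈ unitB,
      (∫⁻ s in Ioc (0 : ℝ) 1, ENNReal.ofReal (s ^ 6) * segInt H (s ^ 4) x) ^ 2 ≤
        ∫⁻ s in Ioc (0 : ℝ) 1, (∫⁻ z in unitB, H z) * segInt H (s ^ 4) x := by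
    intro x hx
    refine (sq_lintegral_le ?_).trans ?_
    · exact ((by fun_prop : Measurable fun s : ℝ => ENNReal.ofReal (s ^ 6)).mul
        (hmx x)).aemeasurable
    · rw [Measure.restrict_apply_univ, Real.volume_Ioc, sub_zero, ENNReal.ofReal_one, one_mul]
      refine setLIntegral_mono' measurableSet_Ioc fun s hs => ?_
      have hs4 : 0 < s ^ 4 := pow_pos hs.1 4
      have hle : s ^ 4 ≤ 1 := pow_le_one₀ hs.1.le hs.2
      have hs6 : 0 ≤ s ^ 6 := pow_nonneg hs.1.le 6
      have h1 := segInt_le hH hs4 hle hx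
      rw [sq]
      calc _ = (ENNReal.ofReal (s ^ 6 * s ^ 6) * segInt H (s ^ 4) x) * segInt H (s ^ 4) x := by
            rw [ENNReal.ofReal_mul hs6]; ring
        _ ≤ (ENNReal.ofReal (s ^ 6 * s ^ 6) * (ENNReal.ofReal (((s ^ 4) ^ 3)⁻¹) *
              ∫⁻ z in unitB, H z)) * segInt H (s ^ 4) x := by gcongr
        _ = _ := by
          rw [← mul_assoc, ← ENNReal.ofReal_mul (by positivity)]
          have : s ^ 6 * s ^ 6 * ((s ^ 4) ^ 3)⁻¹ = 1 := by
            have := hs.1.ne'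
            field_simp
          rw [this, ENNReal.ofReal_one, one_mul]
  refine (setLIntegral_mono' measurableSet_ball hpt).trans ?_
  rw [lintegral_lintegral_swap (measurable_const.mul (hm.comp measurable_swap)).aemeasurable]
  have hb : ∀ s ∈ Ioc (0 : ℝ) 1, ∫⁻ x in unitB, (∫⁻ z in unitB, H z) * segInt H (s ^ 4) x ≤
      (∫⁻ z in unitB, H z) * (8 * volume unitB * ∫⁻ z in unitB, H z) := by
    intro s hs
    rw [lintegral_const_mul _ (hms s)]
    gcongr
    exact lintegral_segInt_le hH (pow_pos hs.1 4) (pow_le_one₀ hs.1.le hs.2)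
  refine (setLIntegral_mono' measurableSet_Ioc hb).trans (le_of_eq ?_)
  rw [setLIntegral_const, Real.volume_Ioc, sub_zero, ENNReal.ofReal_one]
  ring

section SobolevPoincare

variable {F : Type*} [NormedAddCommGroup F] [NormedSpace ℝ F] [CompleteSpace F]

lemma enorm_sub_average_sq_le_segInt {u : E3 → F} (hu : ContDiff ℝ 1 u) {x : E3}
    (hx : x ∈ unitB) :
    ‖u x - ⨍ y in unitB, u y‖ₑ ^ 2 ≤ (volume unitB)⁻¹ * 64 *
      ∫⁻ s in Ioc (0 : ℝ) 1, ENNReal.ofReal (s ^ 6) *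
        segInt (fun z => ‖fderiv ℝ u z‖ₑ ^ 2) (s ^ 4) x := by
  have hDu : Continuous (fderiv ℝ u) := hu.continuous_fderiv (by norm_num)
  have hH : Measurable fun z => ‖fderiv ℝ u z‖ₑ ^ 2 := hDu.enorm.measurable.pow_const 2
  refine (enorm_sub_average_sq_le hu.continuous x).trans ?_
  rw [mul_assoc]
  gcongr
  refine (setLIntegral_mono' measurableSet_ball fun y hy => enorm_sub_sq_le hu hx hy).trans ?_
  rw [lintegral_const_mul' _ _ (by norm_num), lintegral_lintegral_swap]
  · gcongr with s
    rw [lintegral_const_mul' _ _ ENNReal.ofReal_ne_top]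
    rfl
  · have : Measurable fun q : E3 × ℝ =>
        ENNReal.ofReal (q.2 ^ 6) * ‖fderiv ℝ u (x + q.2 ^ 4 • (q.1 - x))‖ₑ ^ 2 :=
      (by fun_prop : Measurable fun q : E3 × ℝ => ENNReal.ofReal (q.2 ^ 6)).mul
        (hH.comp (by fun_prop : Measurable fun q : E3 × ℝ => x + q.2 ^ 4 • (q.1 - x)))
    exact this.aemeasurable

/-- The Sobolev–Poincaré inequality `W^{1,2} → L⁴` on the unit ball, in `lintegral` form. -/
lemma lintegral_sobolev_poincare {u : E3 → F} (hu : ContDiff ℝ 1 u) :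
    ∫⁻ x in unitB, (‖u x - ⨍ y in unitB, u y‖ₑ ^ 2) ^ 2 ≤
      32768 * (volume unitB)⁻¹ * (∫⁻ x in unitB, ‖fderiv ℝ u x‖ₑ ^ 2) ^ 2 := by
  have hb0 : volume unitB ≠ 0 := (measure_ball_pos _ _ one_pos).ne'
  have hbt : volume unitB ≠ ⊤ := measure_ball_lt_top.ne
  have hDu : Continuous (fderiv ℝ u) := hu.continuous_fderiv (by norm_num)
  have hH : Measurable fun z => ‖fderiv ℝ u z‖ₑ ^ 2 := hDu.enorm.measurable.pow_const 2
  refine (setLIntegral_mono' measurableSet_ball fun x hx =>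
    pow_le_pow_left' (enorm_sub_average_sq_le_segInt hu hx) 2).trans ?_
  simp_rw [mul_pow _ _ 2]
  rw [lintegral_const_mul']
  · refine (mul_le_mul_right (lintegral_sq_weighted_segInt_le hH) _).trans (le_of_eq ?_)
    generalize volume unitB = b at *
    calc _ = 32768 * (b⁻¹ * (b⁻¹ * b)) * (∫⁻ x in unitB, ‖fderiv ℝ u x‖ₑ ^ 2) ^ 2 := by ring
      _ = _ := by rw [ENNReal.inv_mul_cancel hb0 hbt, mul_one]
  · exact ENNReal.mul_ne_top (ENNReal.pow_ne_top (ENNReal.inv_ne_top.2 hb0)) (by norm_num)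

/-- The constant in the Sobolev–Poincaré inequality on the unit ball. -/
def sobolevC : ℝ := 32768 * (volume.real unitB)⁻¹

lemma volume_real_unitB_pos : 0 < volume.real unitB :=
  ENNReal.toReal_pos (measure_ball_pos _ _ one_pos).ne' measure_ball_lt_top.ne

lemma sobolevC_pos : 0 < sobolevC := mul_pos (by norm_num) (inv_pos.2 volume_real_unitB_pos)

/-- The Sobolev–Poincaré inequality `W^{1,2} → L⁴` on the unit ball. -/
lemma sobolev_poincare {u : E3 → F} (hu : ContDiff ℝ 1 u) :
    ∫ x in unitB, ‖u x - ⨍ y in unitB, u y‖ ^ 4 ≤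
      sobolevC * (∫ x in unitB, ‖fderiv ℝ u x‖ ^ 2) ^ 2 := by
  have hDu : Continuous (fderiv ℝ u) := hu.continuous_fderiv (by norm_num)
  have h := lintegral_sobolev_poincare hu
  have h1 : ENNReal.ofReal (∫ x in unitB, ‖u x - ⨍ y in unitB, u y‖ ^ 4) =
      ∫⁻ x in unitB, (‖u x - ⨍ y in unitB, u y‖ₑ ^ 2) ^ 2 := by
    rw [ofReal_integral_eq_lintegral_ofReal]
    · refine lintegral_congr fun x => ?_
      rw [← pow_mul, ← ofReal_norm, ENNReal.ofReal_pow (norm_nonneg _)]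
    · exact (((hu.continuous.sub continuous_const).norm).pow 4).integrableOn_unitB
    · exact Filter.Eventually.of_forall fun x => by positivity
  have h2 : ENNReal.ofReal (∫ x in unitB, ‖fderiv ℝ u x‖ ^ 2) =
      ∫⁻ x in unitB, ‖fderiv ℝ u x‖ₑ ^ 2 := by
    rw [ofReal_integral_eq_lintegral_ofReal]
    · refine lintegral_congr fun x => ?_
      rw [← ofReal_norm, ENNReal.ofReal_pow (norm_nonneg _)]
    · exact (hDu.norm.pow 2).integrableOn_unitB
    · exact Filter.Eventually.of_forall fun x => by positivity
  have hI : 0 ≤ ∫ x in unitB, ‖fderiv ℝ u x‖ ^ 2 := integral_nonneg fun x => by positivity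
  have h3 : 32768 * (volume unitB)⁻¹ = ENNReal.ofReal sobolevC := by
    rw [sobolevC, ENNReal.ofReal_mul (by norm_num), ENNReal.ofReal_inv_of_pos volume_real_unitB_pos,
      Measure.real, ENNReal.ofReal_toReal measure_ball_lt_top.ne]
    norm_num
  rw [← h1, ← h2, h3, ← ENNReal.ofReal_pow hI, ← ENNReal.ofReal_mul sobolevC_pos.le] at h
  exact (ENNReal.ofReal_le_ofReal_iff (mul_nonneg sobolevC_pos.le (by positivity))).1 h

end SobolevPoincare

/-- Evaluation of a polynomial in three variables on `ℝ³`. -/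
def ev (P : MvPolynomial (Fin 3) ℝ) (x : E3) : ℝ := MvPolynomial.eval (fun i => x i) P

lemma ev_add (P Q : MvPolynomial (Fin 3) ℝ) (x : E3) : ev (P + Q) x = ev P x + ev Q x :=
  map_add _ _ _

lemma ev_sub (P Q : MvPolynomial (Fin 3) ℝ) (x : E3) : ev (P - Q) x = ev P x - ev Q x :=
  map_sub _ _ _

lemma ev_mul (P Q : MvPolynomial (Fin 3) ℝ) (x : E3) : ev (P * Q) x = ev P x * ev Q x :=
  map_mul _ _ _

lemma ev_pow (P : MvPolynomial (Fin 3) ℝ) (n : ℕ) (x : E3) : ev (P ^ n) x = ev P x ^ n :=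
  map_pow _ _ _

lemma ev_C (a : ℝ) (x : E3) : ev (MvPolynomial.C a) x = a := MvPolynomial.eval_C _

lemma ev_X (i : Fin 3) (x : E3) : ev (MvPolynomial.X i) x = x i := MvPolynomial.eval_X _

lemma ev_sum {ι : Type*} (s : Finset ι) (P : ι → MvPolynomial (Fin 3) ℝ) (x : E3) :
    ev (∑ i ∈ s, P i) x = ∑ i ∈ s, ev (P i) x := map_sum _ _ _

@[fun_prop]
lemma contDiff_ev {n : WithTop ℕ∞} (P : MvPolynomial (Fin 3) ℝ) : ContDiff ℝ n (ev P) := by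
  induction P using MvPolynomial.induction_on with
  | C a => simpa only [funext (ev_C a)] using contDiff_const
  | add P Q hP hQ => simpa only [funext (ev_add P Q)] using hP.add hQ
  | mul_X P i hP =>
    simpa only [funext (ev_mul P _), ev_X] using hP.mul (contDiff_coord i)

@[fun_prop]
lemma differentiable_ev (P : MvPolynomial (Fin 3) ℝ) : Differentiable ℝ (ev P) :=
  (contDiff_ev (n := 1) P).differentiable (by norm_num)

@[fun_prop]
lemma continuous_ev (P : MvPolynomial (Fin 3) ℝ) : Continuous (ev P) :=
  (contDiff_ev (n := 1) P).continuous

lemma pd_ev (j : Fin 3) (P : MvPolynomial (Fin 3) ℝ) :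
    pd j (ev P) = ev (MvPolynomial.pderiv j P) := by
  induction P using MvPolynomial.induction_on with
  | C a =>
    ext x
    rw [funext (ev_C a), pd_const, MvPolynomial.pderiv_C]
    simp [ev]
  | add P Q hP hQ =>
    ext x
    rw [funext (ev_add P Q), pd_add (differentiable_ev P x) (differentiable_ev Q x), hP, hQ,
      map_add, ev_add]
  | mul_X P i hP =>
    ext x
    rw [funext (ev_mul P _), pd_mul (differentiable_ev P x) (differentiable_ev _ x), hP,
      funext (ev_X i), pd_coord, MvPolynomial.pderiv_mul, MvPolynomial.pderiv_X, ev_add, ev_mul,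
      ev_mul, ev_X]
    by_cases h : i = j
    · subst h; simp [ev]; ring
    · simp [h, ev]; ring

lemma pderiv_comm (i j : Fin 3) (P : MvPolynomial (Fin 3) ℝ) :
    MvPolynomial.pderiv i (MvPolynomial.pderiv j P) =
      MvPolynomial.pderiv j (MvPolynomial.pderiv i P) := by
  induction P using MvPolynomial.induction_on with
  | C a => simp
  | add P Q hP hQ => simp [hP, hQ]
  | mul_X P k hP =>
    simp only [MvPolynomial.pderiv_mul, map_add, hP, MvPolynomial.pderiv_X]
    have : ∀ a b : Fin 3, MvPolynomial.pderiv a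
        (Pi.single (M := fun _ => MvPolynomial (Fin 3) ℝ) b 1 k) = 0 := by
      intro a b
      by_cases h : k = b
      · subst h; simp
      · simp [h]
    simp only [this]; ring

lemma eq_zero_of_ev_eq_zero {P : MvPolynomial (Fin 3) ℝ} (h : ∀ x ∈ unitB, ev P x = 0) :
    P = 0 := by
  refine MvPolynomial.funext_set (fun _ => Ioo (-(1 / 2) : ℝ) (1 / 2))
    (fun _ => Ioo_infinite (by norm_num)) fun x hx => ?_
  have hxB : WithLp.toLp 2 x ∈ unitB := by
    rw [mem_ball_zero_iff, ← sq_lt_one_iff₀ (norm_nonneg _), EuclideanSpace.norm_sq_eq]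
    have : ∀ i, x i ^ 2 ≤ 1 / 4 := fun i => by
      have := hx i (mem_univ _)
      simp only [mem_Ioo] at this
      nlinarith
    calc ∑ i, ‖(WithLp.toLp 2 x : E3) i‖ ^ 2 ≤ ∑ _i : Fin 3, (1 / 4 : ℝ) :=
          Finset.sum_le_sum fun i _ => by simpa using this i
      _ < 1 := by norm_num
  simpa [ev] using h _ hxB

/-- The polynomial `1 - |x|²`. -/
def rhoP : MvPolynomial (Fin 3) ℝ := 1 - ∑ i, MvPolynomial.X i ^ 2

lemma ev_rhoP (x : E3) : ev rhoP x = bdef x := by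
  simp [rhoP, ev, bdef]

/-- The Laplacian on polynomials. -/
def lapP : MvPolynomial (Fin 3) ℝ →ₗ[ℝ] MvPolynomial (Fin 3) ℝ :=
  ∑ j, (MvPolynomial.pderiv j).toLinearMap ∘ₗ (MvPolynomial.pderiv j).toLinearMap

lemma lapP_apply (P : MvPolynomial (Fin 3) ℝ) :
    lapP P = ∑ j, MvPolynomial.pderiv j (MvPolynomial.pderiv j P) := by
  simp [lapP]

lemma totalDegree_pderiv_le (j : Fin 3) (P : MvPolynomial (Fin 3) ℝ) :
    (MvPolynomial.pderiv j P).totalDegree ≤ P.totalDegree - 1 := by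
  conv_lhs => rw [P.as_sum, map_sum]
  refine MvPolynomial.totalDegree_finsetSum_le fun s hs => ?_
  rw [MvPolynomial.pderiv_monomial]
  by_cases h : s j = 0
  · simp [h]
  refine (MvPolynomial.totalDegree_monomial_le _ _).trans ?_
  have h1 := MvPolynomial.le_totalDegree hs
  have h2 : (s - Finsupp.single j 1).degree + 1 = s.degree := by
    have h3 : s - Finsupp.single j 1 + Finsupp.single j 1 = s :=
      tsub_add_cancel_of_le (by simpa using Nat.one_le_iff_ne_zero.2 h)
    conv_rhs => rw [← h3, map_add, Finsupp.degree_single]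
  have h4 : ∀ d : Fin 3 →₀ ℕ, (d.sum fun _ e => e) = d.degree := fun d => rfl
  rw [h4] at h1
  have h5 : ((s - Finsupp.single j 1).sum fun _ => id) = (s - Finsupp.single j 1).degree := rfl
  omega

lemma eq_zero_of_integral_unitB_eq_zero {f : E3 → ℝ} (hf : Continuous f)
    (h0 : ∀ x, 0 ≤ f x) (h : ∫ x in unitB, f x = 0) : ∀ x ∈ unitB, f x = 0 := by
  have h1 := (setIntegral_eq_zero_iff_of_nonneg_ae (ae_of_all _ h0) hf.integrableOn_unitB).1 h
  exact Measure.eqOn_open_of_ae_eq h1 isOpen_ball hf.continuousOn continuousOn_const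

lemma eq_zero_of_lapP_rhoP_mul_eq_zero {q : MvPolynomial (Fin 3) ℝ} (h : lapP (rhoP * q) = 0) :
    q = 0 := by
  set Φ := rhoP * q with hΦ
  have hΦs : ∀ x ∈ sphere (0 : E3) 1, ev Φ x = 0 := fun x hx => by
    rw [hΦ, ev_mul, ev_rhoP, bdef_sphere hx, zero_mul]
  have h1 := integral_div_eq_zero (G := fun i => ev (Φ * MvPolynomial.pderiv i Φ))
    (fun i => contDiff_ev _) (fun x hx => by simp [ev_mul, hΦs x hx])
  have h2 : ∀ x, ∑ i, pd i (ev (Φ * MvPolynomial.pderiv i Φ)) x =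
      ∑ i, ev (MvPolynomial.pderiv i Φ) x ^ 2 := by
    intro x
    have h3 : ev (lapP Φ) x = 0 := by rw [h]; simp [ev]
    rw [lapP_apply, ev_sum] at h3
    simp only [pd_ev, MvPolynomial.pderiv_mul, ev_add, ev_mul, Finset.sum_add_distrib]
    rw [← Finset.mul_sum, h3]
    simp [sq]
  simp_rw [h2] at h1
  have h3 := eq_zero_of_integral_unitB_eq_zero
    (continuous_finsetSum _ fun i _ => (continuous_ev _).pow 2)
    (fun x => Finset.sum_nonneg fun i _ => sq_nonneg _) h1
  have h4 : ∀ i, MvPolynomial.pderiv i Φ = 0 := fun i => eq_zero_of_ev_eq_zero fun x hx => by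
    have := (Finset.sum_eq_zero_iff_of_nonneg fun i _ => sq_nonneg _).1 (h3 x hx) i
      (Finset.mem_univ _)
    simpa using this
  have h5 : ∀ x, fderiv ℝ (ev Φ) x = 0 := fun x => by
    ext v
    have h6 : ∀ j, fderiv ℝ (ev Φ) x (EuclideanSpace.single j 1) = 0 := fun j => by
      have := congrFun (pd_ev j Φ) x
      rw [h4 j] at this
      simpa [pd, ev] using this
    have h7 : v = ∑ j, v j • EuclideanSpace.single j (1 : ℝ) := by
      ext i; simp [Finset.sum_apply, Pi.single_apply]
    rw [h7, map_sum]
    simp [h6]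
  have h8 : Φ = 0 := eq_zero_of_ev_eq_zero fun x _ => by
    rw [is_const_of_fderiv_eq_zero (differentiable_ev Φ) h5 x (EuclideanSpace.single 0 1)]
    exact hΦs _ (by simp)
  refine (mul_eq_zero.1 h8).resolve_left fun h9 => ?_
  have := ev_rhoP 0
  rw [h9] at this
  simp [ev, bdef] at this

/-- The Dirichlet problem on the unit ball with polynomial right-hand side has a polynomial
solution. -/
lemma exists_lapP_rhoP_mul_eq (f : MvPolynomial (Fin 3) ℝ) : ∃ q, lapP (rhoP * q) = f := by
  set m := f.totalDegree
  let T : MvPolynomial (Fin 3) ℝ →ₗ[ℝ] MvPolynomial (Fin 3) ℝ := lapP ∘ₗ LinearMap.mulLeft ℝ rhoP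
  have hrho : rhoP.totalDegree ≤ 2 := by
    refine (MvPolynomial.totalDegree_sub _ _).trans (max_le (by simp) ?_)
    exact MvPolynomial.totalDegree_finsetSum_le fun i _ => by simp
  have hT : ∀ q ∈ MvPolynomial.restrictTotalDegree (Fin 3) ℝ m,
      T q ∈ MvPolynomial.restrictTotalDegree (Fin 3) ℝ m := fun q hq => by
    rw [MvPolynomial.mem_restrictTotalDegree] at hq ⊢
    simp only [T, LinearMap.comp_apply, LinearMap.mulLeft_apply, lapP_apply]
    refine MvPolynomial.totalDegree_finsetSum_le fun j _ => ?_
    have h1 := totalDegree_pderiv_le j (MvPolynomial.pderiv j (rhoP * q))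
    have h2 := totalDegree_pderiv_le j (rhoP * q)
    have h3 := MvPolynomial.totalDegree_mul rhoP q
    omega
  have hinj : Function.Injective (T.restrict hT) := by
    rw [← LinearMap.ker_eq_bot, LinearMap.ker_eq_bot']
    intro q hq
    refine Subtype.ext (eq_zero_of_lapP_rhoP_mul_eq_zero ?_)
    simpa [T] using congrArg Subtype.val hq
  obtain ⟨q, hq⟩ := LinearMap.injective_iff_surjective.1 hinj
    ⟨f, (MvPolynomial.mem_restrictTotalDegree _ _ _).2 le_rfl⟩
  exact ⟨q, by simpa [T] using congrArg Subtype.val hq⟩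

section Hessian

open MvPolynomial

/-- The squared length of the gradient of a polynomial. -/
def gradSq (Φ : MvPolynomial (Fin 3) ℝ) : MvPolynomial (Fin 3) ℝ := ∑ i, pderiv i Φ ^ 2

/-- The squared length of the Hessian of a polynomial. -/
def hessSq (Φ : MvPolynomial (Fin 3) ℝ) : MvPolynomial (Fin 3) ℝ :=
  ∑ i, ∑ j, pderiv i (pderiv j Φ) ^ 2

/-- The product of the Hessian and the gradient of a polynomial. -/
def hessGrad (Φ : MvPolynomial (Fin 3) ℝ) (k : Fin 3) : MvPolynomial (Fin 3) ℝ :=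
  ∑ j, pderiv j Φ * pderiv k (pderiv j Φ)

lemma sum_pderiv_weighted (W Φ : MvPolynomial (Fin 3) ℝ) :
    ∑ k, pderiv k (W * (pderiv k Φ * lapP Φ - hessGrad Φ k)) =
      W * (lapP Φ ^ 2 - hessSq Φ) + ∑ k, pderiv k W * (pderiv k Φ * lapP Φ - hessGrad Φ k) := by
  simp only [lapP_apply, hessSq, hessGrad, Fin.sum_univ_three, pderiv_mul, map_add, map_sub,
    pderiv_comm 1 0, pderiv_comm 2 0, pderiv_comm 2 1]
  ring

lemma pderiv_gradSq (Φ : MvPolynomial (Fin 3) ℝ) (k : Fin 3) :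
    pderiv k (gradSq Φ) = 2 * hessGrad Φ k := by
  simp only [gradSq, hessGrad, Fin.sum_univ_three, map_add, pderiv_pow]
  norm_num
  ring

lemma ev_gradSq (Φ : MvPolynomial (Fin 3) ℝ) (x : E3) :
    ev (gradSq Φ) x = ∑ i, ev (pderiv i Φ) x ^ 2 := by
  simp [gradSq, ev]

lemma ev_hessSq (Φ : MvPolynomial (Fin 3) ℝ) (x : E3) :
    ev (hessSq Φ) x = ∑ i, ∑ j, ev (pderiv i (pderiv j Φ)) x ^ 2 := by
  simp [hessSq, ev]

lemma ev_gradSq_nonneg (Φ : MvPolynomial (Fin 3) ℝ) (x : E3) : 0 ≤ ev (gradSq Φ) x := by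
  rw [ev_gradSq]; positivity

lemma ev_hessSq_nonneg (Φ : MvPolynomial (Fin 3) ℝ) (x : E3) : 0 ≤ ev (hessSq Φ) x := by
  rw [ev_hessSq]; positivity

lemma ev_pderiv_rhoP_mul (q : MvPolynomial (Fin 3) ℝ) {x : E3} (hx : x ∈ sphere (0 : E3) 1)
    (k : Fin 3) : ev (pderiv k (rhoP * q)) x = -2 * x k * ev q x := by
  rw [pderiv_mul, ev_add, ev_mul, ev_mul, ev_rhoP, bdef_sphere hx, ← pd_ev,
    funext ev_rhoP, pd_bdef]
  ring

lemma pderiv_rhoP (k : Fin 3) : pderiv k rhoP = - 2 * X k := by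
  simp only [rhoP, map_sub, pderiv_one, map_sum, pderiv_pow, pderiv_X]
  simp [Pi.single_apply]

lemma ev_pderiv_pderiv_rhoP_mul (q : MvPolynomial (Fin 3) ℝ) {x : E3}
    (hx : x ∈ sphere (0 : E3) 1) (k j : Fin 3) :
    ev (pderiv k (pderiv j (rhoP * q))) x = -2 * (if j = k then 1 else 0) * ev q x
      - 2 * x j * ev (pderiv k q) x - 2 * x k * ev (pderiv j q) x := by
  have h2 : ∀ a b : Fin 3, pderiv a ((-2 : MvPolynomial (Fin 3) ℝ) * X b) =
      if b = a then -2 else 0 := by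
    intro a b
    have : (-2 : MvPolynomial (Fin 3) ℝ) = C (-2) := by
      rw [map_neg, map_ofNat]
    rw [this, pderiv_C_mul, pderiv_X]
    by_cases h : b = a
    · subst h; simp
    · simp [h]
  simp only [pderiv_mul, map_add, pderiv_rhoP] at h2 ⊢
  rw [h2]
  simp only [ev_add, ev_mul, ev_rhoP, bdef_sphere hx, ev_X]
  split_ifs with h
  · simp [ev]; ring
  · simp [ev]; ring

lemma sum_mul_boundary (q : MvPolynomial (Fin 3) ℝ) {x : E3}
    (hx : x ∈ sphere (0 : E3) 1) :
    ∑ k, x k * ev (pderiv k (rhoP * q) * lapP (rhoP * q) - hessGrad (rhoP * q) k) x =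
      8 * ev q x ^ 2 := by
  have hs : x 0 ^ 2 + x 1 ^ 2 + x 2 ^ 2 = 1 := by
    have := bdef_sphere hx
    simp only [bdef, Fin.sum_univ_three] at this
    linarith
  simp only [lapP_apply, hessGrad, ev_sub, ev_add, ev_mul, ev_pderiv_rhoP_mul q hx,
    ev_pderiv_pderiv_rhoP_mul q hx, Fin.sum_univ_three]
  generalize ev q x = a
  generalize ev (pderiv 0 q) x = a0
  generalize ev (pderiv 1 q) x = a1
  generalize ev (pderiv 2 q) x = a2
  generalize x 0 = y0 at *
  generalize x 1 = y1 at *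
  generalize x 2 = y2 at *
  simp
  linear_combination 8 * a ^ 2 * hs

lemma hessGrad_sq_le (Φ : MvPolynomial (Fin 3) ℝ) (x : E3) (N : ℝ)
    (hN : N = ev (gradSq Φ) x) (f : ℝ) :
    ∑ k, 2 * ev (hessGrad Φ k) x * (ev (pderiv k Φ) x * f - ev (hessGrad Φ k) x) ≤
      N * f ^ 2 / 2 := by
  rw [hN, ev_gradSq, Finset.sum_mul, Finset.sum_div]
  refine Finset.sum_le_sum fun k _ => ?_
  nlinarith [sq_nonneg (2 * ev (hessGrad Φ k) x - ev (pderiv k Φ) x * f)]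

/-- The `L²` estimate of the Hessian for the Dirichlet problem on the unit ball. -/
lemma integral_hessSq_le (q : MvPolynomial (Fin 3) ℝ) :
    ∫ x in unitB, ev (hessSq (rhoP * q)) x ≤ ∫ x in unitB, ev (lapP (rhoP * q)) x ^ 2 := by
  set Φ := rhoP * q with hΦ
  have h1 := integral_div_nonneg (G := fun k => ev (1 * (pderiv k Φ * lapP Φ - hessGrad Φ k)))
    (fun k => contDiff_ev _) (fun x hx => by
      simp only [one_mul]
      rw [sum_mul_boundary q hx]; positivity)
  simp_rw [pd_ev, ← ev_sum, sum_pderiv_weighted] at h1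
  simp only [one_mul, pderiv_one, zero_mul, Finset.sum_const_zero, add_zero, ev_sub, ev_pow] at h1
  rw [integral_sub (Continuous.integrableOn_unitB (by fun_prop))
    (Continuous.integrableOn_unitB (by fun_prop))] at h1
  linarith

/-- A weighted `L²` estimate of the Hessian for the Dirichlet problem on the unit ball. -/
lemma integral_gradSq_sq_mul_hessSq_le (q : MvPolynomial (Fin 3) ℝ) :
    ∫ x in unitB, ev (gradSq (rhoP * q)) x ^ 2 * ev (hessSq (rhoP * q)) x ≤
      2 * ∫ x in unitB, ev (gradSq (rhoP * q)) x ^ 2 * ev (lapP (rhoP * q)) x ^ 2 := by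
  set Φ := rhoP * q with hΦ
  have h1 := integral_div_nonneg
    (G := fun k => ev (gradSq Φ ^ 2 * (pderiv k Φ * lapP Φ - hessGrad Φ k)))
    (fun k => contDiff_ev _) (fun x hx => by
      simp_rw [ev_mul (gradSq Φ ^ 2), mul_left_comm, ← Finset.mul_sum]
      rw [sum_mul_boundary q hx, ev_pow]; positivity)
  simp_rw [pd_ev, ← ev_sum, sum_pderiv_weighted] at h1
  have hle : ∀ x, ev (gradSq Φ ^ 2 * (lapP Φ ^ 2 - hessSq Φ) +
      ∑ k, pderiv k (gradSq Φ ^ 2) * (pderiv k Φ * lapP Φ - hessGrad Φ k)) x ≤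
      2 * (ev (gradSq Φ) x ^ 2 * ev (lapP Φ) x ^ 2) - ev (gradSq Φ) x ^ 2 * ev (hessSq Φ) x := by
    intro x
    have h2 := hessGrad_sq_le Φ x _ rfl (ev (lapP Φ) x)
    have h3 : ev (∑ k, pderiv k (gradSq Φ ^ 2) * (pderiv k Φ * lapP Φ - hessGrad Φ k)) x =
        2 * ev (gradSq Φ) x * ∑ k, 2 * ev (hessGrad Φ k) x *
          (ev (pderiv k Φ) x * ev (lapP Φ) x - ev (hessGrad Φ k) x) := by
      rw [ev_sum, Finset.mul_sum]
      refine Finset.sum_congr rfl fun k _ => ?_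
      rw [pderiv_pow, pderiv_gradSq]
      simp [ev]; ring
    rw [ev_add, h3, ev_mul, ev_sub, ev_pow, ev_pow]
    nlinarith [ev_gradSq_nonneg Φ x, mul_le_mul_of_nonneg_left h2 (ev_gradSq_nonneg Φ x)]
  have h4 := h1.trans (setIntegral_mono (Continuous.integrableOn_unitB (by fun_prop))
    (Continuous.integrableOn_unitB (by fun_prop)) hle)
  rw [integral_sub (Continuous.integrableOn_unitB (by fun_prop))
    (Continuous.integrableOn_unitB (by fun_prop)), integral_const_mul] at h4
  linarith

end Hessian

/-- Hölder's inequality with four factors. -/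
lemma integral_rpow_mul_rpow_mul_rpow_mul_rpow_le {α : Type*} [MeasurableSpace α] {μ : Measure α}
    {f g h k : α → ℝ} (hf : Integrable f μ) (hg : Integrable g μ) (hh : Integrable h μ)
    (hk : Integrable k μ) (hf0 : ∀ x, 0 ≤ f x) (hg0 : ∀ x, 0 ≤ g x) (hh0 : ∀ x, 0 ≤ h x)
    (hk0 : ∀ x, 0 ≤ k x) {p q r s : ℝ} (hp : 0 ≤ p) (hq : 0 ≤ q) (hr : 0 ≤ r) (hs : 0 ≤ s)
    (hpqrs : p + q + r + s = 1) :
    ∫ x, f x ^ p * g x ^ q * h x ^ r * k x ^ s ∂μ ≤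
      (∫ x, f x ∂μ) ^ p * (∫ x, g x ∂μ) ^ q * (∫ x, h x ∂μ) ^ r * (∫ x, k x ∂μ) ^ s := by
  have key := ENNReal.lintegral_prod_norm_pow_le (μ := μ) (Finset.univ : Finset (Fin 4))
    (f := ![fun x => ENNReal.ofReal (f x), fun x => ENNReal.ofReal (g x),
      fun x => ENNReal.ofReal (h x), fun x => ENNReal.ofReal (k x)]) (p := ![p, q, r, s])
    (by
      intro i _
      fin_cases i
      · exact hf.aemeasurable.ennreal_ofReal
      · exact hg.aemeasurable.ennreal_ofReal
      · exact hh.aemeasurable.ennreal_ofReal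
      · exact hk.aemeasurable.ennreal_ofReal)
    (by simpa [Fin.sum_univ_four] using hpqrs)
    (by intro i _; fin_cases i <;> simpa)
  simp only [Fin.prod_univ_four, Matrix.cons_val_zero, Matrix.cons_val_one, Matrix.cons_val] at key
  have hfp := fun x => Real.rpow_nonneg (hf0 x) p
  have hgq := fun x => Real.rpow_nonneg (hg0 x) q
  have hhr := fun x => Real.rpow_nonneg (hh0 x) r
  have hks := fun x => Real.rpow_nonneg (hk0 x) s
  have h0 : 0 ≤ᵐ[μ] fun x => f x ^ p * g x ^ q * h x ^ r * k x ^ s :=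
    ae_of_all _ fun x => mul_nonneg (mul_nonneg (mul_nonneg (hfp x) (hgq x)) (hhr x)) (hks x)
  have hm : AEStronglyMeasurable (fun x => f x ^ p * g x ^ q * h x ^ r * k x ^ s) μ :=
    ((((hf.aemeasurable.pow_const p).mul (hg.aemeasurable.pow_const q)).mul
      (hh.aemeasurable.pow_const r)).mul (hk.aemeasurable.pow_const s)).aestronglyMeasurable
  have hpt : ∀ x, ENNReal.ofReal (f x ^ p * g x ^ q * h x ^ r * k x ^ s) =
      ENNReal.ofReal (f x) ^ p * ENNReal.ofReal (g x) ^ q * ENNReal.ofReal (h x) ^ r *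
        ENNReal.ofReal (k x) ^ s := fun x => by
    rw [ENNReal.ofReal_mul (mul_nonneg (mul_nonneg (hfp x) (hgq x)) (hhr x)),
      ENNReal.ofReal_mul (mul_nonneg (hfp x) (hgq x)), ENNReal.ofReal_mul (hfp x),
      ENNReal.ofReal_rpow_of_nonneg (hf0 x) hp, ENNReal.ofReal_rpow_of_nonneg (hg0 x) hq,
      ENNReal.ofReal_rpow_of_nonneg (hh0 x) hr, ENNReal.ofReal_rpow_of_nonneg (hk0 x) hs]
  have hF := integral_nonneg (μ := μ) (f := f) hf0
  have hG := integral_nonneg (μ := μ) (f := g) hg0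
  have hH := integral_nonneg (μ := μ) (f := h) hh0
  have hK := integral_nonneg (μ := μ) (f := k) hk0
  rw [integral_eq_lintegral_of_nonneg_ae h0 hm]
  refine ENNReal.toReal_le_of_le_ofReal (by positivity) ?_
  simp_rw [hpt]
  refine key.trans (le_of_eq ?_)
  rw [ENNReal.ofReal_mul (by positivity), ENNReal.ofReal_mul (by positivity),
    ENNReal.ofReal_mul (by positivity),
    ← ENNReal.ofReal_rpow_of_nonneg hF hp, ← ENNReal.ofReal_rpow_of_nonneg hG hq,
    ← ENNReal.ofReal_rpow_of_nonneg hH hr, ← ENNReal.ofReal_rpow_of_nonneg hK hs,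
    ofReal_integral_eq_lintegral_ofReal hf (ae_of_all _ hf0),
    ofReal_integral_eq_lintegral_ofReal hg (ae_of_all _ hg0),
    ofReal_integral_eq_lintegral_ofReal hh (ae_of_all _ hh0),
    ofReal_integral_eq_lintegral_ofReal hk (ae_of_all _ hk0)]

/-- Hölder's inequality with three factors. -/
lemma integral_rpow_mul_rpow_mul_rpow_le {α : Type*} [MeasurableSpace α] {μ : Measure α}
    {f g h : α → ℝ} (hf : Integrable f μ) (hg : Integrable g μ) (hh : Integrable h μ)
    (hf0 : ∀ x, 0 ≤ f x) (hg0 : ∀ x, 0 ≤ g x) (hh0 : ∀ x, 0 ≤ h x) {p q r : ℝ} (hp : 0 ≤ p)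
    (hq : 0 ≤ q) (hr : 0 ≤ r) (hpqr : p + q + r = 1) :
    ∫ x, f x ^ p * g x ^ q * h x ^ r ∂μ ≤
      (∫ x, f x ∂μ) ^ p * (∫ x, g x ∂μ) ^ q * (∫ x, h x ∂μ) ^ r := by
  simpa using integral_rpow_mul_rpow_mul_rpow_mul_rpow_le hf hg hh (integrable_zero α ℝ μ) hf0 hg0
    hh0 (fun _ => le_rfl) hp hq hr le_rfl (by linarith)

/-- Hölder's inequality with two factors. -/
lemma integral_rpow_mul_rpow_le {α : Type*} [MeasurableSpace α] {μ : Measure α}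
    {f g : α → ℝ} (hf : Integrable f μ) (hg : Integrable g μ)
    (hf0 : ∀ x, 0 ≤ f x) (hg0 : ∀ x, 0 ≤ g x) {p q : ℝ} (hp : 0 ≤ p)
    (hq : 0 ≤ q) (hpq : p + q = 1) :
    ∫ x, f x ^ p * g x ^ q ∂μ ≤ (∫ x, f x ∂μ) ^ p * (∫ x, g x ∂μ) ^ q := by
  simpa using integral_rpow_mul_rpow_mul_rpow_le hf hg (integrable_zero α ℝ μ) hf0 hg0
    (fun _ => le_rfl) hp hq le_rfl (by linarith)

lemma norm_fderiv_sq_le (f : E3 → ℝ) (x : E3) : ‖fderiv ℝ f x‖ ^ 2 ≤ ∑ j, pd j f x ^ 2 := by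
  have h0 : 0 ≤ ∑ j, pd j f x ^ 2 := by positivity
  rw [← Real.sqrt_le_sqrt_iff h0, Real.sqrt_sq (norm_nonneg _)]
  refine ContinuousLinearMap.opNorm_le_bound _ (Real.sqrt_nonneg _) fun v => ?_
  have h7 : v = ∑ j, v j • EuclideanSpace.single j (1 : ℝ) := by
    ext i; simp [Finset.sum_apply, Pi.single_apply]
  have h8 : fderiv ℝ f x v = ∑ j, pd j f x * v j := by
    conv_lhs => rw [h7, map_sum]
    simp [pd, mul_comm]
  rw [h8, EuclideanSpace.norm_eq, ← Real.sqrt_mul h0, Real.norm_eq_abs]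
  refine Real.abs_le_sqrt ?_
  simpa using Finset.sum_mul_sq_le_sq_mul_sq Finset.univ (fun j => pd j f x) (fun j => v j)

section GradientBound

open MvPolynomial

/-- Jensen's inequality on the unit ball for continuous functions. -/
lemma integral_rpow_unitB_le {f : E3 → ℝ} (hf : Continuous f) (hf0 : ∀ x, 0 ≤ f x) {p : ℝ}
    (hp0 : 0 ≤ p) (hp1 : p ≤ 1) :
    ∫ x in unitB, f x ^ p ≤ volume.real unitB ^ (1 - p) * (∫ x in unitB, f x) ^ p := by
  have h := integral_rpow_mul_rpow_le (μ := volume.restrict unitB) (g := fun _ => 1)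
    hf.integrableOn_unitB (continuous_const.integrableOn_unitB) hf0 (fun _ => zero_le_one) hp0
    (sub_nonneg.2 hp1) (by ring)
  simpa [mul_comm] using h

lemma setAverage_pderiv_eq_zero (q : MvPolynomial (Fin 3) ℝ) (k : Fin 3) :
    ⨍ x in unitB, ev (pderiv k (rhoP * q)) x = 0 := by
  have h := integral_div_eq_zero (G := fun i => if i = k then ev (rhoP * q) else fun _ => 0)
    (fun i => by split_ifs; exacts [contDiff_ev _, contDiff_const])
    (fun x hx => Finset.sum_eq_zero fun i _ => by
      split_ifs
      · rw [ev_mul, ev_rhoP, bdef_sphere hx]; ring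
      · ring)
  have h2 : ∀ x, ∑ i, pd i (if i = k then ev (rhoP * q) else fun _ => 0) x =
      ev (pderiv k (rhoP * q)) x := by
    intro x
    rw [Finset.sum_eq_single k]
    · simp [pd_ev]
    · intro b _ hb; simp [hb, pd_const]
    · simp
  simp_rw [h2] at h
  rw [setAverage_eq, h, smul_zero]

lemma norm_fderiv_ev_pderiv_sq_le (Φ : MvPolynomial (Fin 3) ℝ) (k : Fin 3) (x : E3) :
    ‖fderiv ℝ (ev (pderiv k Φ)) x‖ ^ 2 ≤ ev (hessSq Φ) x := by
  refine (norm_fderiv_sq_le _ _).trans ?_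
  rw [ev_hessSq]
  simp_rw [pd_ev]
  refine Finset.sum_le_sum fun i _ => ?_
  exact Finset.single_le_sum (f := fun j => ev (pderiv i (pderiv j Φ)) x ^ 2)
    (fun j _ => sq_nonneg _) (Finset.mem_univ k)

lemma ev_pderiv_sq_le (Φ : MvPolynomial (Fin 3) ℝ) (k : Fin 3) (x : E3) :
    ev (pderiv k Φ) x ^ 2 ≤ ev (gradSq Φ) x := by
  rw [ev_gradSq]
  exact Finset.single_le_sum (f := fun j => ev (pderiv j Φ) x ^ 2)
    (fun j _ => sq_nonneg _) (Finset.mem_univ k)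

lemma integral_pderiv_pow_four_le (q : MvPolynomial (Fin 3) ℝ) (k : Fin 3) :
    ∫ x in unitB, ev (pderiv k (rhoP * q)) x ^ 4 ≤
      sobolevC * (∫ x in unitB, ev (hessSq (rhoP * q)) x) ^ 2 := by
  have h := sobolev_poincare (contDiff_ev (n := 1) (pderiv k (rhoP * q)))
  rw [setAverage_pderiv_eq_zero] at h
  simp only [sub_zero, Real.norm_eq_abs, Even.pow_abs (by decide : Even 4)] at h
  refine h.trans (mul_le_mul_of_nonneg_left (pow_le_pow_left₀ (integral_nonneg fun _ => by
    positivity) ?_ 2) sobolevC_pos.le)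
  have := contDiff_ev (n := 1) (pderiv k (rhoP * q))
  exact setIntegral_mono ((this.continuous_fderiv (by norm_num)).norm.pow 2).integrableOn_unitB
    (continuous_ev _).integrableOn_unitB fun x => norm_fderiv_ev_pderiv_sq_le _ _ _

lemma integral_abs_sub_average_pow_four_le (q : MvPolynomial (Fin 3) ℝ) (k : Fin 3) :
    ∫ x in unitB, (ev (pderiv k (rhoP * q)) x ^ 3 -
        ⨍ y in unitB, ev (pderiv k (rhoP * q)) y ^ 3) ^ 4 ≤
      sobolevC * (18 * ∫ x in unitB,
        ev (gradSq (rhoP * q)) x ^ 2 * ev (lapP (rhoP * q)) x ^ 2) ^ 2 := by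
  set Φ := rhoP * q with hΦ
  have h := sobolev_poincare (contDiff_ev (n := 1) (pderiv k Φ ^ 3))
  simp only [Real.norm_eq_abs, Even.pow_abs (by decide : Even 4), ev_pow] at h
  refine h.trans (mul_le_mul_of_nonneg_left (pow_le_pow_left₀ (integral_nonneg fun _ => by
    positivity) ?_ 2) sobolevC_pos.le)
  have h1 := integral_gradSq_sq_mul_hessSq_le q
  have h2 : ∀ x, ‖fderiv ℝ (ev (pderiv k Φ ^ 3)) x‖ ^ 2 ≤
      9 * (ev (gradSq Φ) x ^ 2 * ev (hessSq Φ) x) := by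
    intro x
    have h3 : fderiv ℝ (ev (pderiv k Φ ^ 3)) x =
        (3 * ev (pderiv k Φ) x ^ 2) • fderiv ℝ (ev (pderiv k Φ)) x := by
      rw [funext (ev_pow (pderiv k Φ) 3)]
      rw [fderiv_fun_pow 3 (differentiable_ev _ x)]
      simp
    rw [h3, norm_smul, mul_pow, Real.norm_eq_abs, sq_abs]
    calc (3 * ev (pderiv k Φ) x ^ 2) ^ 2 * ‖fderiv ℝ (ev (pderiv k Φ)) x‖ ^ 2
        ≤ (3 * ev (gradSq Φ) x) ^ 2 * ev (hessSq Φ) x := by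
          gcongr
          · exact ev_pderiv_sq_le _ _ _
          · exact norm_fderiv_ev_pderiv_sq_le _ _ _
      _ = _ := by ring
  have h4 := setIntegral_mono (μ := volume) (s := unitB) (Continuous.integrableOn_unitB
    (((contDiff_ev (n := 1) (pderiv k Φ ^ 3)).continuous_fderiv (by norm_num)).norm.pow 2))
    (Continuous.integrableOn_unitB (by fun_prop)) h2
  rw [integral_const_mul] at h4
  refine h4.trans ?_
  linarith

lemma average_pow_three_pow_four_le (g : E3 → ℝ) (hg : Continuous g) :
    (⨍ y in unitB, g y ^ 3) ^ 4 ≤ (volume.real unitB ^ 3)⁻¹ * (∫ y in unitB, g y ^ 4) ^ 3 := by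
  set b := volume.real unitB with hb
  have hb0 : 0 < b := volume_real_unitB_pos
  have h1 : |∫ y in unitB, g y ^ 3| ≤ b ^ (1 / 4 : ℝ) * (∫ y in unitB, g y ^ 4) ^ (3 / 4 : ℝ) := by
    refine (abs_integral_le_integral_abs).trans ?_
    have := integral_rpow_unitB_le (f := fun x => g x ^ 4) (hg.pow 4)
      (fun x => by positivity) (p := 3 / 4) (by norm_num) (by norm_num)
    norm_num at this
    refine le_trans (le_of_eq ?_) this
    congr 1
    ext x
    rw [← Even.pow_abs (by decide : Even 4), ← Real.rpow_natCast |g x|,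
      ← Real.rpow_mul (abs_nonneg _), abs_pow, ← Real.rpow_natCast |g x|]
    norm_num
  have hI : 0 ≤ ∫ y in unitB, g y ^ 4 := integral_nonneg fun _ => by positivity
  rw [setAverage_eq, smul_eq_mul, mul_pow, ← hb, ← Even.pow_abs (by decide : Even 4) (∫ y in _, _)]
  calc b⁻¹ ^ 4 * |∫ y in unitB, g y ^ 3| ^ 4
      ≤ b⁻¹ ^ 4 * (b ^ (1 / 4 : ℝ) * (∫ y in unitB, g y ^ 4) ^ (3 / 4 : ℝ)) ^ 4 := by gcongr
    _ = b⁻¹ ^ 4 * (b * (∫ y in unitB, g y ^ 4) ^ 3) := by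
        rw [mul_pow, ← Real.rpow_natCast (b ^ _), ← Real.rpow_mul hb0.le,
          ← Real.rpow_natCast (_ ^ (3 / 4 : ℝ)), ← Real.rpow_mul hI, ← Real.rpow_natCast _ 3]
        norm_num
    _ = _ := by field_simp

lemma integral_pow_twelve_le (q : MvPolynomial (Fin 3) ℝ) (k : Fin 3) :
    ∫ x in unitB, ev (pderiv k (rhoP * q)) x ^ 12 ≤
      8 * (sobolevC * (18 * ∫ x in unitB,
        ev (gradSq (rhoP * q)) x ^ 2 * ev (lapP (rhoP * q)) x ^ 2) ^ 2) +
      8 * (volume.real unitB ^ 2)⁻¹ *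
        (sobolevC * (∫ x in unitB, ev (lapP (rhoP * q)) x ^ 2) ^ 2) ^ 3 := by
  have h1 := integral_abs_sub_average_pow_four_le q k
  have h2 := average_pow_three_pow_four_le (ev (pderiv k (rhoP * q))) (continuous_ev _)
  have h3 := integral_pderiv_pow_four_le q k
  have h4 := integral_hessSq_le q
  have hb0 := volume_real_unitB_pos
  have hS := sobolevC_pos
  set m := ⨍ y in unitB, ev (pderiv k (rhoP * q)) y ^ 3
  have h0 : 0 ≤ ∫ x in unitB, ev (pderiv k (rhoP * q)) x ^ 4 :=
    integral_nonneg fun _ => by positivity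
  have h0' : 0 ≤ ∫ x in unitB, ev (hessSq (rhoP * q)) x := integral_nonneg (ev_hessSq_nonneg _)
  have h5 : ∀ x, ev (pderiv k (rhoP * q)) x ^ 12 ≤
      8 * (ev (pderiv k (rhoP * q)) x ^ 3 - m) ^ 4 + 8 * m ^ 4 := by
    intro x
    have : ∀ a c : ℝ, (a + c) ^ 4 ≤ 8 * a ^ 4 + 8 * c ^ 4 := fun a c => by
      nlinarith [sq_nonneg (a - c), sq_nonneg (a + c), sq_nonneg (a ^ 2 - c ^ 2),
        mul_nonneg (sq_nonneg (a - c)) (sq_nonneg (a + c)),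
        mul_nonneg (sq_nonneg (a - c)) (sq_nonneg (a - c)), sq_nonneg (a * c)]
    have := this (ev (pderiv k (rhoP * q)) x ^ 3 - m) m
    calc _ = (ev (pderiv k (rhoP * q)) x ^ 3 - m + m) ^ 4 := by ring
      _ ≤ _ := this
  have h6 := setIntegral_mono (μ := volume) (s := unitB) (Continuous.integrableOn_unitB
    (by fun_prop)) (Continuous.integrableOn_unitB (by fun_prop)) h5
  rw [integral_add (Continuous.integrableOn_unitB (by fun_prop))
    (Continuous.integrableOn_unitB (by fun_prop)), integral_const_mul, integral_const,
    measureReal_restrict_apply_univ, smul_eq_mul] at h6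
  refine h6.trans (add_le_add (by linarith) ?_)
  have h7 : m ^ 4 ≤ (volume.real unitB ^ 3)⁻¹ *
      (sobolevC * (∫ x in unitB, ev (lapP (rhoP * q)) x ^ 2) ^ 2) ^ 3 := by
    refine h2.trans ?_
    gcongr
    refine h3.trans ?_
    gcongr
  calc volume.real unitB * (8 * m ^ 4) ≤ volume.real unitB * (8 * ((volume.real unitB ^ 3)⁻¹ *
      (sobolevC * (∫ x in unitB, ev (lapP (rhoP * q)) x ^ 2) ^ 2) ^ 3)) := by gcongr
    _ = _ := by field_simp

lemma le_of_cubic_le {c₁ c₂ y F : ℝ} (h1 : 0 ≤ c₁) (h2 : 0 ≤ c₂) (hF : 0 ≤ F)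
    (h : y ^ 3 ≤ c₁ * y ^ 2 * F + c₂ * F ^ 3) : y ≤ (c₁ + c₂ + 1) * F := by
  by_contra! hlt
  set K := c₁ + c₂ + 1 with hK
  have hK1 : 1 ≤ K := by linarith
  have hy0 : 0 < y := lt_of_le_of_lt (by positivity) hlt
  have hFy : F ≤ y := by nlinarith
  have a1 : K * F * y ^ 2 < y ^ 3 := by
    calc K * F * y ^ 2 < y * y ^ 2 := by gcongr
      _ = _ := by ring
  have a2 : c₂ * F ^ 3 ≤ c₂ * F * y ^ 2 := by
    have : F ^ 2 ≤ y ^ 2 := by gcongr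
    calc c₂ * F ^ 3 = c₂ * F * F ^ 2 := by ring
      _ ≤ _ := by gcongr
  have a3 : 0 ≤ F * y ^ 2 := by positivity
  rw [hK] at a1
  nlinarith

lemma gradSq_pow_six_le (Φ : MvPolynomial (Fin 3) ℝ) (x : E3) :
    ev (gradSq Φ) x ^ 6 ≤ 243 * ∑ k, ev (pderiv k Φ) x ^ 12 := by
  rw [ev_gradSq]
  have := pow_sum_le_card_mul_sum_pow (s := (Finset.univ : Finset (Fin 3)))
    (f := fun k => ev (pderiv k Φ) x ^ 2) (fun _ _ => sq_nonneg _) 5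
  norm_num [← pow_mul] at this
  exact this

/-- `L¹²` bound of the gradient and weighted bound of the Hessian for the Dirichlet problem on the
unit ball, in terms of the `L³` norm of the right-hand side. -/
lemma exists_gradient_bound : ∃ C : ℝ, 0 < C ∧ ∀ (q : MvPolynomial (Fin 3) ℝ) (F : ℝ), 0 ≤ F →
    ∫ x in unitB, |ev (lapP (rhoP * q)) x| ^ 3 ≤ F ^ 3 →
    ∫ x in unitB, ev (gradSq (rhoP * q)) x ^ 6 ≤ C * F ^ 12 ∧
    ∫ x in unitB, ev (gradSq (rhoP * q)) x ^ 2 * ev (hessSq (rhoP * q)) x ≤ C * F ^ 6 := by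
  set b := volume.real unitB with hb
  have hb0 : 0 < b := volume_real_unitB_pos
  have hS := sobolevC_pos
  set K := 729 * 8 * 324 * sobolevC + 729 * 8 * sobolevC ^ 3 + 1 with hK
  have hK0 : 0 < K := by positivity
  refine ⟨K ^ 3 + 2 * K, by positivity, fun q F hF hFf => ?_⟩
  set Φ := rhoP * q with hΦ
  set S := ∫ x in unitB, ev (lapP Φ) x ^ 2 with hSdef
  set Z := ∫ x in unitB, ev (gradSq Φ) x ^ 2 * ev (lapP Φ) x ^ 2 with hZdef
  set Y := ∫ x in unitB, ev (gradSq Φ) x ^ 6 with hYdef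
  have hS0 : 0 ≤ S := integral_nonneg fun _ => by positivity
  have hZ0 : 0 ≤ Z := integral_nonneg fun _ => by positivity
  have hY0 : 0 ≤ Y := integral_nonneg fun _ => by positivity
  have hT0 : 0 ≤ ∫ x in unitB, |ev (lapP Φ) x| ^ 3 := integral_nonneg fun _ => by positivity
  have hF2 : (∫ x in unitB, |ev (lapP Φ) x| ^ 3) ^ (2 / 3 : ℝ) ≤ F ^ 2 := by
    refine (Real.rpow_le_rpow hT0 hFf (by norm_num)).trans (le_of_eq ?_)
    rw [← Real.rpow_natCast, ← Real.rpow_mul hF, ← Real.rpow_natCast]; norm_num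
  have hpow : ∀ t : ℝ, (|t| ^ 3) ^ (2 / 3 : ℝ) = t ^ 2 := fun t => by
    rw [← Real.rpow_natCast, ← Real.rpow_mul (abs_nonneg _), ← sq_abs, ← Real.rpow_natCast |t| 2]
    norm_num
  have hS1 : S ≤ b ^ (1 / 3 : ℝ) * F ^ 2 := by
    have h := integral_rpow_unitB_le (f := fun x => |ev (lapP Φ) x| ^ 3) (by fun_prop)
      (fun x => by positivity) (p := 2 / 3) (by norm_num) (by norm_num)
    simp only [hpow] at h
    norm_num at h
    exact h.trans (by gcongr)
  have hS6 : S ^ 6 ≤ b ^ 2 * F ^ 12 := by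
    calc S ^ 6 ≤ (b ^ (1 / 3 : ℝ) * F ^ 2) ^ 6 := by gcongr
      _ = _ := by
        rw [mul_pow, ← Real.rpow_natCast (b ^ _), ← Real.rpow_mul hb0.le, ← Real.rpow_natCast b,
          ← pow_mul]
        norm_num
  set y := Y ^ (1 / 3 : ℝ) with hy
  have hy0 : 0 ≤ y := Real.rpow_nonneg hY0 _
  have hy3 : y ^ 3 = Y := by
    rw [hy, ← Real.rpow_natCast, ← Real.rpow_mul hY0]; norm_num
  have hZ1 : Z ≤ y * F ^ 2 := by
    have h := integral_rpow_mul_rpow_le (μ := volume.restrict unitB)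
      (f := fun x => ev (gradSq Φ) x ^ 6) (g := fun x => |ev (lapP Φ) x| ^ 3)
      (Continuous.integrableOn_unitB (by fun_prop)) (Continuous.integrableOn_unitB (by fun_prop))
      (fun x => by positivity) (fun x => by positivity) (p := 1 / 3) (q := 2 / 3) (by norm_num)
      (by norm_num) (by norm_num)
    have h2 : ∀ x, (ev (gradSq Φ) x ^ 6) ^ (1 / 3 : ℝ) = ev (gradSq Φ) x ^ 2 := fun x => by
      rw [← Real.rpow_natCast, ← Real.rpow_mul (ev_gradSq_nonneg Φ x), ← Real.rpow_natCast]
      norm_num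
    simp only [hpow, h2] at h
    exact h.trans (by gcongr)
  have hsum : Y ≤ 243 * ∑ k : Fin 3, ∫ x in unitB, ev (pderiv k Φ) x ^ 12 := by
    have h := setIntegral_mono (μ := volume) (s := unitB)
      (Continuous.integrableOn_unitB (by fun_prop)) (Continuous.integrableOn_unitB (by fun_prop))
      (gradSq_pow_six_le Φ)
    rwa [integral_const_mul, integral_finsetSum _ fun k _ =>
      (Continuous.integrableOn_unitB (by fun_prop))] at h
  have hY1 : y ^ 3 ≤ 729 * 8 * 324 * sobolevC * y ^ 2 * F ^ 4 + 729 * 8 * sobolevC ^ 3 *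
      (F ^ 4) ^ 3 := by
    have h1 : ∑ k : Fin 3, ∫ x in unitB, ev (pderiv k Φ) x ^ 12 ≤ ∑ _k : Fin 3,
        (8 * (sobolevC * (18 * Z) ^ 2) + 8 * (b ^ 2)⁻¹ * (sobolevC * S ^ 2) ^ 3) :=
      Finset.sum_le_sum fun k _ => integral_pow_twelve_le q k
    rw [Finset.sum_const, Finset.card_univ, Fintype.card_fin, nsmul_eq_mul] at h1
    have h2 : 8 * (sobolevC * (18 * Z) ^ 2) ≤ 8 * (sobolevC * (18 * (y * F ^ 2)) ^ 2) := by gcongr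
    have h3 : 8 * (b ^ 2)⁻¹ * (sobolevC * S ^ 2) ^ 3 ≤ 8 * sobolevC ^ 3 * F ^ 12 := by
      calc _ = 8 * (b ^ 2)⁻¹ * sobolevC ^ 3 * S ^ 6 := by ring
        _ ≤ 8 * (b ^ 2)⁻¹ * sobolevC ^ 3 * (b ^ 2 * F ^ 12) := by gcongr
        _ = _ := by field_simp
    rw [hy3]
    push_cast at h1
    nlinarith
  have hyF : y ≤ K * F ^ 4 := le_of_cubic_le (by positivity) (by positivity) (by positivity) hY1
  constructor
  · rw [← hy3]
    calc y ^ 3 ≤ (K * F ^ 4) ^ 3 := by gcongr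
      _ = K ^ 3 * F ^ 12 := by ring
      _ ≤ _ := by gcongr; linarith
  · refine (integral_gradSq_sq_mul_hessSq_le q).trans ?_
    calc 2 * Z ≤ 2 * (K * F ^ 4 * F ^ 2) := by
          have : y * F ^ 2 ≤ K * F ^ 4 * F ^ 2 := by gcongr
          linarith
      _ = 2 * K * F ^ 6 := by ring
      _ ≤ _ := by gcongr; linarith [pow_pos hK0 3]

/-- `L²` bound of the Hessian in terms of the `L³` norm of the Laplacian. -/
lemma integral_hessSq_le_of_cube {q : MvPolynomial (Fin 3) ℝ} {F : ℝ} (hF : 0 ≤ F)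
    (hFf : ∫ x in unitB, |ev (lapP (rhoP * q)) x| ^ 3 ≤ F ^ 3) :
    ∫ x in unitB, ev (hessSq (rhoP * q)) x ≤ volume.real unitB ^ (1 / 3 : ℝ) * F ^ 2 := by
  refine (integral_hessSq_le q).trans ?_
  have hpow : ∀ t : ℝ, (|t| ^ 3) ^ (2 / 3 : ℝ) = t ^ 2 := fun t => by
    rw [← Real.rpow_natCast, ← Real.rpow_mul (abs_nonneg _), ← sq_abs, ← Real.rpow_natCast |t| 2]
    norm_num
  have hF2 : (∫ x in unitB, |ev (lapP (rhoP * q)) x| ^ 3) ^ (2 / 3 : ℝ) ≤ F ^ 2 := by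
    refine (Real.rpow_le_rpow (integral_nonneg fun _ => by positivity) hFf
      (by norm_num)).trans (le_of_eq ?_)
    rw [← Real.rpow_natCast, ← Real.rpow_mul hF, ← Real.rpow_natCast]; norm_num
  have h := integral_rpow_unitB_le (f := fun x => |ev (lapP (rhoP * q)) x| ^ 3) (by fun_prop)
    (fun x => by positivity) (p := 2 / 3) (by norm_num) (by norm_num)
  simp only [hpow] at h
  norm_num at h
  exact h.trans (by gcongr)

end GradientBound

lemma euclideanSpace_eq_sum (v : E3) : v = ∑ j, v j • EuclideanSpace.single j (1 : ℝ) := by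
  ext i; simp [Finset.sum_apply, Pi.single_apply]

lemma fderiv_single_apply {z : E3 → E3} {x : E3} (hz : DifferentiableAt ℝ z x) (i j : Fin 3) :
    fderiv ℝ z x (EuclideanSpace.single i 1) j = pd i (fun y => z y j) x := by
  have h := (hasFDerivAt_coord j (z x)).comp x hz.hasFDerivAt
  have h2 : fderiv ℝ (fun y => z y j) x = _ := h.fderiv
  simp [pd, h2]

lemma norm_fderiv_sq_le_sum {z : E3 → E3} {x : E3} (hz : DifferentiableAt ℝ z x) :
    ‖fderiv ℝ z x‖ ^ 2 ≤ ∑ i, ∑ j, pd j (fun y => z y i) x ^ 2 := by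
  have h0 : 0 ≤ ∑ i, ∑ j, pd j (fun y => z y i) x ^ 2 := by positivity
  rw [← Real.sqrt_le_sqrt_iff h0, Real.sqrt_sq (norm_nonneg _)]
  refine ContinuousLinearMap.opNorm_le_bound _ (Real.sqrt_nonneg _) fun v => ?_
  have h8 : ∀ i, fderiv ℝ z x v i = ∑ j, pd j (fun y => z y i) x * v j := fun i => by
    conv_lhs => rw [euclideanSpace_eq_sum v, map_sum]
    simp [fderiv_single_apply hz, mul_comm]
  rw [EuclideanSpace.norm_eq, EuclideanSpace.norm_eq, ← Real.sqrt_mul h0]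
  refine Real.sqrt_le_sqrt ?_
  simp only [Real.norm_eq_abs, sq_abs, h8]
  rw [Finset.sum_mul]
  exact Finset.sum_le_sum fun i _ => Finset.sum_mul_sq_le_sq_mul_sq _ _ _

/-- The divergence of the radial field with density `‖z‖ ^ p`. -/
lemma sum_pd_radial_le {z : E3 → E3} (hz : ContDiff ℝ 1 z) {p : ℝ} (hp : 1 < p) {x : E3}
    (hx : x ∈ unitB) :
    ∑ i, pd i (fun y => y i * ‖z y‖ ^ p) x ≤
      3 * ‖z x‖ ^ p + p * (‖z x‖ ^ (p - 1) * ‖fderiv ℝ z x‖) := by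
  have hn : ContDiff ℝ 1 fun y => ‖z y‖ ^ p := (contDiff_norm_rpow hp).comp hz
  have hd : DifferentiableAt ℝ (fun y => ‖z y‖ ^ p) x := hn.differentiable (by norm_num) x
  have h1 : ∀ i, pd i (fun y => y i * ‖z y‖ ^ p) x =
      x i * pd i (fun y => ‖z y‖ ^ p) x + ‖z x‖ ^ p := fun i => by
    rw [pd_mul (hasFDerivAt_coord i x).differentiableAt hd, pd_coord]; simp
  have h2 : ∑ i, x i * pd i (fun y => ‖z y‖ ^ p) x = fderiv ℝ (fun y => ‖z y‖ ^ p) x x := by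
    conv_rhs => arg 2; rw [euclideanSpace_eq_sum x]
    simp [pd]
  have h3 : ‖fderiv ℝ (fun y => ‖z y‖ ^ p) x‖ ≤ p * ‖z x‖ ^ (p - 1) * ‖fderiv ℝ z x‖ := by
    have h4 : fderiv ℝ (fun y => ‖z y‖ ^ p) x =
        (fderiv ℝ (fun v : E3 => ‖v‖ ^ p) (z x)).comp (fderiv ℝ z x) :=
      fderiv_comp x ((contDiff_norm_rpow hp).differentiable (by norm_num) _)
        (hz.differentiable (by norm_num) x)
    rw [h4]
    refine (ContinuousLinearMap.opNorm_comp_le _ _).trans ?_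
    gcongr
    rw [norm_fderiv_norm_id_rpow _ hp]
  have h5 : fderiv ℝ (fun y => ‖z y‖ ^ p) x x ≤ ‖fderiv ℝ (fun y => ‖z y‖ ^ p) x‖ := by
    refine (Real.le_norm_self _).trans ((ContinuousLinearMap.le_opNorm _ _).trans ?_)
    rw [mem_ball_zero_iff] at hx
    exact mul_le_of_le_one_right (norm_nonneg _) hx.le
  simp_rw [h1, Finset.sum_add_distrib, h2]
  simp only [Finset.sum_const, Finset.card_univ, Fintype.card_fin, nsmul_eq_mul]
  push_cast
  linarith

lemma rpow_le_mul_pow {I M y θ : ℝ} {n m : ℕ} (hI : 0 ≤ I) (hM : 1 ≤ M) (hy : 0 ≤ y)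
    (hIM : I ≤ M * y ^ n) (hθ0 : 0 ≤ θ) (hθ1 : θ ≤ 1) (hnm : n * θ = m) :
    I ^ θ ≤ M * y ^ m := by
  refine (Real.rpow_le_rpow hI hIM hθ0).trans ?_
  rw [Real.mul_rpow (by linarith) (by positivity), ← Real.rpow_natCast, ← Real.rpow_mul hy, hnm,
    Real.rpow_natCast]
  gcongr
  calc M ^ θ ≤ M ^ (1 : ℝ) := Real.rpow_le_rpow_of_exponent_le hM hθ1
    _ = M := Real.rpow_one M

lemma pow_rpow {t : ℝ} (ht : 0 ≤ t) (n : ℕ) (θ : ℝ) : (t ^ n) ^ θ = t ^ (n * θ) := by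
  rw [← Real.rpow_natCast, ← Real.rpow_mul ht]

/-- A form of Young's inequality. -/
lemma pow_eight_mul_le {s g F κ : ℝ} (hs : 0 ≤ s) (hg : 0 ≤ g) (hF : 0 < F) (hκ : 0 < κ) :
    s ^ 8 * g ≤ F / κ * s ^ 9 + κ ^ 8 / F ^ 8 * g ^ 9 := by
  rcases le_total g (F / κ * s) with h | h
  · calc s ^ 8 * g ≤ s ^ 8 * (F / κ * s) := by gcongr
      _ = F / κ * s ^ 9 := by ring
      _ ≤ _ := le_add_of_nonneg_right (by positivity)
  · have h2 : s ≤ κ / F * g := by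
      rw [div_mul_eq_mul_div, le_div_iff₀ hF]
      rw [div_mul_eq_mul_div, div_le_iff₀ hκ] at h
      linarith
    calc s ^ 8 * g ≤ (κ / F * g) ^ 8 * g := by gcongr
      _ = κ ^ 8 / F ^ 8 * g ^ 9 := by ring
      _ ≤ _ := le_add_of_nonneg_left (by positivity)

section Bilinear

variable {w g : E3 → E3}

lemma integral_norm_rpow_mul_norm_fderiv_le (hw : ContDiff ℝ 1 w) {M α δ : ℝ} (hM : 1 ≤ M)
    (hα : 0 ≤ α) (hδ : 0 ≤ δ) (h2 : ∫ x in unitB, ‖w x‖ ^ 2 ≤ M * α ^ 24)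
    (h4 : ∫ x in unitB, ‖w x‖ ^ 4 ≤ M * δ ^ 48)
    (hD : ∫ x in unitB, ‖fderiv ℝ w x‖ ^ 2 ≤ M * δ ^ 24) :
    ∫ x in unitB, ‖w x‖ ^ (5 / 4 : ℝ) * ‖fderiv ℝ w x‖ ≤ M ^ 3 * (α ^ 9 * δ ^ 18) := by
  have cD : Continuous fun x => ‖fderiv ℝ w x‖ := (hw.continuous_fderiv (by norm_num)).norm
  have cw := hw.continuous
  have h := integral_rpow_mul_rpow_mul_rpow_le (μ := volume.restrict unitB)
    (f := fun x => ‖fderiv ℝ w x‖ ^ 2) (g := fun x => ‖w x‖ ^ 2) (h := fun x => ‖w x‖ ^ 4)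
    (Continuous.integrableOn_unitB (by fun_prop)) (Continuous.integrableOn_unitB (by fun_prop))
    (Continuous.integrableOn_unitB (by fun_prop)) (fun x => by positivity) (fun x => by positivity)
    (fun x => by positivity) (p := 1 / 2) (q := 3 / 8) (r := 1 / 8) (by norm_num) (by norm_num)
    (by norm_num) (by norm_num)
  have hpt : ∀ x, ‖w x‖ ^ (5 / 4 : ℝ) * ‖fderiv ℝ w x‖ = (‖fderiv ℝ w x‖ ^ 2) ^ (1 / 2 : ℝ) *
      (‖w x‖ ^ 2) ^ (3 / 8 : ℝ) * (‖w x‖ ^ 4) ^ (1 / 8 : ℝ) := fun x => by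
    rw [pow_rpow (norm_nonneg _), pow_rpow (norm_nonneg _), pow_rpow (norm_nonneg _), mul_assoc,
      ← Real.rpow_add_of_nonneg (norm_nonneg _) (by norm_num) (by norm_num), mul_comm]
    norm_num
  simp_rw [hpt]
  refine h.trans ?_
  have a1 := rpow_le_mul_pow (n := 24) (m := 12) (integral_nonneg fun _ => by positivity) hM hδ hD
    (θ := 1 / 2) (by norm_num) (by norm_num) (by norm_num)
  have a2 := rpow_le_mul_pow (n := 24) (m := 9) (integral_nonneg fun _ => by positivity) hM hα h2
    (θ := 3 / 8) (by norm_num) (by norm_num) (by norm_num)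
  have a3 := rpow_le_mul_pow (n := 48) (m := 6) (integral_nonneg fun _ => by positivity) hM hδ h4
    (θ := 1 / 8) (by norm_num) (by norm_num) (by norm_num)
  calc _ ≤ M * δ ^ 12 * (M * α ^ 9) * (M * δ ^ 6) := by gcongr
    _ = _ := by ring

lemma integral_norm_rpow_le (hw : Continuous w) {M α δ : ℝ} (hM : 1 ≤ M)
    (hα : 0 ≤ α) (hδ : 0 ≤ δ) (h2 : ∫ x in unitB, ‖w x‖ ^ 2 ≤ M * α ^ 24)
    (h4 : ∫ x in unitB, ‖w x‖ ^ 4 ≤ M * δ ^ 48) (hαδ : α ^ 12 ≤ M * δ ^ 12) :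
    ∫ x in unitB, ‖w x‖ ^ (9 / 4 : ℝ) ≤ M ^ 3 * (α ^ 9 * δ ^ 18) := by
  have h := integral_rpow_mul_rpow_le (μ := volume.restrict unitB)
    (f := fun x => ‖w x‖ ^ 2) (g := fun x => ‖w x‖ ^ 4)
    (Continuous.integrableOn_unitB (by fun_prop)) (Continuous.integrableOn_unitB (by fun_prop))
    (fun x => by positivity) (fun x => by positivity)
    (p := 7 / 8) (q := 1 / 8) (by norm_num) (by norm_num) (by norm_num)
  have hpt : ∀ x, ‖w x‖ ^ (9 / 4 : ℝ) =
      (‖w x‖ ^ 2) ^ (7 / 8 : ℝ) * (‖w x‖ ^ 4) ^ (1 / 8 : ℝ) := fun x => by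
    rw [pow_rpow (norm_nonneg _), pow_rpow (norm_nonneg _),
      ← Real.rpow_add_of_nonneg (norm_nonneg _) (by norm_num) (by norm_num)]
    norm_num
  simp_rw [hpt]
  refine h.trans ?_
  have a2 := rpow_le_mul_pow (n := 24) (m := 21) (integral_nonneg fun _ => by positivity) hM hα h2
    (θ := 7 / 8) (by norm_num) (by norm_num) (by norm_num)
  have a3 := rpow_le_mul_pow (n := 48) (m := 6) (integral_nonneg fun _ => by positivity) hM hδ h4
    (θ := 1 / 8) (by norm_num) (by norm_num) (by norm_num)
  calc _ ≤ M * α ^ 21 * (M * δ ^ 6) := by gcongr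
    _ = M ^ 2 * (α ^ 9 * δ ^ 6) * α ^ 12 := by ring
    _ ≤ M ^ 2 * (α ^ 9 * δ ^ 6) * (M * δ ^ 12) := by gcongr
    _ = _ := by ring

lemma integral_norm_mul_norm_mul_norm_le (hw : ContDiff ℝ 1 w) (hg : Continuous g) {M α δ F : ℝ}
    (hM : 1 ≤ M) (hα : 0 ≤ α) (hδ : 0 ≤ δ) (hF : 0 ≤ F)
    (h2 : ∫ x in unitB, ‖w x‖ ^ 2 ≤ M * α ^ 24)
    (h4 : ∫ x in unitB, ‖w x‖ ^ 4 ≤ M * δ ^ 48)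
    (hD : ∫ x in unitB, ‖fderiv ℝ w x‖ ^ 2 ≤ M * δ ^ 24)
    (hN : ∫ x in unitB, ‖g x‖ ^ 12 ≤ M * F ^ 12) :
    ∫ x in unitB, ‖w x‖ * ‖fderiv ℝ w x‖ * ‖g x‖ ≤ M ^ 4 * (α ^ 8 * δ ^ 16 * F) := by
  have cD : Continuous fun x => ‖fderiv ℝ w x‖ := (hw.continuous_fderiv (by norm_num)).norm
  have cw := hw.continuous
  have h := integral_rpow_mul_rpow_mul_rpow_mul_rpow_le (μ := volume.restrict unitB)
    (f := fun x => ‖fderiv ℝ w x‖ ^ 2) (g := fun x => ‖w x‖ ^ 2) (h := fun x => ‖w x‖ ^ 4)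
    (k := fun x => ‖g x‖ ^ 12)
    (Continuous.integrableOn_unitB (by fun_prop)) (Continuous.integrableOn_unitB (by fun_prop))
    (Continuous.integrableOn_unitB (by fun_prop)) (Continuous.integrableOn_unitB (by fun_prop))
    (fun x => by positivity) (fun x => by positivity)
    (fun x => by positivity) (fun x => by positivity) (p := 1 / 2) (q := 1 / 3) (r := 1 / 12)
    (s := 1 / 12) (by norm_num) (by norm_num)
    (by norm_num) (by norm_num) (by norm_num)
  have hpt : ∀ x, ‖w x‖ * ‖fderiv ℝ w x‖ * ‖g x‖ = (‖fderiv ℝ w x‖ ^ 2) ^ (1 / 2 : ℝ) *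
      (‖w x‖ ^ 2) ^ (1 / 3 : ℝ) * (‖w x‖ ^ 4) ^ (1 / 12 : ℝ) * (‖g x‖ ^ 12) ^ (1 / 12 : ℝ) :=
    fun x => by
      rw [pow_rpow (norm_nonneg _), pow_rpow (norm_nonneg _), pow_rpow (norm_nonneg _),
        pow_rpow (norm_nonneg _), mul_assoc (_ ^ _) (‖w x‖ ^ _),
        ← Real.rpow_add_of_nonneg (norm_nonneg _) (by norm_num) (by norm_num), mul_comm ‖w x‖]
      norm_num
  simp_rw [hpt]
  refine h.trans ?_
  have a1 := rpow_le_mul_pow (n := 24) (m := 12) (integral_nonneg fun _ => by positivity) hM hδ hD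
    (θ := 1 / 2) (by norm_num) (by norm_num) (by norm_num)
  have a2 := rpow_le_mul_pow (n := 24) (m := 8) (integral_nonneg fun _ => by positivity) hM hα h2
    (θ := 1 / 3) (by norm_num) (by norm_num) (by norm_num)
  have a3 := rpow_le_mul_pow (n := 48) (m := 4) (integral_nonneg fun _ => by positivity) hM hδ h4
    (θ := 1 / 12) (by norm_num) (by norm_num) (by norm_num)
  have a4 := rpow_le_mul_pow (n := 12) (m := 1) (integral_nonneg fun _ => by positivity) hM hF hN
    (θ := 1 / 12) (by norm_num) (by norm_num) (by norm_num)
  calc _ ≤ M * δ ^ 12 * (M * α ^ 8) * (M * δ ^ 4) * (M * F ^ 1) := by gcongr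
    _ = _ := by ring

lemma integral_norm_pow_nine_le (hg : Continuous g) {M F : ℝ} (hM : 1 ≤ M) (hF : 0 ≤ F)
    (hb : volume.real unitB ≤ M) (hN : ∫ x in unitB, ‖g x‖ ^ 12 ≤ M * F ^ 12) :
    ∫ x in unitB, ‖g x‖ ^ (9 : ℝ) ≤ M ^ 2 * F ^ 9 := by
  have h := integral_rpow_unitB_le (f := fun x => ‖g x‖ ^ 12) (by fun_prop)
    (fun x => by positivity) (p := 3 / 4) (by norm_num) (by norm_num)
  have hpt : ∀ x, ‖g x‖ ^ (9 : ℝ) = (‖g x‖ ^ 12) ^ (3 / 4 : ℝ) := fun x => by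
    rw [pow_rpow (norm_nonneg _)]; norm_num
  simp_rw [hpt]
  refine h.trans ?_
  have a1 := rpow_le_mul_pow (n := 12) (m := 9) (integral_nonneg fun _ => by positivity) hM hF hN
    (θ := 3 / 4) (by norm_num) (by norm_num) (by norm_num)
  have a2 := rpow_le_mul_pow (n := 0) (m := 0) volume_real_unitB_pos.le hM (zero_le_one)
    (by simpa using hb) (θ := 1 - 3 / 4) (by norm_num) (by norm_num) (by norm_num)
  calc _ ≤ M * 1 ^ 0 * (M * F ^ 9) := by gcongr
    _ = _ := by ring

lemma integral_norm_pow_eight_mul_le (hg : ContDiff ℝ 1 g) {M F : ℝ} (hM : 1 ≤ M) (hF : 0 ≤ F)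
    (hN : ∫ x in unitB, ‖g x‖ ^ 12 ≤ M * F ^ 12)
    (hH : ∫ x in unitB, ‖g x‖ ^ 4 * ‖fderiv ℝ g x‖ ^ 2 ≤ M * F ^ 6) :
    ∫ x in unitB, ‖g x‖ ^ (9 - 1 : ℝ) * ‖fderiv ℝ g x‖ ≤ M ^ 2 * F ^ 9 := by
  have cD : Continuous fun x => ‖fderiv ℝ g x‖ := (hg.continuous_fderiv (by norm_num)).norm
  have cw := hg.continuous
  have h := integral_rpow_mul_rpow_le (μ := volume.restrict unitB)
    (f := fun x => ‖g x‖ ^ 12) (g := fun x => ‖g x‖ ^ 4 * ‖fderiv ℝ g x‖ ^ 2)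
    (Continuous.integrableOn_unitB (by fun_prop)) (Continuous.integrableOn_unitB (by fun_prop))
    (fun x => by positivity) (fun x => by positivity)
    (p := 1 / 2) (q := 1 / 2) (by norm_num) (by norm_num) (by norm_num)
  have hpt : ∀ x, ‖g x‖ ^ (9 - 1 : ℝ) * ‖fderiv ℝ g x‖ =
      (‖g x‖ ^ 12) ^ (1 / 2 : ℝ) * (‖g x‖ ^ 4 * ‖fderiv ℝ g x‖ ^ 2) ^ (1 / 2 : ℝ) := fun x => by
    rw [Real.mul_rpow (by positivity) (by positivity), pow_rpow (norm_nonneg _),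
      pow_rpow (norm_nonneg _), pow_rpow (norm_nonneg _), ← mul_assoc,
      ← Real.rpow_add_of_nonneg (norm_nonneg _) (by norm_num) (by norm_num)]
    norm_num
  simp_rw [hpt]
  refine h.trans ?_
  have a1 := rpow_le_mul_pow (n := 12) (m := 6) (integral_nonneg fun _ => by positivity) hM hF hN
    (θ := 1 / 2) (by norm_num) (by norm_num) (by norm_num)
  have a2 := rpow_le_mul_pow (n := 6) (m := 3) (integral_nonneg fun _ => by positivity) hM hF hH
    (θ := 1 / 2) (by norm_num) (by norm_num) (by norm_num)
  calc _ ≤ M * F ^ 6 * (M * F ^ 3) := by gcongr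
    _ = _ := by ring

end Bilinear

section Trilinear

variable {w g : E3 → E3}

lemma abs_pd_coord_le {z : E3 → E3} {x : E3} (hz : DifferentiableAt ℝ z x) (i j : Fin 3) :
    |pd i (fun y => z y j) x| ≤ ‖fderiv ℝ z x‖ := by
  rw [← fderiv_single_apply hz, ← Real.norm_eq_abs]
  refine (PiLp.norm_apply_le _ j).trans ((ContinuousLinearMap.le_opNorm _ _).trans ?_)
  simp

lemma abs_coord_le (v : E3) (i : Fin 3) : |v i| ≤ ‖v‖ := by
  rw [← Real.norm_eq_abs]; exact PiLp.norm_apply_le v i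

lemma abs_sum_mul_le (v u : E3) : |∑ j, v j * u j| ≤ ‖v‖ * ‖u‖ := by
  have h := abs_real_inner_le_norm u v
  rw [mul_comm]
  simpa [PiLp.inner_apply] using h

lemma contDiff_apply_coord {z : E3 → E3} (hz : ContDiff ℝ 1 z) (j : Fin 3) :
    ContDiff ℝ 1 fun y => z y j :=
  (contDiff_coord j).comp hz

lemma trilinear_le_div (hw : ContDiff ℝ 1 w) (hg : ContDiff ℝ 1 g) (x : E3) :
    |∑ i, ∑ j, w x i * w x j * pd i (fun y => g y j) x -
      ∑ i, pd i (fun y => w y i * ∑ j, w y j * g y j) x| ≤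
        12 * (‖w x‖ * ‖fderiv ℝ w x‖ * ‖g x‖) := by
  have dw : ∀ j, DifferentiableAt ℝ (fun y => w y j) x := fun j =>
    (contDiff_apply_coord hw j).differentiable (by norm_num) x
  have dg : ∀ j, DifferentiableAt ℝ (fun y => g y j) x := fun j =>
    (contDiff_apply_coord hg j).differentiable (by norm_num) x
  have h1 : ∀ i, pd i (fun y => w y i * ∑ j, w y j * g y j) x =
      w x i * ∑ j, (w x j * pd i (fun y => g y j) x + g x j * pd i (fun y => w y j) x) +
        (∑ j, w x j * g x j) * pd i (fun y => w y i) x := fun i => by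
    rw [pd_mul (dw i) (by fun_prop)]
    rw [pd_sum _ (f := fun j y => w y j * g y j) fun j _ => (dw j).mul (dg j)]
    simp_rw [pd_mul (dw _) (dg _)]
  have h2 : ∑ i, ∑ j, w x i * w x j * pd i (fun y => g y j) x -
      ∑ i, pd i (fun y => w y i * ∑ j, w y j * g y j) x =
        -∑ i, ((∑ j, w x i * g x j * pd i (fun y => w y j) x) +
          (∑ j, w x j * g x j) * pd i (fun y => w y i) x) := by
    simp_rw [h1, ← Finset.sum_sub_distrib, ← Finset.sum_neg_distrib]
    refine Finset.sum_congr rfl fun i _ => ?_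
    rw [Finset.mul_sum, ← sub_sub, ← Finset.sum_sub_distrib, neg_add, ← sub_eq_add_neg,
      ← Finset.sum_neg_distrib]
    congr 1
    exact Finset.sum_congr rfl fun j _ => by ring
  have hwd := hw.differentiable (by norm_num) x
  rw [h2, abs_neg]
  calc _ ≤ ∑ i : Fin 3, ((∑ j : Fin 3, ‖w x‖ * ‖g x‖ * ‖fderiv ℝ w x‖) +
        ‖w x‖ * ‖g x‖ * ‖fderiv ℝ w x‖) := by
        refine (Finset.abs_sum_le_sum_abs _ _).trans (Finset.sum_le_sum fun i _ => ?_)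
        refine (abs_add_le _ _).trans (add_le_add ((Finset.abs_sum_le_sum_abs _ _).trans
          (Finset.sum_le_sum fun j _ => ?_)) ?_)
        · rw [abs_mul, abs_mul]
          gcongr
          exacts [abs_coord_le _ _, abs_coord_le _ _, abs_pd_coord_le hwd _ _]
        · rw [abs_mul]
          gcongr
          exacts [abs_sum_mul_le _ _, abs_pd_coord_le hwd _ _]
    _ = _ := by simp; ring

lemma integral_mul_add_mul_add {Ω : Type*} [MeasurableSpace Ω] {μ : Measure Ω}
    {f₁ f₂ f₃ f₄ : Ω → ℝ} (h₁ : Integrable f₁ μ) (h₂ : Integrable f₂ μ) (h₃ : Integrable f₃ μ)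
    (h₄ : Integrable f₄ μ) (A B a b c d : ℝ) :
    ∫ x, (A * (a * f₁ x + b * f₂ x) + B * (c * f₃ x + d * f₄ x)) ∂μ =
      A * (a * (∫ x, f₁ x ∂μ) + b * ∫ x, f₂ x ∂μ) +
        B * (c * (∫ x, f₃ x ∂μ) + d * ∫ x, f₄ x ∂μ) := by
  have k₁ : Integrable (fun x => a * f₁ x + b * f₂ x) μ := (h₁.const_mul a).add (h₂.const_mul b)
  have k₂ : Integrable (fun x => c * f₃ x + d * f₄ x) μ := (h₃.const_mul c).add (h₄.const_mul d)
  rw [integral_add (k₁.const_mul A) (k₂.const_mul B), integral_const_mul, integral_const_mul,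
    integral_add (h₁.const_mul a) (h₂.const_mul b), integral_add (h₃.const_mul c) (h₄.const_mul d)]
  simp_rw [integral_const_mul]

/-- The key trilinear estimate, obtained by comparing the field `w ⟪w, g⟫` with a radial field
through the divergence theorem. -/
lemma abs_integral_trilinear_le (hw : ContDiff ℝ 1 w) (hg : ContDiff ℝ 1 g) {M α δ F : ℝ}
    (hM : 1 ≤ M) (hα : 0 < α) (hδ : 0 < δ) (hF : 0 < F)
    (h2 : ∫ x in unitB, ‖w x‖ ^ 2 ≤ M * α ^ 24)
    (h4 : ∫ x in unitB, ‖w x‖ ^ 4 ≤ M * δ ^ 48)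
    (hD : ∫ x in unitB, ‖fderiv ℝ w x‖ ^ 2 ≤ M * δ ^ 24) (hαδ : α ^ 12 ≤ M * δ ^ 12)
    (hb : volume.real unitB ≤ M) (hN : ∫ x in unitB, ‖g x‖ ^ 12 ≤ M * F ^ 12)
    (hH : ∫ x in unitB, ‖g x‖ ^ 4 * ‖fderiv ℝ g x‖ ^ 2 ≤ M * F ^ 6) :
    |∫ x in unitB, ∑ i, ∑ j, w x i * w x j * pd i (fun y => g y j) x| ≤
      30 * M ^ 4 * (α ^ 8 * δ ^ 16 * F) := by
  have cwi := contDiff_apply_coord hw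
  have cgi := contDiff_apply_coord hg
  set A := F / (α * δ ^ 2) with hA
  set B := (α * δ ^ 2) ^ 8 / F ^ 8 with hB
  have hA0 : 0 ≤ A := by positivity
  have hB0 : 0 ≤ B := by positivity
  have cn : ContDiff ℝ 1 fun y => ‖w y‖ ^ (9 / 4 : ℝ) := (contDiff_norm_rpow (by norm_num)).comp hw
  have cm : ContDiff ℝ 1 fun y => ‖g y‖ ^ (9 : ℝ) := (contDiff_norm_rpow (by norm_num)).comp hg
  let G : Fin 3 → E3 → ℝ := fun i y => w y i * ∑ j, w y j * g y j
  let H : Fin 3 → E3 → ℝ := fun i y => A * (y i * ‖w y‖ ^ (9 / 4 : ℝ)) + B * (y i * ‖g y‖ ^ (9 : ℝ))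
  have cG : ∀ i, ContDiff ℝ 1 (G i) := fun i =>
    (cwi i).mul (ContDiff.sum fun j _ => (cwi j).mul (cgi j))
  have c1 : ∀ i, ContDiff ℝ 1 fun y : E3 => y i * ‖w y‖ ^ (9 / 4 : ℝ) := fun i =>
    (contDiff_coord i).mul cn
  have c2 : ∀ i, ContDiff ℝ 1 fun y : E3 => y i * ‖g y‖ ^ (9 : ℝ) := fun i =>
    (contDiff_coord i).mul cm
  have cH : ∀ i, ContDiff ℝ 1 (H i) := fun i =>
    (contDiff_const.mul (c1 i)).add (contDiff_const.mul (c2 i))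
  have hGH : ∀ x ∈ sphere (0 : E3) 1, |∑ i, x i * G i x| ≤ ∑ i, x i * H i x := fun x hx => by
    have e1 : ∑ i, x i * G i x = (∑ i, w x i * x i) * ∑ j, w x j * g x j := by
      rw [Finset.sum_mul]; exact Finset.sum_congr rfl fun i _ => by simp only [G]; ring
    have hx1 : ‖x‖ = 1 := by simpa using hx
    have e2 : ∑ i, x i * H i x = A * ‖w x‖ ^ (9 / 4 : ℝ) + B * ‖g x‖ ^ (9 : ℝ) := by
      have e3 : ∑ i, x i ^ 2 = 1 := by rw [← EuclideanSpace.real_norm_sq_eq, hx1, one_pow]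
      calc _ = (∑ i, x i ^ 2) * (A * ‖w x‖ ^ (9 / 4 : ℝ) + B * ‖g x‖ ^ (9 : ℝ)) := by
            rw [Finset.sum_mul]; exact Finset.sum_congr rfl fun i _ => by simp only [H]; ring
        _ = _ := by rw [e3, one_mul]
    have hy := pow_eight_mul_le (s := ‖w x‖ ^ (1 / 4 : ℝ)) (by positivity) (norm_nonneg (g x)) hF
      (κ := α * δ ^ 2) (by positivity)
    rw [← Real.rpow_natCast (_ ^ _) 8, ← Real.rpow_natCast (_ ^ _) 9, ← Real.rpow_mul
      (norm_nonneg _), ← Real.rpow_mul (norm_nonneg _), ← Real.rpow_natCast ‖g x‖ 9] at hy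
    norm_num at hy
    rw [e1, e2, abs_mul]
    calc _ ≤ ‖w x‖ * ‖x‖ * (‖w x‖ * ‖g x‖) := by
          gcongr <;> exact abs_sum_mul_le _ _
      _ = ‖w x‖ ^ 2 * ‖g x‖ := by rw [hx1]; ring
      _ ≤ _ := by simpa [hA, hB] using hy
  have hInt : |∫ x in unitB, ∑ i, pd i (G i) x| ≤ ∫ x in unitB, ∑ i, pd i (H i) x := by
    have iG : IntegrableOn (fun x => ∑ i, pd i (G i) x) unitB :=
      Continuous.integrableOn_unitB (continuous_finsetSum _ fun i _ => continuous_pd (cG i) i)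
    have iH : IntegrableOn (fun x => ∑ i, pd i (H i) x) unitB :=
      Continuous.integrableOn_unitB (continuous_finsetSum _ fun i _ => continuous_pd (cH i) i)
    have dG : ∀ i x, DifferentiableAt ℝ (G i) x := fun i x =>
      (cG i).differentiable (by norm_num) x
    have dH : ∀ i x, DifferentiableAt ℝ (H i) x := fun i x =>
      (cH i).differentiable (by norm_num) x
    have k1 := integral_div_nonneg (G := fun i y => H i y - G i y) (fun i => (cH i).sub (cG i))
      fun x hx => by
        have := (abs_le.1 (hGH x hx)).2
        simp_rw [mul_sub, Finset.sum_sub_distrib]; linarith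
    have k2 := integral_div_nonneg (G := fun i y => H i y + G i y) (fun i => (cH i).add (cG i))
      fun x hx => by
        have := (abs_le.1 (hGH x hx)).1
        simp_rw [mul_add, Finset.sum_add_distrib]; linarith
    simp_rw [pd_sub (dH _ _) (dG _ _), Finset.sum_sub_distrib] at k1
    simp_rw [pd_add (dH _ _) (dG _ _), Finset.sum_add_distrib] at k2
    rw [integral_sub iH iG] at k1
    rw [integral_add iH iG] at k2
    exact abs_le.2 ⟨by linarith, by linarith⟩
  have hHle : ∫ x in unitB, ∑ i, pd i (H i) x ≤ 18 * M ^ 4 * (α ^ 8 * δ ^ 16 * F) := by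
    have r1 : Continuous fun x => ‖w x‖ ^ (9 / 4 : ℝ) := cn.continuous
    have r2 : Continuous fun x => ‖g x‖ ^ (9 : ℝ) := cm.continuous
    have r3 : Continuous fun x => ‖w x‖ ^ (9 / 4 - 1 : ℝ) * ‖fderiv ℝ w x‖ :=
      (hw.continuous.norm.rpow_const fun _ => Or.inr (by norm_num)).mul
        (hw.continuous_fderiv (by norm_num)).norm
    have r4 : Continuous fun x => ‖g x‖ ^ (9 - 1 : ℝ) * ‖fderiv ℝ g x‖ :=
      (hg.continuous.norm.rpow_const fun _ => Or.inr (by norm_num)).mul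
        (hg.continuous_fderiv (by norm_num)).norm
    have hpt : ∀ x ∈ unitB, ∑ i, pd i (H i) x ≤
        A * (3 * ‖w x‖ ^ (9 / 4 : ℝ) + 9 / 4 * (‖w x‖ ^ (9 / 4 - 1 : ℝ) * ‖fderiv ℝ w x‖)) +
          B * (3 * ‖g x‖ ^ (9 : ℝ) + 9 * (‖g x‖ ^ (9 - 1 : ℝ) * ‖fderiv ℝ g x‖)) := by
      intro x hx
      have d1 : ∀ i, DifferentiableAt ℝ (fun y : E3 => y i * ‖w y‖ ^ (9 / 4 : ℝ)) x := fun i =>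
        (c1 i).differentiable (by norm_num) x
      have d2 : ∀ i, DifferentiableAt ℝ (fun y : E3 => y i * ‖g y‖ ^ (9 : ℝ)) x := fun i =>
        (c2 i).differentiable (by norm_num) x
      have e : ∀ i, pd i (H i) x = A * pd i (fun y : E3 => y i * ‖w y‖ ^ (9 / 4 : ℝ)) x +
          B * pd i (fun y : E3 => y i * ‖g y‖ ^ (9 : ℝ)) x := fun i => by
        simp only [H]
        rw [pd_add ((d1 i).const_mul A) ((d2 i).const_mul B),
          pd_mul (differentiableAt_const _) (d1 i), pd_mul (differentiableAt_const _) (d2 i),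
          pd_const, pd_const]
        ring
      simp_rw [e, Finset.sum_add_distrib, ← Finset.mul_sum]
      gcongr
      · exact sum_pd_radial_le hw (by norm_num) hx
      · exact sum_pd_radial_le hg (by norm_num) hx
    have i1 := r1.integrableOn_unitB
    have i2 := r2.integrableOn_unitB
    have i3 := r3.integrableOn_unitB
    have i4 := r4.integrableOn_unitB
    have l1 := integral_norm_rpow_le hw.continuous hM hα.le hδ.le h2 h4 hαδ
    have l2 := integral_norm_pow_nine_le hg.continuous hM hF.le hb hN
    have l3 := integral_norm_rpow_mul_norm_fderiv_le hw hM hα.le hδ.le h2 h4 hD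
    rw [show (5 / 4 : ℝ) = 9 / 4 - 1 by norm_num] at l3
    have l4 := integral_norm_pow_eight_mul_le hg hM hF.le hN hH
    calc _ ≤ ∫ x in unitB,
        (A * (3 * ‖w x‖ ^ (9 / 4 : ℝ) + 9 / 4 * (‖w x‖ ^ (9 / 4 - 1 : ℝ) * ‖fderiv ℝ w x‖)) +
          B * (3 * ‖g x‖ ^ (9 : ℝ) + 9 * (‖g x‖ ^ (9 - 1 : ℝ) * ‖fderiv ℝ g x‖))) :=
          setIntegral_mono_on
            (Continuous.integrableOn_unitB (continuous_finsetSum _ fun i _ =>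
              continuous_pd (cH i) i))
            ((((i1.const_mul 3).add (i3.const_mul (9 / 4))).const_mul A).add
              (((i2.const_mul 3).add (i4.const_mul 9)).const_mul B)) measurableSet_ball hpt
      _ = A * (3 * (∫ x in unitB, ‖w x‖ ^ (9 / 4 : ℝ)) +
            9 / 4 * ∫ x in unitB, ‖w x‖ ^ (9 / 4 - 1 : ℝ) * ‖fderiv ℝ w x‖) +
          B * (3 * (∫ x in unitB, ‖g x‖ ^ (9 : ℝ)) +
            9 * ∫ x in unitB, ‖g x‖ ^ (9 - 1 : ℝ) * ‖fderiv ℝ g x‖) := by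
          exact integral_mul_add_mul_add i1 i3 i2 i4 A B 3 (9 / 4) 3 9
      _ ≤ A * (3 * (M ^ 3 * (α ^ 9 * δ ^ 18)) + 9 / 4 * (M ^ 3 * (α ^ 9 * δ ^ 18))) +
          B * (3 * (M ^ 2 * F ^ 9) + 9 * (M ^ 2 * F ^ 9)) := by gcongr
      _ = (21 / 4 * M ^ 3 + 12 * M ^ 2) * (α ^ 8 * δ ^ 16 * F) := by
          rw [hA, hB]; field_simp; ring
      _ ≤ (21 / 4 * M ^ 4 + 12 * M ^ 4) * (α ^ 8 * δ ^ 16 * F) := by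
          gcongr <;> first | exact hM | norm_num
      _ ≤ _ := by
          have : 0 ≤ M ^ 4 * (α ^ 8 * δ ^ 16 * F) := by positivity
          linarith
  have hTG : |(∫ x in unitB, ∑ i, ∑ j, w x i * w x j * pd i (fun y => g y j) x) -
      ∫ x in unitB, ∑ i, pd i (G i) x| ≤ 12 * M ^ 4 * (α ^ 8 * δ ^ 16 * F) := by
    have cD := (hw.continuous_fderiv (by norm_num)).norm
    have cw := hw.continuous
    have cg := hg.continuous
    have cw' := fun i => (cwi i).continuous
    have cpd := fun i j => continuous_pd (cgi j) i
    rw [← integral_sub (Continuous.integrableOn_unitB (by fun_prop))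
      (Continuous.integrableOn_unitB (continuous_finsetSum _ fun i _ => continuous_pd (cG i) i))]
    refine abs_integral_le_integral_abs.trans ?_
    refine (integral_mono_of_nonneg (ae_of_all _ fun _ => abs_nonneg _)
      (Continuous.integrableOn_unitB (by fun_prop))
      (ae_of_all _ fun x => trilinear_le_div hw hg x)).trans ?_
    rw [integral_const_mul]
    have := integral_norm_mul_norm_mul_norm_le hw cg hM hα.le hδ.le hF.le h2 h4 hD hN
    linarith
  have := abs_sub_abs_le_abs_sub (∫ x in unitB, ∑ i, ∑ j, w x i * w x j * pd i (fun y => g y j) x)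
    (∫ x in unitB, ∑ i, pd i (G i) x)
  linarith

end Trilinear

open MvPolynomial

/-- The gradient field of a polynomial. -/
def gradField (Φ : MvPolynomial (Fin 3) ℝ) (x : E3) : E3 :=
  WithLp.toLp 2 fun i => ev (pderiv i Φ) x

lemma contDiff_gradField (Φ : MvPolynomial (Fin 3) ℝ) : ContDiff ℝ 1 (gradField Φ) :=
  contDiff_euclidean.2 fun i => by
    change ContDiff ℝ 1 fun x => ev (pderiv i Φ) x
    fun_prop

lemma norm_gradField_sq (Φ : MvPolynomial (Fin 3) ℝ) (x : E3) :
    ‖gradField Φ x‖ ^ 2 = ev (gradSq Φ) x := by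
  rw [EuclideanSpace.real_norm_sq_eq, ev_gradSq]; rfl

lemma norm_fderiv_gradField_sq_le (Φ : MvPolynomial (Fin 3) ℝ) (x : E3) :
    ‖fderiv ℝ (gradField Φ) x‖ ^ 2 ≤ ev (hessSq Φ) x := by
  refine (norm_fderiv_sq_le_sum ((contDiff_gradField Φ).differentiable (by norm_num) x)).trans
    (le_of_eq ?_)
  rw [ev_hessSq, Finset.sum_comm]
  refine Finset.sum_congr rfl fun i _ => Finset.sum_congr rfl fun j _ => ?_
  rw [← pd_ev]; rfl

section Smooth

variable {w : E3 → E3} {q : MvPolynomial (Fin 3) ℝ} {M C α δ F : ℝ}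

lemma abs_integral_trilinear_ev_le (hw : ContDiff ℝ 1 w)
    (hM : 1 ≤ M) (hα : 0 < α) (hδ : 0 < δ) (hF : 0 < F)
    (h2 : ∫ x in unitB, ‖w x‖ ^ 2 ≤ M * α ^ 24)
    (h4 : ∫ x in unitB, ‖w x‖ ^ 4 ≤ M * δ ^ 48)
    (hD : ∫ x in unitB, ‖fderiv ℝ w x‖ ^ 2 ≤ M * δ ^ 24) (hαδ : α ^ 12 ≤ M * δ ^ 12)
    (hb : volume.real unitB ≤ M)
    (hN : ∫ x in unitB, ev (gradSq (rhoP * q)) x ^ 6 ≤ M * F ^ 12)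
    (hH : ∫ x in unitB, ev (gradSq (rhoP * q)) x ^ 2 * ev (hessSq (rhoP * q)) x ≤ M * F ^ 6) :
    |∫ x in unitB, ∑ i, ∑ j, w x i * w x j * ev (pderiv i (pderiv j (rhoP * q))) x| ≤
      30 * M ^ 4 * (α ^ 8 * δ ^ 16 * F) := by
  have h := abs_integral_trilinear_le (g := gradField (rhoP * q)) hw (contDiff_gradField _) hM hα
    hδ hF h2 h4 hD hαδ hb ?_ ?_
  · refine le_trans (le_of_eq ?_) h
    congr 1
    refine integral_congr_ae (ae_of_all _ fun x => ?_)
    refine Finset.sum_congr rfl fun i _ => Finset.sum_congr rfl fun j _ => ?_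
    congr 1
    rw [← pd_ev]; rfl
  · refine le_trans (le_of_eq ?_) hN
    refine integral_congr_ae (ae_of_all _ fun x => ?_)
    simp only [← norm_gradField_sq, ← pow_mul]
  · refine le_trans ?_ hH
    have cg := (contDiff_gradField (rhoP * q)).continuous
    have cD := ((contDiff_gradField (rhoP * q)).continuous_fderiv (by norm_num)).norm
    refine setIntegral_mono (μ := volume) (s := unitB) (Continuous.integrableOn_unitB (by fun_prop))
      (Continuous.integrableOn_unitB (by fun_prop)) fun x => ?_
    have e : ‖gradField (rhoP * q) x‖ ^ 4 = ev (gradSq (rhoP * q)) x ^ 2 := by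
      rw [← norm_gradField_sq, ← pow_mul]
    simp only [e]
    gcongr
    exact norm_fderiv_gradField_sq_le _ _

lemma abs_integral_hess_le (hM : 1 ≤ M) (hb : volume.real unitB ≤ M) (hF : 0 < F)
    (hq : ∫ x in unitB, |ev (lapP (rhoP * q)) x| ^ 3 ≤ F ^ 3) (i j : Fin 3) :
    |∫ x in unitB, ev (pderiv i (pderiv j (rhoP * q))) x| ≤ M * F := by
  have h1 := integral_rpow_unitB_le (f := fun x => ev (pderiv i (pderiv j (rhoP * q))) x ^ 2)
    (by fun_prop) (fun x => by positivity) (p := 1 / 2) (by norm_num) (by norm_num)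
  have h2 : ∫ x in unitB, ev (pderiv i (pderiv j (rhoP * q))) x ^ 2 ≤ M * F ^ 2 := by
    refine le_trans ?_ ((integral_hessSq_le_of_cube hF.le hq).trans ?_)
    · refine setIntegral_mono (μ := volume) (s := unitB)
        (Continuous.integrableOn_unitB (by fun_prop))
        (Continuous.integrableOn_unitB (by fun_prop)) fun x => ?_
      simp only [ev_hessSq]
      exact (Finset.single_le_sum (f := fun j => ev (pderiv i (pderiv j (rhoP * q))) x ^ 2)
        (fun _ _ => by positivity) (Finset.mem_univ j)).trans (Finset.single_le_sum
          (f := fun i => ∑ j, ev (pderiv i (pderiv j (rhoP * q))) x ^ 2)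
          (fun _ _ => by positivity) (Finset.mem_univ i))
    · gcongr
      simpa using rpow_le_mul_pow (n := 0) (m := 0) volume_real_unitB_pos.le hM (zero_le_one)
        (by simpa using hb) (θ := 1 / 3) (by norm_num) (by norm_num) (by norm_num)
  have h3 : |∫ x in unitB, ev (pderiv i (pderiv j (rhoP * q))) x| ≤
      M ^ (1 / 2 : ℝ) * (M * F ^ 2) ^ (1 / 2 : ℝ) := by
    refine abs_integral_le_integral_abs.trans ?_
    have e : ∀ x, |ev (pderiv i (pderiv j (rhoP * q))) x| =
        (ev (pderiv i (pderiv j (rhoP * q))) x ^ 2) ^ (1 / 2 : ℝ) := fun x => by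
      rw [← Real.sqrt_eq_rpow, Real.sqrt_sq_eq_abs]
    simp_rw [e]
    refine h1.trans ?_
    rw [show (1 - 1 / 2 : ℝ) = 1 / 2 by norm_num]
    have := volume_real_unitB_pos
    have h0 : 0 ≤ ∫ x in unitB, ev (pderiv i (pderiv j (rhoP * q))) x ^ 2 :=
      integral_nonneg fun _ => by positivity
    gcongr
  rwa [← Real.mul_rpow (by positivity) (by positivity),
    show M * (M * F ^ 2) = (M * F) ^ 2 by ring, ← Real.sqrt_eq_rpow, Real.sqrt_sq (by positivity)]
    at h3

lemma norm_average_coord_mul_le (hw : Continuous w) (i j : Fin 3) :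
    |⨍ x in unitB, w x i * w x j| ≤ (volume.real unitB)⁻¹ * ∫ x in unitB, ‖w x‖ ^ 2 := by
  have hb := volume_real_unitB_pos
  rw [setAverage_eq, smul_eq_mul, abs_mul, abs_of_pos (inv_pos.2 hb)]
  gcongr
  refine abs_integral_le_integral_abs.trans ?_
  refine setIntegral_mono (μ := volume) (s := unitB) (Continuous.integrableOn_unitB (by fun_prop))
    (Continuous.integrableOn_unitB (by fun_prop)) fun x => ?_
  simp only [abs_mul, sq]
  gcongr <;> exact abs_coord_le _ _

/-- The integral of the deviation of `w ⊗ w` from its mean against the Hessian of `rhoP * q`. -/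
def hessPairing (w : E3 → E3) (q : MvPolynomial (Fin 3) ℝ) : ℝ :=
  ∫ x in unitB, ∑ i, ∑ j, (w x i * w x j - ⨍ y in unitB, w y i * w y j) *
    ev (pderiv i (pderiv j (rhoP * q))) x

lemma hessPairing_eq
    (h' : ∀ i j, IntegrableOn (fun x => w x i * w x j * ev (pderiv i (pderiv j (rhoP * q))) x)
      unitB) :
    hessPairing w q =
      (∫ x in unitB, ∑ i, ∑ j, w x i * w x j * ev (pderiv i (pderiv j (rhoP * q))) x) -
      ∑ i, ∑ j, (⨍ y in unitB, w y i * w y j) *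
        ∫ x in unitB, ev (pderiv i (pderiv j (rhoP * q))) x := by
  have hc : ∀ i j, IntegrableOn (fun x => (⨍ y in unitB, w y i * w y j) *
      ev (pderiv i (pderiv j (rhoP * q))) x) unitB := fun i j =>
    Continuous.integrableOn_unitB (by fun_prop)
  simp_rw [hessPairing, sub_mul, Finset.sum_sub_distrib, ← integral_const_mul]
  rw [integral_sub]
  · congr 1
    rw [integral_finsetSum _ fun i _ => integrable_finsetSum _ fun j _ => hc i j]
    exact Finset.sum_congr rfl fun i _ => integral_finsetSum _ fun j _ => hc i j
  · exact integrable_finsetSum _ fun i _ => integrable_finsetSum _ fun j _ => h' i j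
  · exact integrable_finsetSum _ fun i _ => integrable_finsetSum _ fun j _ => hc i j

lemma exists_abs_hessPairing_le : ∃ C : ℝ, 0 < C ∧ ∀ (u : E3 → E3)
    (q : MvPolynomial (Fin 3) ℝ) (α δ F : ℝ), ContDiff ℝ 1 u → 0 < α → 0 < δ → 0 < F →
    ∫ x in unitB, ‖u x - ⨍ y in unitB, u y‖ ^ 2 ≤ α ^ 24 →
    ∫ x in unitB, ‖fderiv ℝ u x‖ ^ 2 ≤ δ ^ 24 →
    ∫ x in unitB, |ev (lapP (rhoP * q)) x| ^ 3 ≤ F ^ 3 →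
    |hessPairing (fun x => u x - ⨍ y in unitB, u y) q| ≤ C * (α ^ 8 * δ ^ 16 * F) := by
  obtain ⟨C₀, hC₀, hgrad⟩ := exists_gradient_bound
  have hb0 := volume_real_unitB_pos
  have hS := sobolevC_pos
  obtain ⟨N, hN1, hNC, hNb, hNS⟩ :
      ∃ N : ℝ, 1 ≤ N ∧ C₀ ≤ N ∧ volume.real unitB ≤ N ∧ sobolevC ≤ N :=
    ⟨1 + C₀ + volume.real unitB + sobolevC, by linarith, by linarith, by linarith, by linarith⟩
  obtain ⟨M, hM⟩ : ∃ M, M = N ^ 12 := ⟨_, rfl⟩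
  have hNM : N ≤ M := hM ▸ le_self_pow₀ hN1 (by norm_num)
  have hM1 : 1 ≤ M := hN1.trans hNM
  refine ⟨30 * M ^ 4 + 9 * (volume.real unitB)⁻¹ * M ^ 3, by positivity, ?_⟩
  intro u q α δ F hu hα hδ hF h2 hD hq
  set w : E3 → E3 := fun x => u x - ⨍ y in unitB, u y with hw
  have cw : ContDiff ℝ 1 w := hu.sub contDiff_const
  have cw' := cw.continuous
  have hDw : ∀ x, fderiv ℝ w x = fderiv ℝ u x := fun x => fderiv_sub_const _
  have hN4 : ∫ x in unitB, ‖w x‖ ^ 4 ≤ N * δ ^ 48 := by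
    refine (sobolev_poincare hu).trans ?_
    calc _ ≤ N * (δ ^ 24) ^ 2 := by gcongr
      _ = _ := by ring
  have h4 : ∫ x in unitB, ‖w x‖ ^ 4 ≤ M * δ ^ 48 := hN4.trans (by gcongr)
  have h2' : ∫ x in unitB, ‖w x‖ ^ 2 ≤ (N * δ) ^ 24 := by
    have h := integral_rpow_unitB_le (f := fun x => ‖w x‖ ^ 4) (by fun_prop)
      (fun x => by positivity) (p := 1 / 2) (by norm_num) (by norm_num)
    have e : ∀ x, (‖w x‖ ^ 4) ^ (1 / 2 : ℝ) = ‖w x‖ ^ 2 := fun x => by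
      rw [pow_rpow (norm_nonneg _)]; norm_num
    simp_rw [e] at h
    rw [show (1 - 1 / 2 : ℝ) = 1 / 2 by norm_num] at h
    have a1 := rpow_le_mul_pow (n := 48) (m := 24) (integral_nonneg fun _ => by positivity) hN1
      hδ.le (hN4 : ∫ x in unitB, ‖w x‖ ^ 4 ≤ N * δ ^ 48) (θ := 1 / 2) (by norm_num)
      (by norm_num) (by norm_num)
    have a2 := rpow_le_mul_pow (n := 0) (m := 0) hb0.le hN1 (zero_le_one)
      (by simpa using hNb) (θ := 1 / 2) (by norm_num) (by norm_num) (by norm_num)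
    calc _ ≤ _ := h
      _ ≤ N * 1 ^ 0 * (N * δ ^ 24) := by gcongr
      _ = N ^ 2 * δ ^ 24 := by ring
      _ ≤ N ^ 24 * δ ^ 24 := by
          have := pow_le_pow_right₀ hN1 (show 2 ≤ 24 by norm_num)
          gcongr
      _ = _ := by ring
  obtain ⟨γ, hγ⟩ : ∃ γ, γ = min α (N * δ) := ⟨_, rfl⟩
  have hγ0 : 0 < γ := hγ ▸ lt_min hα (by positivity)
  have hγα : γ ≤ α := hγ ▸ min_le_left _ _
  have hγδ : γ ≤ N * δ := hγ ▸ min_le_right _ _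
  have hγ2 : ∫ x in unitB, ‖w x‖ ^ 2 ≤ γ ^ 24 := by
    rw [hγ]
    rcases min_choice α (N * δ) with h | h <;> rw [h] <;> assumption
  obtain ⟨hg6, hg2⟩ := hgrad q F hF.le hq
  have t1 := abs_integral_trilinear_ev_le (q := q) cw hM1 hγ0 hδ hF
    (hγ2.trans (le_mul_of_one_le_left (by positivity) hM1)) h4
    (by simp_rw [hDw]; exact hD.trans (le_mul_of_one_le_left (by positivity) hM1))
    (by
      calc γ ^ 12 ≤ (N * δ) ^ 12 := by gcongr
        _ = _ := by rw [hM]; ring)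
    (hNb.trans hNM) (hg6.trans (by gcongr; exact hNC.trans hNM))
    (hg2.trans (by gcongr; exact hNC.trans hNM))
  have t2 : |∑ i, ∑ j, (⨍ y in unitB, w y i * w y j) *
      ∫ x in unitB, ev (pderiv i (pderiv j (rhoP * q))) x| ≤
      9 * (volume.real unitB)⁻¹ * M ^ 3 * (γ ^ 8 * δ ^ 16 * F) := by
    have hij : ∀ i j, |(⨍ y in unitB, w y i * w y j) *
        ∫ x in unitB, ev (pderiv i (pderiv j (rhoP * q))) x| ≤
        (volume.real unitB)⁻¹ * M ^ 3 * (γ ^ 8 * δ ^ 16 * F) := fun i j => by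
      rw [abs_mul]
      calc _ ≤ (volume.real unitB)⁻¹ * γ ^ 24 * (M * F) := by
            gcongr
            · exact (norm_average_coord_mul_le cw' i j).trans (by gcongr)
            · exact abs_integral_hess_le hM1 (hNb.trans hNM) hF hq i j
        _ = (volume.real unitB)⁻¹ * (γ ^ 8 * γ ^ 16) * (M * F) := by ring
        _ ≤ (volume.real unitB)⁻¹ * (γ ^ 8 * (N * δ) ^ 16) * (M * F) := by gcongr
        _ = (volume.real unitB)⁻¹ * (γ ^ 8 * (N ^ 16 * δ ^ 16)) * (M * F) := by ring
        _ ≤ (volume.real unitB)⁻¹ * (γ ^ 8 * (N ^ 24 * δ ^ 16)) * (M * F) := by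
            have := pow_le_pow_right₀ hN1 (show 16 ≤ 24 by norm_num)
            gcongr
        _ = _ := by rw [hM]; ring
    calc _ ≤ ∑ i : Fin 3, ∑ j : Fin 3, (volume.real unitB)⁻¹ * M ^ 3 * (γ ^ 8 * δ ^ 16 * F) :=
          (Finset.abs_sum_le_sum_abs _ _).trans (Finset.sum_le_sum fun i _ =>
            (Finset.abs_sum_le_sum_abs _ _).trans (Finset.sum_le_sum fun j _ => hij i j))
      _ = _ := by simp; ring
  rw [hessPairing_eq fun i j => Continuous.integrableOn_unitB (by fun_prop)]
  refine (abs_sub _ _).trans ((add_le_add t1 t2).trans ?_)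
  calc _ = (30 * M ^ 4 + 9 * (volume.real unitB)⁻¹ * M ^ 3) * (γ ^ 8 * δ ^ 16 * F) := by ring
    _ ≤ _ := by gcongr

end Smooth

open scoped Convolution

/-- Mollification with kernel `φ`, precomposed with a dilation. -/
def mollify (s : ℝ) (φ F : E3 → ℝ) (x : E3) : ℝ :=
  (φ ⋆[ContinuousLinearMap.lsmul ℝ ℝ, volume] F) (s • x)

lemma mollify_eq (s : ℝ) (φ F : E3 → ℝ) (x : E3) :
    mollify s φ F x = ∫ t, φ t * F (s • x - t) := rfl

lemma lintegral_mollify_sq_le {s : ℝ} (hs : 0 < s) {φ F : E3 → ℝ} (hφ : Continuous φ)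
    (hφ0 : ∀ x, 0 ≤ φ x) (hφ1 : ∫ x, φ x = 1) (hF : Measurable F) :
    ∫⁻ x, ‖mollify s φ F x‖ₑ ^ 2 ≤ ENNReal.ofReal (s ^ 3)⁻¹ * ∫⁻ x, ‖F x‖ₑ ^ 2 := by
  set ν : Measure E3 := volume.withDensity fun t => ENNReal.ofReal (φ t) with hν
  have hν1 : ν univ = 1 := by
    rw [hν, withDensity_apply _ MeasurableSet.univ, Measure.restrict_univ,
      ← ofReal_integral_eq_lintegral_ofReal (integrable_of_integral_eq_one hφ1)
        (ae_of_all _ hφ0), hφ1, ENNReal.ofReal_one]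
  have hpr : IsProbabilityMeasure ν := ⟨hν1⟩
  have hm : Measurable fun p : E3 × E3 => F (s • p.1 - p.2) := hF.comp (by fun_prop)
  have h1 : ∀ x, ‖mollify s φ F x‖ₑ ^ 2 ≤ ∫⁻ t, ‖F (s • x - t)‖ₑ ^ 2 ∂ν := fun x => by
    have hmx : Measurable fun t => F (s • x - t) := hF.comp (by fun_prop)
    have h2 : ‖mollify s φ F x‖ₑ ≤ ∫⁻ t, ‖F (s • x - t)‖ₑ ∂ν := by
      rw [mollify_eq, hν, lintegral_withDensity_eq_lintegral_mul _ (by fun_prop) hmx.enorm]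
      refine (enorm_integral_le_lintegral_enorm _).trans (lintegral_mono fun t => ?_)
      simp [enorm_mul, Real.enorm_eq_ofReal (hφ0 t)]
    calc _ ≤ (∫⁻ t, ‖F (s • x - t)‖ₑ ∂ν) ^ 2 := by gcongr
      _ ≤ ν univ * _ := sq_lintegral_le hmx.enorm.aemeasurable
      _ = _ := by rw [hν1, one_mul]
  calc _ ≤ ∫⁻ x, ∫⁻ t, ‖F (s • x - t)‖ₑ ^ 2 ∂ν := lintegral_mono h1
    _ = ∫⁻ t, (∫⁻ x, ‖F (s • x - t)‖ₑ ^ 2) ∂ν :=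
        lintegral_lintegral_swap (hm.enorm.pow_const 2).aemeasurable
    _ = ∫⁻ t, ENNReal.ofReal (s ^ 3)⁻¹ * (∫⁻ x, ‖F x‖ₑ ^ 2) ∂ν := by
        refine lintegral_congr fun t => ?_
        have := lintegral_comp_add_smul (H := fun x => ‖F x‖ₑ ^ 2) (by fun_prop) (-t) hs
        simpa [sub_eq_neg_add] using this
    _ = _ := by rw [lintegral_const, hν1, mul_one]

lemma contDiff_mollify (s : ℝ) {φ F : E3 → ℝ} (hφ : ContDiff ℝ 1 φ) (hc : HasCompactSupport φ)
    (hF : LocallyIntegrable F) : ContDiff ℝ 1 (mollify s φ F) :=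
  (hc.contDiff_convolution_left _ hφ hF).comp (contDiff_const_smul s)

lemma pd_mollify (s : ℝ) {φ F : E3 → ℝ} (hφ : ContDiff ℝ 1 φ) (hc : HasCompactSupport φ)
    (hF : LocallyIntegrable F) (j : Fin 3) (x : E3) :
    pd j (mollify s φ F) x = s * ∫ t, F t * pd j φ (s • x - t) := by
  have h1 := (hc.hasFDerivAt_convolution_left (ContinuousLinearMap.lsmul ℝ ℝ) hφ hF (s • x)).comp x
    ((hasFDerivAt_id x).const_smul s)
  have h2 : fderiv ℝ (mollify s φ F) x = _ := h1.fderiv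
  rw [pd, h2]
  simp only [ContinuousLinearMap.comp_apply, smul_apply,
    ContinuousLinearMap.id_apply, map_smul, smul_eq_mul]
  congr 1
  have h3 := (hc.fderiv ℝ).convolutionExists_left
    ((ContinuousLinearMap.lsmul ℝ ℝ : ℝ →L[ℝ] ℝ →L[ℝ] ℝ).precompL E3)
    (hφ.continuous_fderiv (by norm_num)) hF (s • x)
  rw [convolution_def, ContinuousLinearMap.integral_apply h3, ← integral_sub_left_eq_self _ _ (s • x)]
  refine integral_congr_ae (ae_of_all _ fun t => ?_)
  simp [pd, mul_comm]

/-- `g j` is the weak `j`-th derivative of `f` on the unit ball. -/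
def IsWeakDeriv (f : E3 → ℝ) (j : Fin 3) (g : E3 → ℝ) : Prop :=
  ∀ φ : E3 → ℝ, ContDiff ℝ (⊤ : ℕ∞) φ → tsupport φ ⊆ unitB →
    ∫ x in unitB, f x * pd j φ x = - ∫ x in unitB, g x * φ x

lemma pd_mollify_eq_of_isWeakDeriv {s r : ℝ} (hsr : s + r < 1) (hs : 0 < s)
    {φ f g : E3 → ℝ}
    (hφ : ContDiff ℝ (⊤ : ℕ∞) φ) (hsupp : tsupport φ ⊆ closedBall 0 r)
    (hf : IntegrableOn f unitB) {j : Fin 3} (hfg : IsWeakDeriv f j g) {x : E3} (hx : x ∈ unitB) :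
    pd j (mollify s φ (unitB.indicator f)) x = s * mollify s φ (unitB.indicator g) x := by
  have hc : HasCompactSupport φ := (isCompact_closedBall _ _).of_isClosed_subset
    (isClosed_tsupport _) hsupp
  have hφ1 : ContDiff ℝ 1 φ := hφ.of_le (by exact_mod_cast le_top)
  rw [pd_mollify s hφ1 hc (hf.integrable_indicator measurableSet_ball).locallyIntegrable]
  congr 1
  let ψ : E3 → ℝ := fun t => φ (s • x - t)
  have hψ : ContDiff ℝ (⊤ : ℕ∞) ψ := hφ.comp (contDiff_const.sub contDiff_id)
  have hψs : tsupport ψ ⊆ unitB := by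
    have h1 : tsupport ψ ⊆ closedBall (s • x) r := by
      refine closure_minimal (fun t ht => ?_) isClosed_closedBall
      have := hsupp (subset_tsupport φ (show s • x - t ∈ Function.support φ from ht))
      rw [mem_closedBall_zero_iff] at this
      rwa [mem_closedBall, dist_comm, dist_eq_norm]
    intro t ht
    have h2 := h1 ht
    rw [mem_ball_zero_iff] at hx ⊢
    rw [mem_closedBall, dist_eq_norm] at h2
    calc ‖t‖ = ‖(t - s • x) + s • x‖ := by simp
      _ ≤ ‖t - s • x‖ + s * ‖x‖ := by
          refine (norm_add_le _ _).trans ?_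
          rw [norm_smul, Real.norm_of_nonneg hs.le]
      _ ≤ r + s * 1 := by gcongr
      _ < 1 := by linarith
  have hpd : ∀ t, pd j ψ t = - pd j φ (s • x - t) := fun t => by
    have h1 : HasFDerivAt ψ _ t := (hφ1.differentiable (by norm_num) (s • x - t)).hasFDerivAt.comp t
      ((hasFDerivAt_id t).const_sub (s • x))
    rw [pd, h1.fderiv]
    simp [pd]
  have h := hfg ψ hψ hψs
  simp_rw [hpd, mul_neg, integral_neg, neg_inj] at h
  have e1 : ∫ t, unitB.indicator f t * pd j φ (s • x - t) =
      ∫ t in unitB, f t * pd j φ (s • x - t) := by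
    rw [← integral_indicator measurableSet_ball]
    refine integral_congr_ae (ae_of_all _ fun t => ?_)
    by_cases ht : t ∈ unitB <;> simp [ht]
  have e2 : mollify s φ (unitB.indicator g) x = ∫ t in unitB, g t * ψ t := by
    rw [mollify_eq, ← integral_sub_left_eq_self _ _ (s • x), ← integral_indicator measurableSet_ball]
    refine integral_congr_ae (ae_of_all _ fun t => ?_)
    simp only [sub_sub_cancel, ψ]
    by_cases ht : t ∈ unitB <;> simp [ht, mul_comm]
  rw [e1, e2, h]

lemma measurableSet_unitB : MeasurableSet unitB := measurableSet_ball

instance isFiniteMeasure_restrict_unitB : IsFiniteMeasure (volume.restrict unitB) :=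
  isFiniteMeasure_restrict.2 measure_ball_lt_top.ne

lemma eLpNorm_two_sq {Ω G : Type*} [MeasurableSpace Ω] [NormedAddCommGroup G] (f : Ω → G)
    (μ : Measure Ω) : eLpNorm f 2 μ ^ 2 = ∫⁻ x, ‖f x‖ₑ ^ 2 ∂μ := by
  have h := eLpNorm_nnreal_pow_eq_lintegral (f := f) (μ := μ) (p := 2) (by norm_num)
  simpa only [NNReal.coe_ofNat, ENNReal.coe_ofNat, ENNReal.rpow_ofNat] using h

lemma integral_sq_eq_toReal {Ω : Type*} [MeasurableSpace Ω] {f : Ω → ℝ} {μ : Measure Ω}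
    (hf : AEStronglyMeasurable f μ) : ∫ x, f x ^ 2 ∂μ = (eLpNorm f 2 μ ^ 2).toReal := by
  rw [eLpNorm_two_sq, integral_eq_lintegral_of_nonneg_ae (ae_of_all _ fun _ => sq_nonneg _)
    (hf.pow 2)]
  congr 1
  refine lintegral_congr fun x => ?_
  rw [← sq_abs, ENNReal.ofReal_pow (abs_nonneg _), ← Real.norm_eq_abs, ofReal_norm]

lemma eLpNorm_mollify_le {s : ℝ} (hs : 1 / 2 ≤ s) {φ F : E3 → ℝ} (hφ : Continuous φ)
    (hφ0 : ∀ x, 0 ≤ φ x) (hφ1 : ∫ x, φ x = 1) (hF : Measurable F) :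
    eLpNorm (mollify s φ F) 2 volume ≤ 3 * eLpNorm F 2 volume := by
  have h := lintegral_mollify_sq_le (by linarith : 0 < s) hφ hφ0 hφ1 hF
  rw [← eLpNorm_two_sq, ← eLpNorm_two_sq] at h
  have h2 : ENNReal.ofReal (s ^ 3)⁻¹ ≤ 3 ^ 2 := by
    rw [show (3 ^ 2 : ENNReal) = ENNReal.ofReal 9 by norm_num]
    refine ENNReal.ofReal_le_ofReal ?_
    rw [inv_le_comm₀ (by positivity) (by norm_num)]
    calc (9 : ℝ)⁻¹ ≤ (1 / 2) ^ 3 := by norm_num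
      _ ≤ s ^ 3 := by gcongr
  refine (ENNReal.pow_le_pow_left_iff two_ne_zero).1 ?_
  rw [mul_pow]
  exact h.trans (by gcongr)

lemma dist_mollify_le {s r η : ℝ} {φ k : E3 → ℝ} (hη : 0 ≤ η)
    (hφ0 : ∀ x, 0 ≤ φ x) (hφ1 : ∫ x, φ x = 1) (hsupp : Function.support φ ⊆ ball 0 r)
    (hk : Continuous k) {x : E3} (hkx : ∀ y ∈ ball (s • x) r, dist (k y) (k x) ≤ η) :
    dist (mollify s φ k x) (k x) ≤ η :=
  dist_convolution_le hη hsupp hφ0 hφ1 hk.aestronglyMeasurable hkx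

lemma exists_mollifier {r : ℝ} (hr : 0 < r) : ∃ φ : E3 → ℝ, ContDiff ℝ (⊤ : ℕ∞) φ ∧
    (∀ x, 0 ≤ φ x) ∧ ∫ x, φ x = 1 ∧ Function.support φ ⊆ ball 0 r ∧
      tsupport φ ⊆ closedBall 0 r := by
  let b : ContDiffBump (0 : E3) := ⟨r / 2, r, by positivity, by linarith⟩
  exact ⟨b.normed volume, b.contDiff_normed, b.nonneg_normed, b.integral_normed,
    b.support_normed_eq.subset, b.tsupport_normed_eq.subset⟩

lemma eLpNorm_mollify_sub_le {s r η : ℝ} (hs : 1 / 2 ≤ s) {φ F k : E3 → ℝ} (hφ : ContDiff ℝ 1 φ)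
    (hφ0 : ∀ x, 0 ≤ φ x) (hφ1 : ∫ x, φ x = 1) (hsupp : Function.support φ ⊆ ball 0 r)
    (hc : HasCompactSupport φ)
    (hF : Measurable F) (hFi : LocallyIntegrable F) (hk : Continuous k) (hη : 0 ≤ η)
    (hkx : ∀ x ∈ unitB, ∀ y ∈ ball (s • x) r, dist (k y) (k x) ≤ η) {e : ENNReal}
    (he : eLpNorm (F - k) 2 volume ≤ e) :
    eLpNorm (mollify s φ F - F) 2 (volume.restrict unitB) ≤
      4 * e + volume unitB ^ (2⁻¹ : ℝ) * ENNReal.ofReal η := by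
  have hki : LocallyIntegrable k := hk.locallyIntegrable
  have hsm : ∀ G : E3 → ℝ, LocallyIntegrable G → Continuous (mollify s φ G) := fun G hG =>
    (contDiff_mollify s hφ hc hG).continuous
  have hlin : mollify s φ F - mollify s φ k = mollify s φ (F - k) := by
    ext x
    have i1 := hc.convolutionExists_left (ContinuousLinearMap.lsmul ℝ ℝ) hφ.continuous hFi (s • x)
    have i2 := hc.convolutionExists_left (ContinuousLinearMap.lsmul ℝ ℝ) hφ.continuous
      hki (s • x)
    simp only [Pi.sub_apply, mollify_eq, mul_sub]
    exact (integral_sub i1 i2).symm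
  have hdec : mollify s φ F - F = mollify s φ (F - k) + ((mollify s φ k - k) + (k - F)) := by
    rw [← hlin]; abel
  have m1 := (hsm _ (hFi.sub hki)).aestronglyMeasurable
    (μ := volume.restrict unitB)
  have m2 := ((hsm _ hki).sub hk).aestronglyMeasurable
    (μ := volume.restrict unitB)
  have m3 := (hk.measurable.sub hF).aestronglyMeasurable (μ := volume.restrict unitB)
  have t1 : eLpNorm (mollify s φ (F - k)) 2 (volume.restrict unitB) ≤ 3 * e :=
    (eLpNorm_mono_measure _ Measure.restrict_le_self).trans
      ((eLpNorm_mollify_le hs hφ.continuous hφ0 hφ1 (hF.sub hk.measurable)).trans (by gcongr))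
  have t3 : eLpNorm (k - F) 2 (volume.restrict unitB) ≤ e := by
    rw [eLpNorm_sub_comm]
    exact (eLpNorm_mono_measure _ Measure.restrict_le_self).trans he
  have t2 : eLpNorm (mollify s φ k - k) 2 (volume.restrict unitB) ≤
      volume unitB ^ (2⁻¹ : ℝ) * ENNReal.ofReal η := by
    have h := eLpNorm_le_of_ae_bound (p := 2) (μ := volume.restrict unitB)
      (f := mollify s φ k - k) (C := η) ((ae_restrict_iff' measurableSet_ball).2
        (ae_of_all _ fun x hx => by
          rw [Pi.sub_apply, ← dist_eq_norm]
          exact dist_mollify_le hη hφ0 hφ1 hsupp hk (hkx x hx)))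
    simpa using h
  rw [hdec]
  calc _ ≤ 3 * e + (volume unitB ^ (2⁻¹ : ℝ) * ENNReal.ofReal η + e) :=
        (eLpNorm_add_le m1 (m2.add m3) (by norm_num)).trans
          (add_le_add t1 ((eLpNorm_add_le m2 m3 (by norm_num)).trans (add_le_add t2 t3)))
    _ = _ := by ring

lemma exists_continuous_eLpNorm_sub_le {F : E3 → ℝ} (hF : MemLp F 2) {e : ENNReal} (he : e ≠ 0) :
    ∃ k : E3 → ℝ, UniformContinuous k ∧ eLpNorm (F - k) 2 volume ≤ e := by
  obtain ⟨k, hkc, hkF, hk, -⟩ := hF.exists_hasCompactSupport_eLpNorm_sub_le (by norm_num) he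
  exact ⟨k, hk.uniformContinuous_of_tendsto_cocompact hkc.is_zero_at_infty, hkF⟩

lemma exists_mollify_approx {F : E3 → ℝ} (hFm : Measurable F) (hF : MemLp F 2) {ε κ : ℝ}
    (hε : 0 < ε) (hκ : 0 < κ) : ∃ (s r : ℝ) (φ : E3 → ℝ), 1 / 2 ≤ s ∧ 1 - κ ≤ s ∧ s + r < 1 ∧
      ContDiff ℝ (⊤ : ℕ∞) φ ∧ (∀ x, 0 ≤ φ x) ∧ ∫ x, φ x = 1 ∧ tsupport φ ⊆ closedBall 0 r ∧
      eLpNorm (mollify s φ F - F) 2 (volume.restrict unitB) ≤ ENNReal.ofReal ε := by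
  have he : ENNReal.ofReal (ε / 8) ≠ 0 := by
    rw [Ne, ENNReal.ofReal_eq_zero]; linarith
  obtain ⟨k, hk, hkF⟩ := exists_continuous_eLpNorm_sub_le hF he
  obtain ⟨V, hV0, hV⟩ : ∃ V : ℝ, 0 ≤ V ∧ volume unitB ^ (2⁻¹ : ℝ) = ENNReal.ofReal V :=
    ⟨_, ENNReal.toReal_nonneg, (ENNReal.ofReal_toReal
      (ENNReal.rpow_ne_top_of_nonneg (by norm_num) measure_ball_lt_top.ne)).symm⟩
  have hη : 0 < ε / (2 * (V + 1)) := by positivity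
  obtain ⟨d, hd, hkd⟩ := Metric.uniformContinuous_iff.1 hk _ hη
  obtain ⟨r, hr, hr1, hr2, hr3⟩ : ∃ r : ℝ, 0 < r ∧ r ≤ 1 / 8 ∧ r ≤ d / 4 ∧ r ≤ κ / 2 :=
    ⟨min (1 / 8) (min (d / 4) (κ / 2)), by positivity, min_le_left _ _,
      (min_le_right _ _).trans (min_le_left _ _), (min_le_right _ _).trans (min_le_right _ _)⟩
  obtain ⟨φ, hφ, hφ0, hφ1, hsupp, htsupp⟩ := exists_mollifier hr
  have hc : HasCompactSupport φ := (isCompact_closedBall _ _).of_isClosed_subset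
    (isClosed_tsupport _) htsupp
  refine ⟨1 - 2 * r, r, φ, by linarith, by linarith, by linarith, hφ, hφ0, hφ1, htsupp, ?_⟩
  have hx : ∀ x ∈ unitB, ∀ y ∈ ball ((1 - 2 * r) • x) r,
      dist (k y) (k x) ≤ ε / (2 * (V + 1)) := fun x hx y hy => by
    refine (hkd ?_).le
    have h1 : dist ((1 - 2 * r) • x) x = 2 * r * ‖x‖ := by
      rw [dist_eq_norm, show (1 - 2 * r) • x - x = (-(2 * r)) • x by module, norm_smul, norm_neg,
        Real.norm_of_nonneg (by positivity)]
    have h2 : ‖x‖ < 1 := mem_ball_zero_iff.1 hx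
    have h3 := dist_triangle y ((1 - 2 * r) • x) x
    have h4 := mem_ball.1 hy
    nlinarith
  refine (eLpNorm_mollify_sub_le (by linarith) (hφ.of_le (by exact_mod_cast le_top)) hφ0 hφ1 hsupp
    hc hFm (hF.locallyIntegrable (by norm_num)) hk.continuous hη.le hx hkF).trans ?_
  rw [hV, ← ENNReal.ofReal_mul hV0, show (4 : ENNReal) = ENNReal.ofReal 4 by norm_num,
    ← ENNReal.ofReal_mul (by norm_num), ← ENNReal.ofReal_add (by positivity) (by positivity)]
  refine ENNReal.ofReal_le_ofReal ?_
  have h5 : V * (ε / (2 * (V + 1))) ≤ ε / 2 := by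
    rw [mul_div_assoc', div_le_div_iff₀ (by positivity) (by norm_num)]
    nlinarith
  linarith

lemma integral_mollify_indicator_sq_le {s : ℝ} (hs : 0 < s) {φ g : E3 → ℝ}
    (hφ : ContDiff ℝ 1 φ) (hc : HasCompactSupport φ) (hφ0 : ∀ x, 0 ≤ φ x) (hφ1 : ∫ x, φ x = 1)
    (hgm : Measurable g) (hg : MemLp g 2 (volume.restrict unitB)) :
    ∫ x in unitB, mollify s φ (unitB.indicator g) x ^ 2 ≤
      (s ^ 3)⁻¹ * ∫ x in unitB, g x ^ 2 := by
  have hgi : MemLp (unitB.indicator g) 2 := (memLp_indicator_iff_restrict measurableSet_ball).2 hg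
  have hcont := (contDiff_mollify s hφ hc (hgi.locallyIntegrable (by norm_num))).continuous
  have h := lintegral_mollify_sq_le hs hφ.continuous hφ0 hφ1 (hgm.indicator measurableSet_unitB)
  have h1 : eLpNorm (mollify s φ (unitB.indicator g)) 2 (volume.restrict unitB) ^ 2 ≤
      ENNReal.ofReal (s ^ 3)⁻¹ * eLpNorm g 2 (volume.restrict unitB) ^ 2 := by
    rw [← eLpNorm_indicator_eq_eLpNorm_restrict (f := g) measurableSet_unitB, eLpNorm_two_sq,
      eLpNorm_two_sq]
    exact (lintegral_mono' Measure.restrict_le_self le_rfl).trans h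
  rw [integral_sq_eq_toReal hcont.aestronglyMeasurable, integral_sq_eq_toReal
    hgm.aestronglyMeasurable]
  conv_rhs => rw [← ENNReal.toReal_ofReal (by positivity : 0 ≤ (s ^ 3)⁻¹), ← ENNReal.toReal_mul]
  exact ENNReal.toReal_mono (ENNReal.mul_ne_top ENNReal.ofReal_ne_top
    (ENNReal.pow_ne_top hg.eLpNorm_ne_top)) h1

lemma exists_contDiff_approx {f : E3 → ℝ} {g : Fin 3 → E3 → ℝ} (hfm : Measurable f)
    (hgm : ∀ j, Measurable (g j)) (hf : MemLp f 2 (volume.restrict unitB))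
    (hg : ∀ j, MemLp (g j) 2 (volume.restrict unitB)) (hfg : ∀ j, IsWeakDeriv f j (g j))
    {ε : ℝ} (hε : 0 < ε) :
    ∃ h : E3 → ℝ, ContDiff ℝ 1 h ∧ ∫ x in unitB, (h x - f x) ^ 2 ≤ ε ∧
      ∀ j, ∫ x in unitB, pd j h x ^ 2 ≤ (∫ x in unitB, g j x ^ 2) + ε := by
  have hF : MemLp (unitB.indicator f) 2 := (memLp_indicator_iff_restrict measurableSet_ball).2 hf
  obtain ⟨I, hI0, hI⟩ : ∃ I : ℝ, 0 ≤ I ∧ ∀ j, ∫ x in unitB, g j x ^ 2 ≤ I :=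
    ⟨∑ j, ∫ x in unitB, g j x ^ 2, Finset.sum_nonneg fun j _ => integral_nonneg fun _ => sq_nonneg _,
      fun j => Finset.single_le_sum (f := fun j => ∫ x in unitB, g j x ^ 2)
        (fun j _ => integral_nonneg fun _ => sq_nonneg _) (Finset.mem_univ j)⟩
  obtain ⟨s, r, φ, hs, hsκ, hsr, hφ, hφ0, hφ1, hsupp, happ⟩ := exists_mollify_approx
    (hfm.indicator measurableSet_ball) hF (Real.sqrt_pos.2 hε)
    (κ := ε / (2 * (I + 1))) (by positivity)
  have hs0 : 0 < s := by linarith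
  have hr : 0 ≤ r := by
    by_contra hr
    have h0 : φ = 0 := by
      rw [← tsupport_eq_empty_iff]
      exact subset_empty_iff.1 (hsupp.trans (closedBall_eq_empty.2 (not_le.1 hr)).subset)
    simp [h0] at hφ1
  have hs1 : s < 1 := by linarith
  have hc : HasCompactSupport φ := (isCompact_closedBall _ _).of_isClosed_subset
    (isClosed_tsupport _) hsupp
  have hφ' : ContDiff ℝ 1 φ := hφ.of_le (by exact_mod_cast le_top)
  have hC1 := contDiff_mollify s hφ' hc (hF.locallyIntegrable (by norm_num))
  refine ⟨mollify s φ (unitB.indicator f), hC1, ?_, fun j => ?_⟩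
  · have h1 : ∫ x in unitB, (mollify s φ (unitB.indicator f) x - f x) ^ 2 =
        ∫ x in unitB, ((mollify s φ (unitB.indicator f) - unitB.indicator f) x) ^ 2 :=
      setIntegral_congr_fun measurableSet_ball fun x hx => by
        simp only [Pi.sub_apply, indicator_of_mem hx]
    rw [h1, integral_sq_eq_toReal
      (hC1.continuous.measurable.sub (hfm.indicator measurableSet_ball)).aestronglyMeasurable]
    refine ENNReal.toReal_le_of_le_ofReal hε.le ((pow_le_pow_left' happ 2).trans ?_)
    rw [← ENNReal.ofReal_pow (Real.sqrt_nonneg _), Real.sq_sqrt hε.le]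
  · have h2 : ∫ x in unitB, pd j (mollify s φ (unitB.indicator f)) x ^ 2 =
        s ^ 2 * ∫ x in unitB, mollify s φ (unitB.indicator (g j)) x ^ 2 := by
      rw [← integral_const_mul]
      refine setIntegral_congr_fun measurableSet_ball fun x hx => ?_
      simp only [pd_mollify_eq_of_isWeakDeriv hsr hs0 hφ hsupp
        (hf.integrable (by norm_num)) (hfg j) hx, mul_pow]
    have h3 := integral_mollify_indicator_sq_le hs0 hφ' hc hφ0 hφ1 (hgm j) (hg j)
    have h4 := hI j
    have h5 : 0 ≤ ∫ x in unitB, g j x ^ 2 := integral_nonneg fun _ => sq_nonneg _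
    obtain ⟨J, hJ⟩ : ∃ J, J = ∫ x in unitB, g j x ^ 2 := ⟨_, rfl⟩
    rw [← hJ] at h3 h4 h5 ⊢
    have h6 : s⁻¹ * J ≤ J + ε := by
      rw [inv_mul_le_iff₀ hs0]
      have h7 : ε / (2 * (I + 1)) * J ≤ ε / 2 := by
        rw [div_mul_eq_mul_div, div_le_div_iff₀ (by positivity) (by norm_num)]
        nlinarith
      nlinarith
    calc _ ≤ s ^ 2 * ((s ^ 3)⁻¹ * J) := h2.trans_le (by gcongr)
      _ = s⁻¹ * J := by field_simp
      _ ≤ _ := h6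

lemma IsWeakDeriv.congr_ae {f f' g g' : E3 → ℝ} {j : Fin 3} (h : IsWeakDeriv f j g)
    (hf : f =ᵐ[volume.restrict unitB] f') (hg : g =ᵐ[volume.restrict unitB] g') :
    IsWeakDeriv f' j g' := fun φ hφ hsupp => by
  have h1 : ∫ x in unitB, f' x * pd j φ x = ∫ x in unitB, f x * pd j φ x :=
    integral_congr_ae (hf.mono fun x hx => by simp only [hx])
  have h2 : ∫ x in unitB, g' x * φ x = ∫ x in unitB, g x * φ x :=
    integral_congr_ae (hg.mono fun x hx => by simp only [hx])
  rw [h1, h2, h φ hφ hsupp]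

/-- Functions with square integrable weak derivatives on the unit ball are approximated by
continuously differentiable functions without essentially increasing the Dirichlet integral. -/
lemma exists_contDiff_approx_of_memLp {f : E3 → ℝ} {g : Fin 3 → E3 → ℝ}
    (hf : MemLp f 2 (volume.restrict unitB)) (hg : ∀ j, MemLp (g j) 2 (volume.restrict unitB))
    (hfg : ∀ j, IsWeakDeriv f j (g j)) {ε : ℝ} (hε : 0 < ε) :
    ∃ h : E3 → ℝ, ContDiff ℝ 1 h ∧ ∫ x in unitB, (h x - f x) ^ 2 ≤ ε ∧
      ∀ j, ∫ x in unitB, pd j h x ^ 2 ≤ (∫ x in unitB, g j x ^ 2) + ε := by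
  have ef := hf.aestronglyMeasurable.ae_eq_mk
  have eg := fun j => (hg j).aestronglyMeasurable.ae_eq_mk
  obtain ⟨h, h1, h2, h3⟩ := exists_contDiff_approx
    hf.aestronglyMeasurable.stronglyMeasurable_mk.measurable
    (fun j => (hg j).aestronglyMeasurable.stronglyMeasurable_mk.measurable)
    ((memLp_congr_ae ef).1 hf) (fun j => (memLp_congr_ae (eg j)).1 (hg j))
    (fun j => (hfg j).congr_ae ef (eg j)) hε
  refine ⟨h, h1, ?_, fun j => ?_⟩
  · exact (integral_congr_ae (ef.mono fun x hx => by simp only [hx])).trans_le h2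
  · refine (h3 j).trans_eq (congrArg (· + ε) (integral_congr_ae ((eg j).mono fun x hx => ?_)))
    simp only [hx]

lemma Continuous.memLp_unitB {F : Type*} [NormedAddCommGroup F] [SecondCountableTopology F]
    {f : E3 → F} (hf : Continuous f) (p : ENNReal) : MemLp f p (volume.restrict unitB) := by
  obtain ⟨M, hM⟩ := (isCompact_closedBall (0 : E3) 1).exists_bound_of_continuousOn hf.continuousOn
  exact MemLp.of_bound hf.aestronglyMeasurable M
    ((ae_restrict_iff' measurableSet_unitB).2 (ae_of_all _ fun x hx =>
      hM x (ball_subset_closedBall hx)))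

lemma exists_contDiff_vector_approx {u : E3 → E3} {g : Fin 3 → Fin 3 → E3 → ℝ}
    (hu : MemLp u 2 (volume.restrict unitB))
    (hg : ∀ i j, MemLp (g i j) 2 (volume.restrict unitB))
    (hug : ∀ i j, IsWeakDeriv (fun x => u x i) j (g i j)) {ε : ℝ} (hε : 0 < ε) :
    ∃ U : E3 → E3, ContDiff ℝ 1 U ∧ (∀ i, ∫ x in unitB, (U x i - u x i) ^ 2 ≤ ε) ∧
      ∫ x in unitB, ‖fderiv ℝ U x‖ ^ 2 ≤ (∑ i, ∑ j, ∫ x in unitB, g i j x ^ 2) + 9 * ε := by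
  choose h h1 h2 h3 using fun i => exists_contDiff_approx_of_memLp (hu.eval_piLp i) (hg i)
    (hug i) hε
  have hU : ContDiff ℝ 1 fun x => (WithLp.toLp 2 fun i => h i x : E3) := contDiff_euclidean.2 h1
  refine ⟨fun x => WithLp.toLp 2 fun i => h i x, hU, h2, ?_⟩
  have hcd := fun i j => continuous_pd (h1 i) j
  calc _ ≤ ∫ x in unitB, ∑ i, ∑ j, pd j (h i) x ^ 2 := by
        refine setIntegral_mono (μ := volume) (s := unitB)
          (Continuous.integrableOn_unitB ((hU.continuous_fderiv (by norm_num)).norm.pow 2))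
          (Continuous.integrableOn_unitB (by fun_prop)) fun x => ?_
        exact norm_fderiv_sq_le_sum (hU.differentiable (by norm_num) x)
    _ = ∑ i, ∑ j, ∫ x in unitB, pd j (h i) x ^ 2 := by
        rw [integral_finsetSum _ fun i _ => Continuous.integrableOn_unitB (by fun_prop)]
        exact Finset.sum_congr rfl fun i _ => integral_finsetSum _ fun j _ =>
          Continuous.integrableOn_unitB (by fun_prop)
    _ ≤ ∑ i, ∑ j, ((∫ x in unitB, g i j x ^ 2) + ε) := by gcongr with i _ j _; exact h3 i j
    _ = _ := by simp [Finset.sum_add_distrib]; ring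

lemma abs_integral_mul_mul_le {Ω : Type*} [MeasurableSpace Ω] {μ : Measure Ω} {f g ψ : Ω → ℝ}
    (hf : MemLp f 2 μ) (hg : MemLp g 2 μ) {M : ℝ} (hM : ∀ᵐ x ∂μ, |ψ x| ≤ M) :
    |∫ x, f x * g x * ψ x ∂μ| ≤ M * (√(∫ x, f x ^ 2 ∂μ) * √(∫ x, g x ^ 2 ∂μ)) := by
  have h := integral_mul_norm_le_Lp_mul_Lq (μ := μ) Real.HolderConjugate.two_two
    (f := f) (g := g) (by simpa using hf) (by simpa using hg)
  simp only [Real.rpow_ofNat, Real.norm_eq_abs, sq_abs, ← Real.sqrt_eq_rpow] at h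
  rcases (ae μ).eq_or_neBot with h0 | h0
  · simp [ae_eq_bot.1 h0]
  obtain ⟨x, hx⟩ := hM.exists
  have hM0 : 0 ≤ M := (abs_nonneg _).trans hx
  refine abs_integral_le_integral_abs.trans (le_trans ?_ (mul_le_mul_of_nonneg_left h hM0))
  rw [← integral_const_mul]
  refine integral_mono_of_nonneg (ae_of_all _ fun x => abs_nonneg _) ?_ ?_
  · have := (hf.norm.integrable_mul hg.norm).const_mul M
    exact this
  · filter_upwards [hM] with x hx
    rw [abs_mul, abs_mul, mul_comm]
    gcongr

open Filter Topology in
lemma tendsto_integral_mul_mul {Ω : Type*} [MeasurableSpace Ω] {μ : Measure Ω}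
    {a b : ℕ → Ω → ℝ} {a' b' ψ : Ω → ℝ} (ha : ∀ n, MemLp (a n) 2 μ) (hb : ∀ n, MemLp (b n) 2 μ)
    (ha' : MemLp a' 2 μ) (hb' : MemLp b' 2 μ) (hψ : AEStronglyMeasurable ψ μ) {M : ℝ}
    (hM : ∀ᵐ x ∂μ, |ψ x| ≤ M)
    (hta : Tendsto (fun n => ∫ x, (a n x - a' x) ^ 2 ∂μ) atTop (𝓝 0))
    (htb : Tendsto (fun n => ∫ x, (b n x - b' x) ^ 2 ∂μ) atTop (𝓝 0)) :
    Tendsto (fun n => ∫ x, a n x * b n x * ψ x ∂μ) atTop (𝓝 (∫ x, a' x * b' x * ψ x ∂μ)) := by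
  have hi : ∀ {f g : Ω → ℝ}, MemLp f 2 μ → MemLp g 2 μ → Integrable (fun x => f x * g x * ψ x) μ :=
    fun hf hg => (hf.integrable_mul hg).mul_bdd hψ hM
  have hd : ∀ n, (∫ x, a n x * b n x * ψ x ∂μ) - ∫ x, a' x * b' x * ψ x ∂μ =
      (∫ x, (a n x - a' x) * (b n x - b' x) * ψ x ∂μ) +
        (∫ x, (a n x - a' x) * b' x * ψ x ∂μ) + ∫ x, a' x * (b n x - b' x) * ψ x ∂μ := fun n => by
    have i1 := hi ((ha n).sub ha') ((hb n).sub hb')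
    have i2 := hi ((ha n).sub ha') hb'
    have i3 := hi ha' ((hb n).sub hb')
    simp only [Pi.sub_apply] at i1 i2 i3
    have i4 : Integrable (fun x => (a n x - a' x) * (b n x - b' x) * ψ x +
        (a n x - a' x) * b' x * ψ x) μ := i1.add i2
    rw [← integral_sub (hi (ha n) (hb n)) (hi ha' hb'), ← integral_add i1 i2,
      ← integral_add i4 i3]
    exact integral_congr_ae (ae_of_all _ fun x => by ring)
  rw [tendsto_iff_dist_tendsto_zero]
  have sa := (Real.continuous_sqrt.tendsto 0).comp hta
  have sb := (Real.continuous_sqrt.tendsto 0).comp htb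
  rw [Real.sqrt_zero] at sa sb
  refine squeeze_zero (fun _ => dist_nonneg) (fun n => ?_)
    (g := fun n => M * (√(∫ x, (a n x - a' x) ^ 2 ∂μ) * √(∫ x, (b n x - b' x) ^ 2 ∂μ)) +
      M * (√(∫ x, (a n x - a' x) ^ 2 ∂μ) * √(∫ x, b' x ^ 2 ∂μ)) +
      M * (√(∫ x, a' x ^ 2 ∂μ) * √(∫ x, (b n x - b' x) ^ 2 ∂μ))) ?_
  · rw [Real.dist_eq, hd]
    refine (abs_add_three _ _ _).trans ?_
    gcongr
    · exact abs_integral_mul_mul_le ((ha n).sub ha') ((hb n).sub hb') hM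
    · exact abs_integral_mul_mul_le ((ha n).sub ha') hb' hM
    · exact abs_integral_mul_mul_le ha' ((hb n).sub hb') hM
  · have := (((sa.mul sb).const_mul M).add ((sa.mul_const (√(∫ x, b' x ^ 2 ∂μ))).const_mul M)).add
      ((sb.const_mul (√(∫ x, a' x ^ 2 ∂μ))).const_mul M)
    simpa using this

lemma integral_sub_average_sq_le {f : E3 → ℝ} (hf : MemLp f 2 (volume.restrict unitB)) :
    ∫ x in unitB, (f x - ⨍ y in unitB, f y) ^ 2 ≤ ∫ x in unitB, f x ^ 2 := by
  have hb := volume_real_unitB_pos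
  obtain ⟨m, hm⟩ : ∃ m, m = ⨍ y in unitB, f y := ⟨_, rfl⟩
  have hI : ∫ x in unitB, f x = volume.real unitB * m := by
    rw [hm, setAverage_eq, smul_eq_mul, mul_inv_cancel_left₀ hb.ne']
  have i0 : IntegrableOn f unitB := hf.integrable (by norm_num)
  have i1 : IntegrableOn (fun x => f x ^ 2) unitB := hf.integrable_sq
  have i2 : IntegrableOn (fun x => 2 * m * f x) unitB := i0.const_mul _
  have i3 : IntegrableOn (fun x => f x ^ 2 - 2 * m * f x) unitB := i1.sub i2
  have i4 : IntegrableOn (fun _ => m ^ 2) unitB := integrable_const _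
  rw [← hm]
  calc _ = ∫ x in unitB, (f x ^ 2 - 2 * m * f x + m ^ 2) := by congr 1; ext x; ring
    _ = (∫ x in unitB, f x ^ 2) - volume.real unitB * m ^ 2 := by
        rw [integral_add i3 i4, integral_sub i1 i2, integral_const_mul, hI, setIntegral_const,
          smul_eq_mul]
        ring
    _ ≤ _ := by nlinarith [sq_nonneg m]

lemma average_coord {u : E3 → E3} (hu : IntegrableOn u unitB) (i : Fin 3) :
    (⨍ y in unitB, u y) i = ⨍ y in unitB, u y i := by
  rw [setAverage_eq, setAverage_eq, PiLp.smul_apply, eval_integral_piLp fun i => hu.eval_piLp i]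

lemma norm_sq_eq_sum (x : E3) : ‖x‖ ^ 2 = ∑ i, x i * x i * 1 := by
  rw [EuclideanSpace.real_norm_sq_eq]
  exact Finset.sum_congr rfl fun i _ => by ring

open Filter Topology in
lemma tendsto_hessPairing {w : ℕ → E3 → E3} {w' : E3 → E3} (q : MvPolynomial (Fin 3) ℝ)
    (hw : ∀ n, MemLp (w n) 2 (volume.restrict unitB)) (hw' : MemLp w' 2 (volume.restrict unitB))
    (h : ∀ i, Tendsto (fun n => ∫ x in unitB, (w n x i - w' x i) ^ 2) atTop (𝓝 0)) :
    Tendsto (fun n => hessPairing (w n) q) atTop (𝓝 (hessPairing w' q)) := by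
  have hbd : ∀ {ψ : E3 → ℝ}, Continuous ψ → ∃ M, ∀ᵐ x ∂volume.restrict unitB, |ψ x| ≤ M :=
    fun hψ => by
      obtain ⟨M, hM⟩ := (isCompact_closedBall (0 : E3) 1).exists_bound_of_continuousOn
        hψ.continuousOn
      exact ⟨M, (ae_restrict_iff' measurableSet_unitB).2 (ae_of_all _ fun x hx =>
        hM x (ball_subset_closedBall hx))⟩
  have ht : ∀ {ψ : E3 → ℝ}, Continuous ψ → ∀ i j,
      Tendsto (fun n => ∫ x in unitB, w n x i * w n x j * ψ x) atTop
        (𝓝 (∫ x in unitB, w' x i * w' x j * ψ x)) := fun hψ i j => by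
    obtain ⟨M, hM⟩ := hbd hψ
    exact tendsto_integral_mul_mul (fun n => (hw n).eval_piLp i) (fun n => (hw n).eval_piLp j)
      (hw'.eval_piLp i) (hw'.eval_piLp j) hψ.aestronglyMeasurable hM (h i) (h j)
  have hInt : ∀ {z : E3 → E3}, MemLp z 2 (volume.restrict unitB) → ∀ i j,
      IntegrableOn (fun x => z x i * z x j * ev (pderiv i (pderiv j (rhoP * q))) x) unitB :=
    fun hz i j => by
      obtain ⟨M, hM⟩ := hbd (continuous_ev (pderiv i (pderiv j (rhoP * q))))
      exact ((hz.eval_piLp i).integrable_mul (hz.eval_piLp j)).mul_bdd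
        (continuous_ev _).aestronglyMeasurable hM
  have heq : ∀ {z : E3 → E3}, MemLp z 2 (volume.restrict unitB) → hessPairing z q =
      (∑ i, ∑ j, ∫ x in unitB, z x i * z x j * ev (pderiv i (pderiv j (rhoP * q))) x) -
      ∑ i, ∑ j, ((volume.real unitB)⁻¹ * ∫ y in unitB, z y i * z y j * 1) *
        ∫ x in unitB, ev (pderiv i (pderiv j (rhoP * q))) x := fun hz => by
    rw [hessPairing_eq (hInt hz), integral_finsetSum _ fun i _ =>
      integrable_finsetSum _ fun j _ => hInt hz i j]
    simp only [integral_finsetSum _ fun j _ => hInt hz _ j, mul_one, setAverage_eq, smul_eq_mul]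
  rw [heq hw', funext fun n => heq (hw n)]
  refine Tendsto.sub (tendsto_finsetSum _ fun i _ => tendsto_finsetSum _ fun j _ =>
    ht (continuous_ev _) i j) (tendsto_finsetSum _ fun i _ => tendsto_finsetSum _ fun j _ => ?_)
  exact ((ht continuous_const i j).const_mul _).mul_const _

open Filter Topology in
lemma exists_abs_hessPairing_le_of_isWeakDeriv : ∃ C : ℝ, 0 < C ∧ ∀ (u : E3 → E3)
    (g : Fin 3 → Fin 3 → E3 → ℝ) (q : MvPolynomial (Fin 3) ℝ) (α δ F : ℝ),
    MemLp u 2 (volume.restrict unitB) → (∀ i j, MemLp (g i j) 2 (volume.restrict unitB)) →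
    (∀ i j, IsWeakDeriv (fun x => u x i) j (g i j)) → 0 < α → 0 < δ → 0 < F →
    ∫ x in unitB, ‖u x - ⨍ y in unitB, u y‖ ^ 2 < α ^ 24 →
    ∑ i, ∑ j, ∫ x in unitB, g i j x ^ 2 < δ ^ 24 →
    ∫ x in unitB, |ev (lapP (rhoP * q)) x| ^ 3 ≤ F ^ 3 →
    |hessPairing (fun x => u x - ⨍ y in unitB, u y) q| ≤ C * (α ^ 8 * δ ^ 16 * F) := by
  obtain ⟨C, hC, hle⟩ := exists_abs_hessPairing_le
  refine ⟨C, hC, fun u g q α δ F hu hg hug hα hδ hF hw hD hq => ?_⟩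
  have hε : ∀ n : ℕ, (0 : ℝ) < 1 / (n + 1) := fun n => by positivity
  choose U hU1 hU2 hU3 using fun n => exists_contDiff_vector_approx hu hg hug (hε n)
  have hUm : ∀ n, MemLp (U n) 2 (volume.restrict unitB) := fun n => (hU1 n).continuous.memLp_unitB 2
  have hUi : ∀ n, IntegrableOn (U n) unitB := fun n => (hUm n).integrable (by norm_num)
  have hui : IntegrableOn u unitB := hu.integrable (by norm_num)
  have hwn : ∀ n, MemLp (fun x => U n x - ⨍ y in unitB, U n y) 2 (volume.restrict unitB) :=
    fun n => (hUm n).sub (memLp_const _)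
  have hwm : MemLp (fun x => u x - ⨍ y in unitB, u y) 2 (volume.restrict unitB) :=
    hu.sub (memLp_const _)
  have h0 : Tendsto (fun n : ℕ => 1 / ((n : ℝ) + 1)) atTop (𝓝 0) :=
    tendsto_one_div_add_atTop_nhds_zero_nat
  have hconv : ∀ i, Tendsto (fun n => ∫ x in unitB,
      ((U n x - ⨍ y in unitB, U n y) i - (u x - ⨍ y in unitB, u y) i) ^ 2) atTop (𝓝 0) :=
    fun i => by
      refine squeeze_zero (fun n => integral_nonneg fun _ => sq_nonneg _) (fun n => ?_) h0
      have h1 := integral_sub_average_sq_le (((hUm n).sub hu).eval_piLp i)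
      simp only [Pi.sub_apply, PiLp.sub_apply] at h1
      refine le_trans (le_of_eq ?_) (h1.trans (hU2 n i))
      congr 1
      ext x
      have h2 : ⨍ y in unitB, (U n y i - u y i) =
          (⨍ y in unitB, U n y i) - ⨍ y in unitB, u y i := by
        simp only [setAverage_eq]
        rw [integral_sub ((hUi n).eval_piLp i) (hui.eval_piLp i), smul_sub]
      rw [PiLp.sub_apply, PiLp.sub_apply, average_coord (hUi n), average_coord hui, h2]
      ring
  have hnorm : Tendsto (fun n => ∫ x in unitB, ‖U n x - ⨍ y in unitB, U n y‖ ^ 2) atTop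
      (𝓝 (∫ x in unitB, ‖u x - ⨍ y in unitB, u y‖ ^ 2)) := by
    have hsum : ∀ {z : E3 → E3}, MemLp z 2 (volume.restrict unitB) →
        ∫ x in unitB, ‖z x‖ ^ 2 = ∑ i, ∫ x in unitB, z x i * z x i * 1 := fun hz => by
      simp only [norm_sq_eq_sum]
      exact integral_finsetSum _ fun i _ => by
        simp only [mul_one]
        exact (hz.eval_piLp i).integrable_mul (hz.eval_piLp i)
    rw [hsum hwm, funext fun n => hsum (hwn n)]
    exact tendsto_finsetSum _ fun i _ => tendsto_integral_mul_mul (fun n => (hwn n).eval_piLp i)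
      (fun n => (hwn n).eval_piLp i) (hwm.eval_piLp i) (hwm.eval_piLp i)
      aestronglyMeasurable_const (M := 1) (ae_of_all _ fun _ => by simp) (hconv i) (hconv i)
  have hDn : Tendsto (fun n : ℕ => (∑ i, ∑ j, ∫ x in unitB, g i j x ^ 2) + 9 * (1 / ((n : ℝ) + 1)))
      atTop (𝓝 (∑ i, ∑ j, ∫ x in unitB, g i j x ^ 2)) := by
    simpa using (h0.const_mul 9).const_add (∑ i, ∑ j, ∫ x in unitB, g i j x ^ 2)
  refine le_of_tendsto (tendsto_hessPairing q hwn hwm hconv).abs ?_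
  filter_upwards [hnorm.eventually_lt_const hw, hDn.eventually_lt_const hD] with n h1 h2
  exact hle (U n) q α δ F (hU1 n) hα hδ hF h1.le ((hU3 n).trans h2.le) hq

lemma exists_cutoff {r : ℝ} (hr0 : 0 < r) (hr : r < 1) : ∃ χ : E3 → ℝ, ContDiff ℝ (⊤ : ℕ∞) χ ∧
    tsupport χ ⊆ unitB ∧ ∀ x ∈ closedBall (0 : E3) r, χ x = 1 := by
  let b : ContDiffBump (0 : E3) := ⟨r, (r + 1) / 2, hr0, by linarith⟩
  refine ⟨b, b.contDiff, ?_, fun x hx => b.one_of_mem_closedBall hx⟩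
  rw [b.tsupport_eq]
  exact closedBall_subset_ball (by change (r + 1) / 2 < 1; linarith)

lemma aemeasurable_of_integrableOn_mul {g : E3 → ℝ}
    (h : ∀ φ : E3 → ℝ, ContDiff ℝ (⊤ : ℕ∞) φ → tsupport φ ⊆ unitB →
      IntegrableOn (fun x => g x * φ x) unitB) : AEMeasurable g (volume.restrict unitB) := by
  have hr : ∀ n : ℕ, (0 : ℝ) < (n + 1) / (n + 2) ∧ ((n : ℝ) + 1) / (n + 2) < 1 := fun n =>
    ⟨by positivity, by rw [div_lt_one (by positivity)]; linarith⟩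
  have hU : unitB = ⋃ n : ℕ, ball (0 : E3) ((n + 1) / (n + 2)) := by
    refine Subset.antisymm (fun x hx => ?_) (iUnion_subset fun n => ball_subset_ball (hr n).2.le)
    have hx1 : ‖x‖ < 1 := mem_ball_zero_iff.1 hx
    obtain ⟨n, hn⟩ := exists_nat_gt (1 / (1 - ‖x‖))
    refine mem_iUnion.2 ⟨n, mem_ball_zero_iff.2 ?_⟩
    rw [div_lt_iff₀ (by linarith)] at hn
    rw [lt_div_iff₀ (by positivity)]
    nlinarith
  rw [hU, aemeasurable_iUnion_iff]
  intro n
  obtain ⟨χ, hχ, hsupp, hχ1⟩ := exists_cutoff (hr n).1 (hr n).2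
  have h1 : AEMeasurable (fun x => g x * χ x) (volume.restrict (ball 0 (((n : ℝ) + 1) / (n + 2)))) :=
    ((h χ hχ hsupp).aestronglyMeasurable.aemeasurable).mono_measure
      (Measure.restrict_mono (ball_subset_ball (hr n).2.le) le_rfl)
  refine h1.congr ((ae_restrict_iff' measurableSet_ball).2 (ae_of_all _ fun x hx => ?_))
  simp only [hχ1 x (ball_subset_closedBall hx), mul_one]

/-- A weak derivative, understood with the convention that nonintegrable functions have integral
zero, may be replaced by a measurable one that is not larger. -/
lemma IsWeakDeriv.exists_memLp {f g S : E3 → ℝ} {j : Fin 3} (h : IsWeakDeriv f j g)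
    (hf : IntegrableOn f unitB) (hS : IntegrableOn S unitB) (hgS : ∀ x, g x ^ 2 ≤ S x) :
    ∃ g' : E3 → ℝ, MemLp g' 2 (volume.restrict unitB) ∧ IsWeakDeriv f j g' ∧
      ∀ x, g' x ^ 2 ≤ g x ^ 2 := by
  by_cases hg : ∀ φ : E3 → ℝ, ContDiff ℝ (⊤ : ℕ∞) φ → tsupport φ ⊆ unitB →
      IntegrableOn (fun x => g x * φ x) unitB
  · have hm := aemeasurable_of_integrableOn_mul hg
    refine ⟨g, (memLp_two_iff_integrable_sq hm.aestronglyMeasurable).2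
      (hS.mono' (hm.pow_const 2).aestronglyMeasurable (ae_of_all _ fun x => ?_)), h, fun x => le_rfl⟩
    rw [Real.norm_of_nonneg (sq_nonneg _)]
    exact hgS x
  · push Not at hg
    obtain ⟨φ₀, hφ₀, hs₀, hi₀⟩ := hg
    refine ⟨0, MemLp.zero, fun φ hφ hs => ?_, fun x => by simp [sq_nonneg]⟩
    simp only [Pi.zero_apply, zero_mul, integral_zero, neg_zero]
    have hz : ∀ ψ : E3 → ℝ, ContDiff ℝ (⊤ : ℕ∞) ψ → tsupport ψ ⊆ unitB →
        ¬ IntegrableOn (fun x => g x * ψ x) unitB → ∫ x in unitB, f x * pd j ψ x = 0 :=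
      fun ψ hψ hs hi => by rw [h ψ hψ hs, integral_undef hi, neg_zero]
    by_cases hi : IntegrableOn (fun x => g x * φ x) unitB
    · have hi1 : ¬ IntegrableOn (fun x => g x * (φ + φ₀) x) unitB := fun hc => hi₀ <| by
        refine (hc.sub hi).congr (ae_of_all _ fun x => ?_)
        simp only [Pi.sub_apply, Pi.add_apply]; ring
      have h1 := hz (φ + φ₀) (hφ.add hφ₀)
        ((tsupport_add φ φ₀).trans (union_subset hs hs₀)) hi1
      have h2 := hz φ₀ hφ₀ hs₀ hi₀
      have hInt : ∀ ψ : E3 → ℝ, ContDiff ℝ (⊤ : ℕ∞) ψ →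
          IntegrableOn (fun x => f x * pd j ψ x) unitB := fun ψ hψ => by
        have hc := continuous_pd (hψ.of_le (by exact_mod_cast le_top : (1 : WithTop ℕ∞) ≤ _)) j
        obtain ⟨M, hM⟩ := (isCompact_closedBall (0 : E3) 1).exists_bound_of_continuousOn
          hc.continuousOn
        exact Integrable.mul_bdd hf hc.aestronglyMeasurable
          ((ae_restrict_iff' measurableSet_unitB).2 (ae_of_all _ fun x hx =>
            hM x (ball_subset_closedBall hx)))
      have h3 : ∫ x in unitB, f x * pd j (φ + φ₀) x =
          (∫ x in unitB, f x * pd j φ x) + ∫ x in unitB, f x * pd j φ₀ x := by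
        rw [← integral_add (hInt φ hφ) (hInt φ₀ hφ₀)]
        refine integral_congr_ae (ae_of_all _ fun x => ?_)
        have d1 := hφ.differentiable (by simp) x
        have d2 := hφ₀.differentiable (by simp) x
        simp only [pd, fderiv_add d1 d2, add_apply, mul_add]
      linarith
    · exact hz φ hφ hs hi

lemma exists_ev_sub_le {k : E3 → ℝ} (hk : Continuous k) {η : ℝ} (hη : 0 < η) :
    ∃ P : MvPolynomial (Fin 3) ℝ, ∀ x ∈ closedBall (0 : E3) 1, |ev P x - k x| ≤ η := by
  let X := closedBall (0 : E3) 1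
  have : CompactSpace X := isCompact_iff_compactSpace.1 (isCompact_closedBall _ _)
  let c : Fin 3 → C(X, ℝ) := fun i => ⟨fun x => x.1 i, by fun_prop⟩
  have hc : ∀ P x, (MvPolynomial.aeval c P : C(X, ℝ)) x = ev P x.1 := fun P x => by
    induction P using MvPolynomial.induction_on with
    | C a => simp [ev]
    | add p q hp hq => simp only [map_add, ContinuousMap.add_apply, hp, hq, ev_add]
    | mul_X p i hp =>
      simp only [map_mul, ContinuousMap.mul_apply, hp, ev_mul, MvPolynomial.aeval_X]
      simp [ev, c]
  have hsep : (MvPolynomial.aeval c : MvPolynomial (Fin 3) ℝ →ₐ[ℝ] C(X, ℝ)).range.SeparatesPoints := by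
    intro x y hxy
    obtain ⟨i, hi⟩ : ∃ i, x.1 i ≠ y.1 i := by
      by_contra hcon
      push Not at hcon
      exact hxy (Subtype.ext (PiLp.ext hcon))
    exact ⟨c i, ⟨c i, ⟨MvPolynomial.X i, by simp⟩, rfl⟩, hi⟩
  obtain ⟨⟨-, P, rfl⟩, hP⟩ := ContinuousMap.exists_mem_subalgebra_near_continuous_of_separatesPoints
    _ hsep (fun x : X => k x.1) (by fun_prop) η hη
  refine ⟨P, fun x hx => ?_⟩
  have := (hP ⟨x, hx⟩).le
  rw [← Real.norm_eq_abs, ← hc P ⟨x, hx⟩]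
  exact this

/-- Polynomials are dense in the space of cube integrable functions on the unit ball. -/
lemma exists_ev_eLpNorm_sub_le {f : E3 → ℝ} (hf : MemLp f 3 (volume.restrict unitB)) {ε : ℝ}
    (hε : 0 < ε) : ∃ P : MvPolynomial (Fin 3) ℝ,
      eLpNorm (fun x => f x - ev P x) 3 (volume.restrict unitB) ≤ ENNReal.ofReal ε := by
  have he : ENNReal.ofReal (ε / 2) ≠ 0 := by
    rw [Ne, ENNReal.ofReal_eq_zero]; linarith
  obtain ⟨k, -, hkf, hk, -⟩ := ((memLp_indicator_iff_restrict measurableSet_unitB).2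
    hf).exists_hasCompactSupport_eLpNorm_sub_le (by norm_num) he
  have hkf' : eLpNorm (f - k) 3 (volume.restrict unitB) ≤ ENNReal.ofReal (ε / 2) := by
    refine le_trans (le_of_eq (eLpNorm_congr_ae ?_))
      ((eLpNorm_mono_measure _ Measure.restrict_le_self).trans hkf)
    refine (ae_restrict_iff' measurableSet_unitB).2 (ae_of_all _ fun x hx => ?_)
    simp only [Pi.sub_apply, indicator_of_mem hx]
  obtain ⟨V, hV0, hV⟩ : ∃ V : ℝ, 0 ≤ V ∧
      volume.restrict unitB univ ^ (ENNReal.toReal 3)⁻¹ = ENNReal.ofReal V :=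
    ⟨_, ENNReal.toReal_nonneg, (ENNReal.ofReal_toReal
      (ENNReal.rpow_ne_top_of_nonneg (by norm_num) (measure_ne_top _ _))).symm⟩
  obtain ⟨P, hP⟩ := exists_ev_sub_le hk (η := ε / (2 * (V + 1))) (by positivity)
  have hkP : eLpNorm (k - ev P) 3 (volume.restrict unitB) ≤ ENNReal.ofReal (ε / 2) := by
    refine (eLpNorm_le_of_ae_bound (C := ε / (2 * (V + 1))) ((ae_restrict_iff'
      measurableSet_unitB).2 (ae_of_all _ fun x hx => ?_))).trans ?_
    · rw [Pi.sub_apply, norm_sub_rev]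
      exact hP x (ball_subset_closedBall hx)
    · rw [hV, ← ENNReal.ofReal_mul hV0]
      refine ENNReal.ofReal_le_ofReal ?_
      rw [mul_div_assoc', div_le_div_iff₀ (by positivity) (by norm_num)]
      nlinarith
  refine ⟨P, ?_⟩
  have hd : (fun x => f x - ev P x) = (f - k) + (k - ev P) := by
    ext x; simp
  rw [hd, ← add_halves ε, ENNReal.ofReal_add (by positivity) (by positivity)]
  exact (eLpNorm_add_le (hf.aestronglyMeasurable.sub hk.aestronglyMeasurable)
    (hk.sub (continuous_ev P)).aestronglyMeasurable (by norm_num)).trans (add_le_add hkf' hkP)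

lemma integral_abs_rpow_le_of_forall_ev {p : E3 → ℝ}
    (hpm : AEStronglyMeasurable p (volume.restrict unitB))
    (hp : IntegrableOn (fun x => |p x| ^ (3 / 2 : ℝ)) unitB) {K : ℝ} (hK : 0 ≤ K)
    (h : ∀ (P : MvPolynomial (Fin 3) ℝ) (F : ℝ), 0 < F → ∫ x in unitB, |ev P x| ^ 3 ≤ F ^ 3 →
      |∫ x in unitB, p x * ev P x| ≤ K * F) :
    ∫ x in unitB, |p x| ^ (3 / 2 : ℝ) ≤ K ^ (3 / 2 : ℝ) := by
  obtain ⟨J, hJ⟩ : ∃ J, J = ∫ x in unitB, |p x| ^ (3 / 2 : ℝ) := ⟨_, rfl⟩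
  have hJ0 : 0 ≤ J := hJ ▸ integral_nonneg fun x => by positivity
  obtain ⟨f, hf⟩ : ∃ f : E3 → ℝ, f = fun x => p x * |p x| ^ (-(1 / 2) : ℝ) := ⟨_, rfl⟩
  have hfm : AEStronglyMeasurable f (volume.restrict unitB) := by
    rw [hf]
    exact (hpm.aemeasurable.mul
      ((measurable_norm.comp_aemeasurable hpm.aemeasurable).pow_const _)).aestronglyMeasurable
  have hfabs : ∀ x, |f x| = |p x| ^ (1 / 2 : ℝ) := fun x => by
    rw [hf, abs_mul, abs_of_nonneg (by positivity : 0 ≤ |p x| ^ (-(1 / 2) : ℝ))]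
    rcases (abs_nonneg (p x)).eq_or_lt with h0 | h0
    · rw [← h0]; norm_num
    · rw [← Real.rpow_one_add' h0.le (by norm_num)]; norm_num
  have hfp : ∀ x, p x * f x = |p x| ^ (3 / 2 : ℝ) := fun x => by
    have h1 : p x * f x = |p x| * |f x| := by
      rw [hf, abs_mul, abs_of_nonneg (by positivity : 0 ≤ |p x| ^ (-(1 / 2) : ℝ)), ← mul_assoc,
        ← mul_assoc, abs_mul_abs_self]
    rw [h1, hfabs, ← Real.rpow_one_add' (abs_nonneg _) (by norm_num)]
    norm_num
  have hf3 : ∀ x, |f x| ^ 3 = |p x| ^ (3 / 2 : ℝ) := fun x => by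
    rw [hfabs, ← Real.rpow_natCast, ← Real.rpow_mul (abs_nonneg _)]; norm_num
  have hp32 : MemLp p (ENNReal.ofReal (3 / 2)) (volume.restrict unitB) := by
    rw [← integrable_norm_rpow_iff hpm (by simp) (by simp),
      ENNReal.toReal_ofReal (by norm_num)]
    exact hp
  have hfL : MemLp f 3 (volume.restrict unitB) := by
    rw [← integrable_norm_rpow_iff hfm (by simp) (by simp)]
    refine hp.congr (ae_of_all _ fun x => ?_)
    simp only [ENNReal.toReal_ofNat, Real.rpow_ofNat, Real.norm_eq_abs, hf3]
  have hconj : Real.HolderConjugate (3 / 2) 3 := by constructor <;> norm_num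
  have hInt : ∀ z : E3 → ℝ, MemLp z 3 (volume.restrict unitB) →
      IntegrableOn (fun x => p x * z x) unitB ∧
        ∫ x in unitB, p x * z x ≤ J ^ (2 / 3 : ℝ) * (∫ x in unitB, |z x| ^ 3) ^ (1 / 3 : ℝ) := by
    intro z hz
    have hz' : MemLp z (ENNReal.ofReal 3) (volume.restrict unitB) := by simpa using hz
    have : (ENNReal.ofReal (3 / 2)).HolderTriple (ENNReal.ofReal 3) 1 := hconj.ennrealOfReal
    have hi : IntegrableOn (fun x => p x * z x) unitB := hp32.integrable_mul hz'
    refine ⟨hi, (integral_mono hi hi.norm fun x => le_abs_self _).trans ?_⟩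
    have h1 := integral_mul_norm_le_Lp_mul_Lq hconj hp32 hz'
    simp only [Real.norm_eq_abs, Real.rpow_ofNat, ← hJ] at h1
    simp only [Real.norm_eq_abs, abs_mul]
    rwa [show (1 / (3 / 2) : ℝ) = 2 / 3 by norm_num] at h1
  have hn : ∀ {z : E3 → ℝ}, MemLp z 3 (volume.restrict unitB) →
      (∫ x in unitB, |z x| ^ 3) ^ (1 / 3 : ℝ) = (eLpNorm z 3 (volume.restrict unitB)).toReal := by
    intro z hz
    rw [hz.eLpNorm_eq_integral_rpow_norm (by simp) (by simp), ENNReal.toReal_ofReal (by positivity)]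
    simp
  have hfn : (eLpNorm f 3 (volume.restrict unitB)).toReal = J ^ (1 / 3 : ℝ) := by
    rw [← hn hfL, hJ]; simp only [hf3]
  have key : ∀ ε : ℝ, 0 < ε → J ≤ K * (J ^ (1 / 3 : ℝ) + 2 * ε) + J ^ (2 / 3 : ℝ) * ε := by
    intro ε hε
    obtain ⟨P, hP⟩ := exists_ev_eLpNorm_sub_le hfL hε
    have hPL : MemLp (ev P) 3 (volume.restrict unitB) := (continuous_ev P).memLp_unitB 3
    have hdL : MemLp (fun x => f x - ev P x) 3 (volume.restrict unitB) := hfL.sub hPL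
    have h1 : (eLpNorm (ev P) 3 (volume.restrict unitB)).toReal ≤ J ^ (1 / 3 : ℝ) + ε := by
      rw [← hfn]
      have hd : ev P = f - fun x => f x - ev P x := by ext x; simp
      have h2 := eLpNorm_sub_le hfL.aestronglyMeasurable hdL.aestronglyMeasurable
        (p := 3) (by norm_num)
      rw [← hd] at h2
      refine (ENNReal.toReal_mono (ENNReal.add_ne_top.2
        ⟨hfL.eLpNorm_ne_top, hdL.eLpNorm_ne_top⟩) h2).trans ?_
      rw [ENNReal.toReal_add hfL.eLpNorm_ne_top hdL.eLpNorm_ne_top]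
      gcongr
      exact ENNReal.toReal_le_of_le_ofReal hε.le hP
    have h2 := h P (J ^ (1 / 3 : ℝ) + 2 * ε) (by positivity) (by
      have h3 : (∫ x in unitB, |ev P x| ^ 3) ^ (1 / 3 : ℝ) ≤ J ^ (1 / 3 : ℝ) + 2 * ε := by
        rw [hn hPL]; linarith
      have h4 : 0 ≤ ∫ x in unitB, |ev P x| ^ 3 := integral_nonneg fun x => by positivity
      calc _ = ((∫ x in unitB, |ev P x| ^ 3) ^ (1 / 3 : ℝ)) ^ 3 := by
            rw [← Real.rpow_natCast, ← Real.rpow_mul h4]; norm_num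
        _ ≤ _ := by gcongr)
    have h3 := (hInt _ hdL).2
    rw [hn hdL] at h3
    have h4 : (eLpNorm (fun x => f x - ev P x) 3 (volume.restrict unitB)).toReal ≤ ε :=
      ENNReal.toReal_le_of_le_ofReal hε.le hP
    have h5 : J = (∫ x in unitB, p x * ev P x) + ∫ x in unitB, p x * (f x - ev P x) := by
      rw [← integral_add (hInt _ hPL).1 (hInt _ hdL).1, hJ]
      refine integral_congr_ae (ae_of_all _ fun x => ?_)
      simp only [← hfp]; ring
    have h6 : J ^ (2 / 3 : ℝ) * (eLpNorm (fun x => f x - ev P x) 3 (volume.restrict unitB)).toReal ≤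
      J ^ (2 / 3 : ℝ) * ε := by gcongr
    have h7 := le_abs_self (∫ x in unitB, p x * ev P x)
    linarith
  have hlim : J ≤ K * J ^ (1 / 3 : ℝ) := by
    refine le_of_forall_pos_le_add fun ε hε => ?_
    have hM : 0 < 2 * K + J ^ (2 / 3 : ℝ) + 1 := by positivity
    have := key (ε / (2 * K + J ^ (2 / 3 : ℝ) + 1)) (by positivity)
    refine this.trans ?_
    have : (2 * K + J ^ (2 / 3 : ℝ)) * (ε / (2 * K + J ^ (2 / 3 : ℝ) + 1)) ≤ ε := by
      rw [mul_div_assoc', div_le_iff₀ hM]; nlinarith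
    linarith
  rw [← hJ]
  rcases hJ0.eq_or_lt with h0 | h0
  · rw [← h0]; positivity
  · have h8 : J ^ (2 / 3 : ℝ) ≤ K := by
      have h9 : J = J ^ (2 / 3 : ℝ) * J ^ (1 / 3 : ℝ) := by
        rw [← Real.rpow_add h0]; norm_num
      have h10 : 0 < J ^ (1 / 3 : ℝ) := by positivity
      rw [h9] at hlim
      exact le_of_mul_le_mul_right (hlim.trans_eq (by rw [← h9])) h10
    calc J = (J ^ (2 / 3 : ℝ)) ^ (3 / 2 : ℝ) := by rw [← Real.rpow_mul hJ0]; norm_num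
      _ ≤ _ := by gcongr

lemma integral_norm_sub_average_sq_le {u : E3 → E3} (hu : MemLp u 2 (volume.restrict unitB)) :
    ∫ x in unitB, ‖u x - ⨍ y in unitB, u y‖ ^ 2 ≤ ∫ x in unitB, ‖u x‖ ^ 2 := by
  have hui : IntegrableOn u unitB := hu.integrable (by norm_num)
  have hw : MemLp (fun x => u x - ⨍ y in unitB, u y) 2 (volume.restrict unitB) :=
    hu.sub (memLp_const _)
  have hsum : ∀ {z : E3 → E3}, MemLp z 2 (volume.restrict unitB) →
      ∫ x in unitB, ‖z x‖ ^ 2 = ∑ i, ∫ x in unitB, z x i ^ 2 := fun hz => by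
    simp only [EuclideanSpace.real_norm_sq_eq]
    exact integral_finsetSum _ fun i _ => (hz.eval_piLp i).integrable_sq
  rw [hsum hw, hsum hu]
  refine Finset.sum_le_sum fun i _ => ?_
  simp only [PiLp.sub_apply, average_coord hui]
  exact integral_sub_average_sq_le (hu.eval_piLp i)

open Filter Topology in
/-- The pressure estimate on the unit ball for a single time. -/
lemma exists_integral_abs_rpow_le : ∃ C : ℝ, 0 < C ∧ ∀ (u : E3 → E3)
    (g : Fin 3 → Fin 3 → E3 → ℝ) (p : E3 → ℝ),
    MemLp u 2 (volume.restrict unitB) → IntegrableOn (fun x => ∑ i, ∑ j, g i j x ^ 2) unitB →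
    (∀ i j, IsWeakDeriv (fun x => u x i) j (g i j)) →
    AEStronglyMeasurable p (volume.restrict unitB) →
    IntegrableOn (fun x => |p x| ^ (3 / 2 : ℝ)) unitB →
    (∀ q, ∫ x in unitB, p x * ev (lapP (rhoP * q)) x =
      - hessPairing (fun x => u x - ⨍ y in unitB, u y) q) →
    ∫ x in unitB, |p x| ^ (3 / 2 : ℝ) ≤
      C * ((∫ x in unitB, ‖u x‖ ^ 2) ^ (1 / 2 : ℝ) *
        ∫ x in unitB, ∑ i, ∑ j, g i j x ^ 2) := by
  obtain ⟨C, hC, hle⟩ := exists_abs_hessPairing_le_of_isWeakDeriv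
  refine ⟨C ^ (3 / 2 : ℝ), by positivity, fun u g p hu hg hug hpm hp hpq => ?_⟩
  have hgS : ∀ i j x, g i j x ^ 2 ≤ ∑ i, ∑ j, g i j x ^ 2 := fun i j x =>
    (Finset.single_le_sum (f := fun j => g i j x ^ 2) (fun _ _ => sq_nonneg _)
      (Finset.mem_univ j)).trans (Finset.single_le_sum (f := fun i => ∑ j, g i j x ^ 2)
        (fun _ _ => Finset.sum_nonneg fun _ _ => sq_nonneg _) (Finset.mem_univ i))
  choose g' hg'L hg'w hg'le using fun i j => (hug i j).exists_memLp
    ((hu.eval_piLp i).integrable (by norm_num)) hg (hgS i j)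
  obtain ⟨D, hD⟩ : ∃ D, D = ∫ x in unitB, ∑ i, ∑ j, g i j x ^ 2 := ⟨_, rfl⟩
  obtain ⟨U, hU⟩ : ∃ U, U = ∫ x in unitB, ‖u x‖ ^ 2 := ⟨_, rfl⟩
  have hD0 : 0 ≤ D := hD ▸ integral_nonneg fun x => by positivity
  have hU0 : 0 ≤ U := hU ▸ integral_nonneg fun x => by positivity
  have hD' : ∑ i, ∑ j, ∫ x in unitB, g' i j x ^ 2 ≤ D := by
    have hi : ∀ i j, IntegrableOn (fun x => g' i j x ^ 2) unitB := fun i j =>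
      (hg'L i j).integrable_sq
    simp only [← integral_finsetSum _ fun j _ => hi _ j]
    rw [← integral_finsetSum _ fun i _ => integrable_finsetSum _ fun j _ => hi i j, hD]
    refine integral_mono (integrable_finsetSum _ fun i _ => integrable_finsetSum _ fun j _ =>
      hi i j) hg fun x => ?_
    exact Finset.sum_le_sum fun i _ => Finset.sum_le_sum fun j _ => hg'le i j x
  have hroot : ∀ {y : ℝ}, 0 < y → ∀ n : ℕ, (y ^ (1 / 24 : ℝ)) ^ n = y ^ (n / 24 : ℝ) := fun hy n => by
    rw [← Real.rpow_natCast, ← Real.rpow_mul hy.le]; congr 1; ring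
  have key : ∀ ε : ℝ, 0 < ε → ∫ x in unitB, |p x| ^ (3 / 2 : ℝ) ≤
      C ^ (3 / 2 : ℝ) * ((U + ε) ^ (1 / 2 : ℝ) * (D + ε)) := fun ε hε => by
    have hUε : 0 < U + ε := by linarith
    have hDε : 0 < D + ε := by linarith
    refine (integral_abs_rpow_le_of_forall_ev hpm hp
      (K := C * (((U + ε) ^ (1 / 24 : ℝ)) ^ 8 * ((D + ε) ^ (1 / 24 : ℝ)) ^ 16)) (by positivity)
      fun P F hF hPF => ?_).trans_eq ?_
    · obtain ⟨q, hq⟩ := exists_lapP_rhoP_mul_eq P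
      rw [← hq] at hPF ⊢
      rw [hpq q, abs_neg]
      refine (hle u g' q ((U + ε) ^ (1 / 24 : ℝ)) ((D + ε) ^ (1 / 24 : ℝ)) F hu hg'L hg'w (by positivity) (by positivity) hF ?_ ?_ hPF).trans_eq
        (by ring)
      · rw [hroot hUε]
        norm_num
        exact (integral_norm_sub_average_sq_le hu).trans_lt (by rw [← hU]; linarith)
      · rw [hroot hDε]
        norm_num
        exact hD'.trans_lt (by linarith)
    · rw [hroot hUε, hroot hDε, Real.mul_rpow hC.le (by positivity),
        Real.mul_rpow (by positivity) (by positivity), ← Real.rpow_mul hUε.le,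
        ← Real.rpow_mul hDε.le]
      norm_num
  rw [← hU, ← hD]
  have hcont : Continuous fun ε : ℝ => C ^ (3 / 2 : ℝ) * ((U + ε) ^ (1 / 2 : ℝ) * (D + ε)) := by
    have : Continuous fun ε : ℝ => (U + ε) ^ (1 / 2 : ℝ) :=
      (continuous_const.add continuous_id).rpow_const fun _ => Or.inr (by norm_num)
    fun_prop
  have hlim := (hcont.tendsto 0).mono_left (nhdsWithin_le_nhds (s := Ioi 0))
  simp only [add_zero] at hlim
  exact ge_of_tendsto hlim (eventually_nhdsWithin_of_forall fun ε hε => key ε hε)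

lemma setIntegral_unitB_comp_smul {F : Type*} [NormedAddCommGroup F] [NormedSpace ℝ F] {r : ℝ}
    (hr : 0 < r) (f : E3 → F) :
    ∫ x in unitB, f (r • x) = (r ^ 3)⁻¹ • ∫ x in ballB r, f x := by
  rw [Measure.setIntegral_comp_smul_of_pos _ _ _ hr, smul_unitBall_of_pos hr,
    finrank_euclideanSpace_fin, ballB]

lemma setIntegral_ballB_eq {F : Type*} [NormedAddCommGroup F] [NormedSpace ℝ F] {r : ℝ}
    (hr : 0 < r) (f : E3 → F) :
    ∫ x in ballB r, f x = r ^ 3 • ∫ x in unitB, f (r • x) := by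
  rw [setIntegral_unitB_comp_smul hr, smul_inv_smul₀ (by positivity)]

lemma setAverage_unitB_comp_smul {F : Type*} [NormedAddCommGroup F] [NormedSpace ℝ F] {r : ℝ}
    (hr : 0 < r) (f : E3 → F) : ⨍ x in unitB, f (r • x) = ⨍ x in ballB r, f x := by
  have h := setIntegral_ballB_eq hr fun _ : E3 => (1 : ℝ)
  simp only [setIntegral_const, smul_eq_mul, mul_one] at h
  rw [setAverage_eq, setAverage_eq, setIntegral_unitB_comp_smul hr, h, mul_inv, smul_smul, mul_comm]

lemma map_smul_restrict_unitB {r : ℝ} (hr : 0 < r) :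
    (volume.restrict unitB).map (fun x : E3 => r • x) =
      ENNReal.ofReal (r ^ 3)⁻¹ • volume.restrict (ballB r) := by
  have hpre : (fun x : E3 => r • x) ⁻¹' ballB r = unitB := by
    ext x
    simp [ballB, norm_smul, abs_of_pos hr, hr]
  rw [← hpre, ← Measure.restrict_map (by fun_prop) (show MeasurableSet (ballB r) from
    measurableSet_ball), Measure.map_addHaar_smul _ hr.ne', finrank_euclideanSpace_fin,
    abs_of_pos (by positivity : 0 < (r ^ 3)⁻¹), Measure.restrict_smul]

lemma MemLp.comp_smul_unitB {F : Type*} [NormedAddCommGroup F] {r : ℝ} (hr : 0 < r) {f : E3 → F}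
    {p : ENNReal} (hf : MemLp f p (volume.restrict (ballB r))) :
    MemLp (fun x => f (r • x)) p (volume.restrict unitB) := by
  refine MemLp.comp_of_map (f := fun x : E3 => r • x) ?_ (by fun_prop)
  rw [map_smul_restrict_unitB hr]
  exact hf.smul_measure ENNReal.ofReal_ne_top

lemma AEStronglyMeasurable.comp_smul_unitB {F : Type*} [NormedAddCommGroup F] {r : ℝ} (hr : 0 < r)
    {f : E3 → F} (hf : AEStronglyMeasurable f (volume.restrict (ballB r))) :
    AEStronglyMeasurable (fun x => f (r • x)) (volume.restrict unitB) := by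
  refine AEStronglyMeasurable.comp_aemeasurable (f := fun x : E3 => r • x) ?_ (by fun_prop)
  rw [map_smul_restrict_unitB hr]
  exact hf.smul_measure _

lemma IntegrableOn.comp_smul_unitB {F : Type*} [NormedAddCommGroup F] {r : ℝ} (hr : 0 < r)
    {f : E3 → F} (hf : IntegrableOn f (ballB r)) : IntegrableOn (fun x => f (r • x)) unitB :=
  memLp_one_iff_integrable.1 (MemLp.comp_smul_unitB hr (memLp_one_iff_integrable.2 hf))

lemma pd_comp_smul (j : Fin 3) (f : E3 → ℝ) (c : ℝ) :
    pd j (fun y => f (c • y)) = fun y => c * pd j f (c • y) := by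
  ext y
  simp [pd, fderiv_comp_smul]

lemma pd_const_mul_comp_smul (j : Fin 3) (f : E3 → ℝ) (a c : ℝ) :
    pd j (fun y => a * f (c • y)) = fun y => a * (c * pd j f (c • y)) := by
  ext y
  have h := congrArg (fun L => L y (EuclideanSpace.single j (1 : ℝ)))
    (fderiv_const_smul_field (𝕜 := ℝ) (f := fun y => f (c • y)) a)
  exact h.trans (congrArg (a * ·) (congrFun (pd_comp_smul j f c) y))

/-- The pressure estimate on a ball of radius `r` for a single time. -/
lemma exists_setIntegral_ballB_abs_rpow_le : ∃ C : ℝ, 0 < C ∧ ∀ (r : ℝ) (V : E3 → E3)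
    (G : E3 → Fin 3 → Fin 3 → ℝ) (P : E3 → ℝ), 0 < r →
    MemLp V 2 (volume.restrict (ballB r)) →
    IntegrableOn (fun x => ∑ i, ∑ j, G x i j ^ 2) (ballB r) →
    (∀ φ : E3 → ℝ, ContDiff ℝ (⊤ : ℕ∞) φ → tsupport φ ⊆ ballB r → ∀ i j,
      ∫ x in ballB r, V x i * pd j φ x = - ∫ x in ballB r, G x i j * φ x) →
    AEStronglyMeasurable P (volume.restrict (ballB r)) →
    IntegrableOn (fun x => |P x| ^ (3 / 2 : ℝ)) (ballB r) →
    (∀ φ : E3 → ℝ, ContDiff ℝ 2 φ → (∀ x ∈ sphere (0 : E3) r, φ x = 0) →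
      ∫ x in ballB r, P x * ∑ j, pd j (pd j φ) x =
        - ∫ x in ballB r, ∑ i, ∑ j,
          ((V x i - (⨍ y in ballB r, V y) i) * (V x j - (⨍ y in ballB r, V y) j) -
            ⨍ y in ballB r, (V y i - (⨍ w in ballB r, V w) i) * (V y j - (⨍ w in ballB r, V w) j))
          * pd i (pd j φ) x) →
    ∫ x in ballB r, |P x| ^ (3 / 2 : ℝ) ≤
      C * r ^ (1 / 2 : ℝ) * ((∫ x in ballB r, ‖V x‖ ^ 2) ^ (1 / 2 : ℝ) *
        ∫ x in ballB r, ∑ i, ∑ j, G x i j ^ 2) := by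
  obtain ⟨C, hC, hle⟩ := exists_integral_abs_rpow_le
  refine ⟨C, hC, fun r V G P hr hV hG hVG hPm hP hPV => ?_⟩
  have hr0 := hr.ne'
  have h := hle (fun x => V (r • x)) (fun i j x => r * G (r • x) i j) (fun x => P (r • x))
    (MemLp.comp_smul_unitB hr hV) ?_ (fun i j φ hφ hφs => ?_)
    (AEStronglyMeasurable.comp_smul_unitB hr hPm) (IntegrableOn.comp_smul_unitB hr hP)
    (fun q => ?_)
  · have hA : 0 ≤ ∫ x in ballB r, ‖V x‖ ^ 2 := integral_nonneg fun x => by positivity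
    simp only [mul_pow, ← Finset.mul_sum, integral_const_mul] at h
    rw [setIntegral_unitB_comp_smul hr (fun x => |P x| ^ (3 / 2 : ℝ)),
      setIntegral_unitB_comp_smul hr (fun x => ‖V x‖ ^ 2),
      setIntegral_unitB_comp_smul hr (fun x => ∑ i, ∑ j, G x i j ^ 2)] at h
    simp only [smul_eq_mul] at h
    rw [inv_mul_le_iff₀ (by positivity), Real.mul_rpow (by positivity) hA] at h
    refine h.trans_eq ?_
    have hs : ((r ^ 3)⁻¹ : ℝ) ^ (1 / 2 : ℝ) * r ^ 2 = r ^ (1 / 2 : ℝ) := by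
      rw [← Real.rpow_natCast, ← Real.rpow_natCast, ← Real.rpow_neg hr.le, ← Real.rpow_mul hr.le,
        ← Real.rpow_add hr]
      norm_num
    rw [← hs]
    field_simp
  · simp only [mul_pow, ← Finset.mul_sum]
    exact (IntegrableOn.comp_smul_unitB hr hG).const_mul _
  · have h := hVG (fun y => φ (r⁻¹ • y)) (hφ.comp (contDiff_const_smul _)) ?_ i j
    · rw [setIntegral_ballB_eq hr, setIntegral_ballB_eq hr, pd_comp_smul] at h
      simp only [inv_smul_smul₀ hr0, smul_eq_mul] at h
      rw [← mul_neg, mul_right_inj' (by positivity)] at h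
      simp only [mul_assoc, integral_const_mul, mul_left_comm _ r⁻¹] at h ⊢
      rw [inv_mul_eq_iff_eq_mul₀ hr0] at h
      rw [h]; ring
    · intro y hy
      have h1 : r⁻¹ • y ∈ tsupport φ :=
        tsupport_comp_subset_preimage φ (f := fun y : E3 => r⁻¹ • y) (by fun_prop) hy
      have h2 := hφs h1
      rw [mem_ball_zero_iff, norm_smul, norm_inv, Real.norm_of_nonneg hr.le,
        inv_mul_lt_iff₀ hr, mul_one] at h2
      simpa [ballB] using h2
  · have h := hPV (fun y => ev (rhoP * q) (r⁻¹ • y)) ((contDiff_ev _).comp (contDiff_const_smul _))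
      fun x hx => ?_
    · simp only [pd_comp_smul, pd_const_mul_comp_smul, pd_ev] at h
      rw [setIntegral_ballB_eq hr, setIntegral_ballB_eq hr, ← setAverage_unitB_comp_smul hr V] at h
      simp only [inv_smul_smul₀ hr0, smul_eq_mul, mul_left_comm _ r⁻¹, ← Finset.mul_sum,
        integral_const_mul] at h
      rw [← mul_neg, ← mul_neg, ← mul_neg, mul_right_inj' (by positivity),
        mul_right_inj' (by positivity), mul_right_inj' (by positivity)] at h
      simp only [lapP_apply, ev_sum, hessPairing, PiLp.sub_apply]
      rw [h]
      refine congrArg Neg.neg (integral_congr_ae (.of_forall fun x => ?_))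
      refine Finset.sum_congr rfl fun i _ => Finset.sum_congr rfl fun j _ => ?_
      rw [← setAverage_unitB_comp_smul hr fun y => (V y i - (⨍ x in unitB, V (r • x)) i) *
        (V y j - (⨍ x in unitB, V (r • x)) j)]
    · rw [ev_mul, ev_rhoP, bdef_sphere, zero_mul]
      rw [mem_sphere_zero_iff_norm] at hx ⊢
      rw [norm_smul, hx, norm_inv, Real.norm_of_nonneg hr.le, inv_mul_cancel₀ hr0]

/-- Estimate (2.10) for the non-harmonic part of the pressure: if `p₁` solves, for a.e. `t`,
the variational identity `∫_{B(ϱ)} p₁ Δφ = -∫_{B(ϱ)} (τ - τ_ϱ) : ∇²φ` for all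
`φ ∈ C²(cl B(ϱ))` vanishing on `∂B(ϱ)`, where `τ = (v - c_ϱ) ⊗ (v - c_ϱ)`, then
`(1/ϱ²) ∫_{Q(ϱ)} |p₁|^{3/2} ≤ c E(ϱ) A^{1/2}(ϱ)` with a universal constant `c`. -/
theorem pressure_nonharmonic_part_estimate :
    ∃ c : ℝ, 0 < c ∧
      ∀ (ϱ : ℝ) (v : E3 → ℝ → E3) (gv : E3 → ℝ → Fin 3 → Fin 3 → ℝ)
        (p₁ : E3 → ℝ → ℝ),
        0 < ϱ → ϱ ≤ 1 →
        VelocityClass v gv ϱ →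
        AEMeasurable (fun z : E3 × ℝ => p₁ z.1 z.2) (volume.restrict (QSet ϱ)) →
        (∀ᵐ t ∂(volume.restrict (timeI ϱ)),
          IntegrableOn (fun x => |p₁ x t| ^ ((3 : ℝ) / 2)) (ballB ϱ)) →
        (∀ᵐ t ∂(volume.restrict (timeI ϱ)),
          ∀ φ : E3 → ℝ, ContDiffOn ℝ 2 φ (Metric.closedBall (0 : E3) ϱ) →
            (∀ x ∈ Metric.sphere (0 : E3) ϱ, φ x = 0) →
            (∫ x in ballB ϱ, p₁ x t *
                ∑ j, fderiv ℝ (fun y => fderiv ℝ φ y (EuclideanSpace.single j (1 : ℝ))) x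
                  (EuclideanSpace.single j (1 : ℝ)))
              = - ∫ x in ballB ϱ, ∑ i, ∑ j,
                  ((v x t i - (⨍ y in ballB ϱ, v y t) i)
                      * (v x t j - (⨍ y in ballB ϱ, v y t) j)
                    - ⨍ y in ballB ϱ, (v y t i - (⨍ w in ballB ϱ, v w t) i)
                        * (v y t j - (⨍ w in ballB ϱ, v w t) j))
                  * fderiv ℝ (fun y => fderiv ℝ φ y (EuclideanSpace.single j (1 : ℝ))) x
                      (EuclideanSpace.single i (1 : ℝ))) →
        (1 / ϱ ^ 2) * ∫ t in timeI ϱ, ∫ x in ballB ϱ, |p₁ x t| ^ ((3 : ℝ) / 2)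
          ≤ c * funE gv ϱ * funA v ϱ ^ ((1 : ℝ) / 2) := by
  obtain ⟨C, hC, hle⟩ := exists_setIntegral_ballB_abs_rpow_le
  refine ⟨C, hC, fun ϱ v gv p₁ hϱ _ hv hpm hpi hpv => ?_⟩
  have hprod : volume.restrict (QSet ϱ) =
      (volume.restrict (ballB ϱ)).prod (volume.restrict (timeI ϱ)) := by
    rw [QSet, Measure.prod_restrict, Measure.volume_eq_prod]
  have hvm := hv.v_meas
  have hv2 := hv.v_L2
  have hgv := hv.grad_L2
  rw [IntegrableOn, hprod] at hv2 hgv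
  rw [hprod] at hvm hpm
  obtain ⟨M, hM⟩ := hv.v_Linfty
  have hA : ∀ᵐ t ∂(volume.restrict (timeI ϱ)),
      (1 / ϱ) * ∫ x in ballB ϱ, ‖v x t‖ ^ 2 ≤ funA v ϱ :=
    ae_le_essSup ⟨(1 / ϱ) * M, Filter.eventually_map.2 <| hM.mono fun t ht => by gcongr⟩
  have hslice : ∀ᵐ t ∂(volume.restrict (timeI ϱ)),
      ∫ x in ballB ϱ, |p₁ x t| ^ ((3 : ℝ) / 2) ≤
        C * ϱ * funA v ϱ ^ ((1 : ℝ) / 2) * ∫ x in ballB ϱ, ∑ i, ∑ j, gv x t i j ^ 2 := by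
    filter_upwards [hvm.aestronglyMeasurable.prod_swap.prodMk_left, hv2.swap.prod_right_ae,
      hgv.swap.prod_right_ae, hpm.aestronglyMeasurable.prod_swap.prodMk_left, hpi, hpv, hv.isGrad,
      hA] with t h1 h2 h3 h4 h5 h6 h7 h8
    have hD : 0 ≤ ∫ x in ballB ϱ, ∑ i, ∑ j, gv x t i j ^ 2 :=
      integral_nonneg fun x => by positivity
    have hU : 0 ≤ ∫ x in ballB ϱ, ‖v x t‖ ^ 2 := integral_nonneg fun x => by positivity
    have hUA : (∫ x in ballB ϱ, ‖v x t‖ ^ 2) ^ ((1 : ℝ) / 2) ≤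
        ϱ ^ ((1 : ℝ) / 2) * funA v ϱ ^ ((1 : ℝ) / 2) := by
      have h9 := Real.rpow_le_rpow (by positivity) h8 (by norm_num : (0 : ℝ) ≤ 1 / 2)
      rwa [one_div_mul_eq_div, Real.div_rpow hU hϱ.le, div_le_iff₀' (by positivity)] at h9
    have hsq : ϱ ^ ((1 : ℝ) / 2) * ϱ ^ ((1 : ℝ) / 2) = ϱ := by
      rw [← Real.rpow_add hϱ]
      norm_num
    refine (hle ϱ (fun x => v x t) (fun x => gv x t) (fun x => p₁ x t) hϱ
      ((memLp_two_iff_integrable_sq_norm h1).2 h2) h3 h7 h4 h5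
      fun φ hφ hφ0 => h6 φ hφ.contDiffOn hφ0).trans ?_
    calc _ ≤ C * ϱ ^ ((1 : ℝ) / 2) * (ϱ ^ ((1 : ℝ) / 2) * funA v ϱ ^ ((1 : ℝ) / 2) *
          ∫ x in ballB ϱ, ∑ i, ∑ j, gv x t i j ^ 2) := by gcongr
      _ = C * (ϱ ^ ((1 : ℝ) / 2) * ϱ ^ ((1 : ℝ) / 2)) * funA v ϱ ^ ((1 : ℝ) / 2) *
          ∫ x in ballB ϱ, ∑ i, ∑ j, gv x t i j ^ 2 := by ring
      _ = _ := by rw [hsq]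
  have hInt := integral_mono_of_nonneg
    (.of_forall fun t => integral_nonneg fun x => by positivity)
    (hgv.swap.integral_prod_left.const_mul (C * ϱ * funA v ϱ ^ ((1 : ℝ) / 2))) hslice
  rw [integral_const_mul] at hInt
  rw [one_div_mul_eq_div, div_le_iff₀ (by positivity)]
  refine hInt.trans_eq ?_
  simp only [funE, Function.comp_apply, Prod.swap]
  field_simp
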